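/- Let a < b, T > 0, Q = (a,b) × (0,T], and let u₀ satisfy (2.8) with zeros x₁ < ⋯ < x_k, N₀ = {x₁,…,x_k}, N = N₀ × [0,T]. Then there exists exactly one classical solution u of the limit problem (2.7): namely, there exists a unique u ∈ C([a,b]×[0,T]) such that u(x,t) = 0 if and only if (x,t) ∈ N, u is C^{2,1} (twice continuously differentiable in x and once in t) on Q ∖ N, u(a,t) = −1 and u(b,t) = 1 for all t ∈ (0,T], u(x,0) = u₀(x) for x ∈ (a,b), and u_t = |u| u_xx + u(1 − |u|) holds pointwise on Q ∖ N. -/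

import Mathlib

open Set Filter MeasureTheory Topology

/-- Partial derivative in `x` of `u(x,t)`. -/
noncomputable def pdx (u : ℝ → ℝ → ℝ) (x t : ℝ) : ℝ := deriv (fun y => u y t) x

/-- Second partial derivative in `x` of `u(x,t)`. -/
noncomputable def pdxx (u : ℝ → ℝ → ℝ) (x t : ℝ) : ℝ := deriv (fun y => pdx u y t) x

/-- Partial derivative in `t` of `u(x,t)`, one-sided at `t = T`. -/
noncomputable def pdtW (T : ℝ) (u : ℝ → ℝ → ℝ) (x t : ℝ) : ℝ :=
  derivWithin (fun s => u x s) (Set.Iic T) t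

/-- `Q = (a,b) × (0,T]`. -/
def QT (a b T : ℝ) : Set (ℝ × ℝ) := Set.Ioo a b ×ˢ Set.Ioc 0 T

/-- `N = N₀ × [0,T]`. -/
def NSet (N₀ : Set ℝ) (T : ℝ) : Set (ℝ × ℝ) := N₀ ×ˢ Set.Icc 0 T

/-- Condition (2.8): `u₀` is continuous, `u₀(a) = -1`, `u₀(b) = 1`, the zeros of `u₀`
form the finite set `N₀ ⊆ (a,b)`, and `u₀` changes sign at each of its zeros. -/
structure InitData (a b : ℝ) (N₀ : Set ℝ) (u₀ : ℝ → ℝ) : Prop where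
  cont : ContinuousOn u₀ (Set.Icc a b)
  bdry_a : u₀ a = -1
  bdry_b : u₀ b = 1
  fin : N₀.Finite
  sub : N₀ ⊆ Set.Ioo a b
  zeros : ∀ x ∈ Set.Icc a b, (u₀ x = 0 ↔ x ∈ N₀)
  sign_change : ∀ x ∈ N₀, ∀ δ > 0,
    ∃ y ∈ Set.Ioo (x - δ) x, ∃ z ∈ Set.Ioo x (x + δ), u₀ y * u₀ z < 0

/-- A classical solution of the limit problem (2.7): `u ∈ C(Q̄)` vanishing exactly on `N`,
`C^{2,1}` on `Q ∖ N`, with boundary values `∓1`, initial value `u₀`, satisfying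
`u_t = |u| u_xx + u(1-|u|)` on `Q ∖ N`. -/
structure IsClassicalSol (a b T : ℝ) (N₀ : Set ℝ) (u₀ : ℝ → ℝ) (u : ℝ → ℝ → ℝ) : Prop where
  cont : ContinuousOn (fun p : ℝ × ℝ => u p.1 p.2) (Set.Icc a b ×ˢ Set.Icc 0 T)
  zero_iff : ∀ x ∈ Set.Icc a b, ∀ t ∈ Set.Icc 0 T, (u x t = 0 ↔ x ∈ N₀)
  diff_x : ∀ p ∈ QT a b T \ NSet N₀ T, DifferentiableAt ℝ (fun y => u y p.2) p.1
  diff_xx : ∀ p ∈ QT a b T \ NSet N₀ T, DifferentiableAt ℝ (fun y => pdx u y p.2) p.1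
  diff_t : ∀ p ∈ QT a b T \ NSet N₀ T,
    DifferentiableWithinAt ℝ (fun s => u p.1 s) (Set.Iic T) p.2
  cont_x : ContinuousOn (fun p : ℝ × ℝ => pdx u p.1 p.2) (QT a b T \ NSet N₀ T)
  cont_xx : ContinuousOn (fun p : ℝ × ℝ => pdxx u p.1 p.2) (QT a b T \ NSet N₀ T)
  cont_t : ContinuousOn (fun p : ℝ × ℝ => pdtW T u p.1 p.2) (QT a b T \ NSet N₀ T)
  bdry_a : ∀ t ∈ Set.Ioc 0 T, u a t = -1
  bdry_b : ∀ t ∈ Set.Ioc 0 T, u b t = 1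
  init : ∀ x ∈ Set.Ioo a b, u x 0 = u₀ x
  pde : ∀ p ∈ QT a b T \ NSet N₀ T,
    pdtW T u p.1 p.2 = |u p.1 p.2| * pdxx u p.1 p.2 + u p.1 p.2 * (1 - |u p.1 p.2|)

/-- First-touching principle for finitely many functions of time: if all start negative and any of
them that reaches zero (while the others are nonpositive) has negative derivative there, then all
stay negative. -/
theorem neg_of_touching {ι : Type*} (I : Finset ι) (φ : ι → ℝ → ℝ) {t₀ t₁ : ℝ}
    (hc : ∀ i ∈ I, ContinuousOn (φ i) (Icc t₀ t₁)) (h0 : ∀ i ∈ I, φ i t₀ < 0)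
    (hd : ∀ i ∈ I, ∀ t ∈ Ioc t₀ t₁, (∀ j ∈ I, φ j t ≤ 0) → φ i t = 0 →
      ∃ d < 0, HasDerivAt (φ i) d t) :
    ∀ i ∈ I, ∀ t ∈ Icc t₀ t₁, φ i t < 0 := by
  by_contra! hcon
  obtain ⟨i0, hi0, s0, hs0, hpos⟩ := hcon
  set S : Set ℝ := ⋃ i ∈ I, (Icc t₀ t₁ ∩ φ i ⁻¹' Ici 0) with hS
  have hSclosed : IsClosed S := by
    apply Set.Finite.isClosed_biUnion I.finite_toSet
    intro i hi
    exact (hc i hi).preimage_isClosed_of_isClosed isClosed_Icc isClosed_Ici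
  have hSsub : S ⊆ Icc t₀ t₁ := by
    intro s hs
    simp only [hS, mem_iUnion] at hs
    obtain ⟨i, hi, h⟩ := hs
    exact h.1
  have hScomp : IsCompact S := isCompact_Icc.of_isClosed_subset hSclosed hSsub
  have hSne : S.Nonempty := ⟨s0, by
    simp only [hS, mem_iUnion]; exact ⟨i0, hi0, hs0, hpos⟩⟩
  obtain ⟨t, ht⟩ := hScomp.exists_isLeast hSne
  have htS := ht.1
  simp only [hS, mem_iUnion] at htS
  obtain ⟨i, hi, htI, hti⟩ := htS
  have hlt : ∀ j ∈ I, ∀ s ∈ Ico t₀ t, φ j s < 0 := by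
    intro j hj s hs
    by_contra! h
    have : s ∈ S := by
      simp only [hS, mem_iUnion]
      exact ⟨j, hj, ⟨hs.1, hs.2.le.trans htI.2⟩, h⟩
    exact absurd (ht.2 this) (not_le.mpr hs.2)
  have ht0 : t₀ < t := by
    rcases eq_or_lt_of_le htI.1 with h | h
    · have := h0 i hi
      rw [h] at this
      exact absurd hti (not_le.mpr this)
    · exact h
  have hle : ∀ j ∈ I, φ j t ≤ 0 := by
    intro j hj
    have h1 : Tendsto (φ j) (𝓝[Ico t₀ t] t) (𝓝 (φ j t)) :=
      ((hc j hj) t htI).mono_left (nhdsWithin_mono _ fun s hs => ⟨hs.1, hs.2.le.trans htI.2⟩)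
    have : (𝓝[Ico t₀ t] t).NeBot := by
      rw [nhdsWithin_Ico_eq_nhdsLT ht0]; infer_instance
    refine le_of_tendsto h1 ?_
    filter_upwards [self_mem_nhdsWithin] with s hs using (hlt j hj s hs).le
  have hz : φ i t = 0 := le_antisymm (hle i hi) hti
  obtain ⟨d, hd0, hder⟩ := hd i hi t ⟨ht0, htI.2⟩ hle hz
  have h2 : Tendsto (slope (φ i) t) (𝓝[<] t) (𝓝 d) :=
    (hasDerivAt_iff_tendsto_slope.mp hder).mono_left
      (nhdsWithin_mono _ fun s hs => ne_of_lt hs)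
  have h3 : 0 ≤ d := by
    refine ge_of_tendsto h2 ?_
    have : Ico t₀ t ∈ 𝓝[<] t := Ico_mem_nhdsLT ht0
    filter_upwards [this] with s hs
    rw [slope_def_field, hz]
    have h4 := hlt i hi s hs
    have h5 := hs.2
    apply div_nonneg_of_nonpos <;> linarith
  linarith

/-- A bounded, globally Lipschitz vector field has solutions on every time interval. -/
theorem exists_solution_of_lipschitz_of_bounded {E : Type*} [NormedAddCommGroup E]
    [NormedSpace ℝ E] [CompleteSpace E] (G : E → E) (K L : NNReal) (hK : LipschitzWith K G)
    (hL : ∀ x, ‖G x‖ ≤ L) (x₀ : E) {S : ℝ} (hS : 0 < S) :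
    ∃ v : ℝ → E, v 0 = x₀ ∧ ContinuousOn v (Icc 0 S) ∧ ∀ t ∈ Ioo 0 S, HasDerivAt v (G (v t)) t := by
  have hp : IsPicardLindelof (fun _ => G) (tmin := 0) (tmax := S) ⟨0, le_rfl, hS.le⟩ x₀
      (L * S.toNNReal) 0 L K := by
    refine ⟨fun t _ => hK.lipschitzOnWith, fun x _ => continuousOn_const, fun t _ x _ => hL x, ?_⟩
    simp [hS.le]
  obtain ⟨v, hv0, hv⟩ := hp.exists_eq_forall_mem_Icc_hasDerivWithinAt₀
  refine ⟨v, hv0, fun t ht => (hv t ht).continuousWithinAt, fun t ht => ?_⟩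
  exact (hv t (Ioo_subset_Icc_self ht)).hasDerivAt (Icc_mem_nhds ht.1 ht.2)

/-- The logarithmic growth rate of the semi-discrete equation. -/
noncomputable def rate (h : ℝ) (w : ℤ → ℝ → ℝ) (i : ℤ) (t : ℝ) : ℝ :=
  (w (i + 1) t - 2 * w i t + w (i - 1) t) / h ^ 2 + 1 - w i t

/-- Solutions of the method-of-lines discretization `∂ₜ w_i = w_i (δ²w_i + 1 - w_i)`. -/
structure LineScheme (n : ℤ) (h M S α β : ℝ) (f : ℤ → ℝ) (w : ℤ → ℝ → ℝ) : Prop where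
  pos : ∀ i, 0 < i → i < n → ∀ t ∈ Icc 0 S, 0 < w i t
  nonneg : ∀ i t, 0 ≤ i → i ≤ n → t ∈ Icc 0 S → 0 ≤ w i t
  le : ∀ i t, 0 ≤ i → i ≤ n → t ∈ Icc 0 S → w i t ≤ M
  left : ∀ t, w 0 t = α
  right : ∀ t, w n t = β
  init : ∀ i, 0 < i → i < n → w i 0 = f i
  cont : ∀ i, 0 ≤ i → i ≤ n → ContinuousOn (w i) (Icc 0 S)
  deriv : ∀ i, 0 < i → i < n → ∀ t ∈ Ioc 0 S, HasDerivAt (w i) (w i t * rate h w i t) t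

theorem abs_exp_min_sub_le {M : ℝ} (hM : 1 ≤ M) (x y : ℝ) :
    |Real.exp (min x (Real.log M)) - Real.exp (min y (Real.log M))| ≤ M * |x - y| := by
  have key : ∀ a b : ℝ, a ≤ Real.log M → b ≤ Real.log M →
      Real.exp a - Real.exp b ≤ M * |a - b| := by
    intro a b ha hb
    have h1 := Real.add_one_le_exp (b - a)
    have h2 : Real.exp b = Real.exp a * Real.exp (b - a) := by
      rw [← Real.exp_add]; ring_nf
    have h3 : Real.exp a ≤ M := by
      rw [← Real.exp_log (by linarith : (0:ℝ) < M)]; exact Real.exp_le_exp.mpr ha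
    have h4 := Real.exp_pos a
    have h5 : a - b ≤ |a - b| := le_abs_self _
    calc Real.exp a - Real.exp b = Real.exp a * (1 - Real.exp (b - a)) := by rw [h2]; ring
      _ ≤ Real.exp a * |a - b| := by apply mul_le_mul_of_nonneg_left _ h4.le; linarith
      _ ≤ M * |a - b| := by gcongr
  have hmin : |min x (Real.log M) - min y (Real.log M)| ≤ |x - y| := by
    have := abs_min_sub_min_le_max x (Real.log M) y (Real.log M)
    simpa using this
  have hM0 : 0 ≤ M := by linarith
  have h1 := key _ _ (min_le_right x (Real.log M)) (min_le_right y (Real.log M))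
  have h2 := key _ _ (min_le_right y (Real.log M)) (min_le_right x (Real.log M))
  rw [abs_sub_comm (min y _)] at h2
  have h3 := mul_le_mul_of_nonneg_left hmin hM0
  rw [abs_le]
  constructor <;> linarith

theorem exists_lineScheme (n : ℤ) {h M S α β : ℝ} (hn : 0 < n) (hM : 1 ≤ M) (hS : 0 < S)
    (hα : α ∈ Icc 0 M) (hβ : β ∈ Icc 0 M) (f : ℤ → ℝ)
    (hf : ∀ i, 0 < i → i < n → f i ∈ Ioc 0 M) :
    ∃ w, LineScheme n h M S α β f w := by
  classical
  set J : Finset ℤ := Finset.Ioo 0 n with hJ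
  let ω : (J → ℝ) → ℤ → ℝ := fun v k =>
    if hk : k ∈ J then Real.exp (min (v ⟨k, hk⟩) (Real.log M)) else if k ≤ 0 then α else β
  have hM0 : 0 < M := by linarith
  have hω0 : ∀ v k, 0 ≤ ω v k := by
    intro v k
    simp only [ω]
    split_ifs
    · exact (Real.exp_pos _).le
    · exact hα.1
    · exact hβ.1
  have hωM : ∀ v k, ω v k ≤ M := by
    intro v k
    simp only [ω]
    split_ifs
    · calc _ ≤ Real.exp (Real.log M) := Real.exp_le_exp.mpr (min_le_right _ _)
        _ = M := Real.exp_log hM0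
    · exact hα.2
    · exact hβ.2
  have hωL : ∀ v v' k, |ω v k - ω v' k| ≤ M * ‖v - v'‖ := by
    intro v v' k
    simp only [ω]
    split_ifs with hk
    · refine (abs_exp_min_sub_le hM _ _).trans ?_
      gcongr
      exact norm_le_pi_norm (v - v') ⟨k, hk⟩
    all_goals simp; positivity
  let G : (J → ℝ) → (J → ℝ) := fun v j =>
    (ω v (j + 1) - 2 * ω v j + ω v (j - 1)) / h ^ 2 + 1 - ω v j
  have hGL : LipschitzWith (Real.toNNReal (4 * M / h ^ 2 + M)) G := by
    apply LipschitzWith.of_dist_le_mul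
    intro v v'
    rw [Real.coe_toNNReal _ (by positivity), dist_eq_norm, dist_eq_norm,
      pi_norm_le_iff_of_nonneg (by positivity)]
    intro j
    have h1 := abs_le.mp (hωL v v' (j + 1))
    have h2 := abs_le.mp (hωL v v' j)
    have h3 := abs_le.mp (hωL v v' (j - 1))
    have h4 : (G v - G v') j = ((ω v (j + 1) - ω v' (j + 1)) - 2 * (ω v j - ω v' j)
        + (ω v (j - 1) - ω v' (j - 1))) / h ^ 2 - (ω v j - ω v' j) := by
      simp only [G, Pi.sub_apply]; ring
    have h5 : |((ω v (j + 1) - ω v' (j + 1)) - 2 * (ω v j - ω v' j)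
        + (ω v (j - 1) - ω v' (j - 1))) / h ^ 2| ≤ (4 * (M * ‖v - v'‖)) / h ^ 2 := by
      rw [abs_div, abs_of_nonneg (sq_nonneg h)]
      gcongr
      rw [abs_le]; constructor <;> linarith
    rw [h4, Real.norm_eq_abs]
    refine (abs_sub _ _).trans ?_
    have h6 := hωL v v' j
    calc _ ≤ (4 * (M * ‖v - v'‖)) / h ^ 2 + M * ‖v - v'‖ := add_le_add h5 h6
      _ = _ := by ring
  have hGB : ∀ v, ‖G v‖ ≤ (Real.toNNReal (4 * M / h ^ 2 + 1 + M)) := by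
    intro v
    rw [Real.coe_toNNReal _ (by positivity), pi_norm_le_iff_of_nonneg (by positivity)]
    intro j
    have a1 := hω0 v (j + 1)
    have a2 := hω0 v j
    have a3 := hω0 v (j - 1)
    have b1 := hωM v (j + 1)
    have b2 := hωM v j
    have b3 := hωM v (j - 1)
    have h5 : |(ω v (j + 1) - 2 * ω v j + ω v (j - 1)) / h ^ 2| ≤ 4 * M / h ^ 2 := by
      rw [abs_div, abs_of_nonneg (sq_nonneg h)]
      gcongr
      rw [abs_le]; constructor <;> linarith
    rw [abs_le] at h5
    rw [Real.norm_eq_abs, abs_le]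
    simp only [G]
    constructor <;> linarith [h5.1, h5.2]
  obtain ⟨ρ, hρ0, hρc, hρ⟩ := exists_solution_of_lipschitz_of_bounded G _ _ hGL hGB
    (fun j : J => Real.log (f j)) (by linarith : 0 < S + 1)
  have hρj : ∀ j : J, ∀ t ∈ Ioo 0 (S + 1), HasDerivAt (fun t => ρ t j) (G (ρ t) j) t :=
    fun j t ht => hasDerivAt_pi.mp (hρ t ht) j
  have hρcj : ∀ j : J, ContinuousOn (fun t => ρ t j) (Icc 0 (S + 1)) :=
    fun j => continuousOn_pi.mp hρc j
  have hfJ : ∀ j : J, f j ∈ Ioc 0 M := fun j =>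
    hf j (Finset.mem_Ioo.mp j.2).1 (Finset.mem_Ioo.mp j.2).2
  have hρle : ∀ j : J, ∀ t ∈ Ico 0 (S + 1), ρ t j ≤ Real.log M := by
    intro j t ht
    apply le_of_forall_pos_lt_add
    intro ε hε
    set δ := ε / (1 + t) with hδ
    have ht1 : 0 < 1 + t := by linarith [ht.1]
    have hδ0 : 0 < δ := by positivity
    have := neg_of_touching {(0 : ℕ)} (fun _ s => ρ s j - (Real.log M + δ * (1 + s)))
      (t₀ := 0) (t₁ := t) ?_ ?_ ?_ 0 (by simp) t ⟨ht.1, le_rfl⟩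
    · have h3 : δ * (1 + t) = ε := by rw [hδ]; field_simp
      linarith
    · intro _ _
      exact ((hρcj j).mono (Icc_subset_Icc_right ht.2.le)).sub (by fun_prop)
    · intro _ _
      have : ρ 0 j ≤ Real.log M := by
        rw [hρ0]; exact Real.log_le_log (hfJ j).1 (hfJ j).2
      linarith
    · intro _ _ s hs _ hz
      refine ⟨G (ρ s) j - δ, ?_, ?_⟩
      · have hgt : Real.log M ≤ ρ s j := by nlinarith [hs.1]
        have hωj : ω (ρ s) j = M := by
          simp only [ω, j.2, dif_pos]
          rw [min_eq_right hgt, Real.exp_log hM0]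
        have : (ω (ρ s) (j + 1) - 2 * ω (ρ s) j + ω (ρ s) (j - 1)) / h ^ 2 ≤ 0 := by
          apply div_nonpos_of_nonpos_of_nonneg _ (sq_nonneg h)
          have := hωM (ρ s) (j + 1)
          have := hωM (ρ s) (j - 1)
          linarith
        simp only [G]
        linarith
      · have h1 := hρj j s ⟨hs.1, hs.2.trans_lt ht.2⟩
        have h2 : HasDerivAt (fun s => Real.log M + δ * (1 + s)) δ s := by
          simpa using (((hasDerivAt_id s).const_add 1).const_mul δ).const_add (Real.log M)
        exact h1.sub h2
  have hn0 : (0 : ℤ) ∉ J := by simp [hJ]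
  have hnn : n ∉ J := by simp [hJ]
  have hωJ : ∀ j : J, ∀ t ∈ Ico 0 (S + 1), ω (ρ t) j = Real.exp (ρ t j) := by
    intro j t ht
    simp only [ω, j.2, dif_pos]
    rw [min_eq_left (hρle j t ht)]
  refine ⟨fun k t => ω (ρ t) k, ?_, fun i t _ _ _ => hω0 _ _, fun i t _ _ _ => hωM _ _,
    ?_, ?_, ?_, ?_, ?_⟩
  · intro i h0 hi t ht
    have hiJ : i ∈ J := by simp [hJ, h0, hi]
    simp only [ω, hiJ, dif_pos]
    exact Real.exp_pos _
  · intro t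
    simp [ω, hn0]
  · intro t
    simp [ω, hnn, hn]
  · intro i h0 hi
    have hiJ : i ∈ J := by simp [hJ, h0, hi]
    have := hωJ ⟨i, hiJ⟩ 0 ⟨le_rfl, by linarith⟩
    simp only at this
    rw [this, hρ0, Real.exp_log (hf i h0 hi).1]
  · intro i _ _
    by_cases hiJ : i ∈ J
    · refine ((Real.continuous_exp.comp_continuousOn (hρcj ⟨i, hiJ⟩)).mono
        (Icc_subset_Icc_right (by linarith))).congr ?_
      intro t ht
      exact hωJ ⟨i, hiJ⟩ t ⟨ht.1, by linarith [ht.2]⟩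
    · simp only [ω, hiJ, dif_neg, not_false_eq_true]
      exact continuousOn_const
  · intro i h0 hi t ht
    have hiJ : i ∈ J := by simp [hJ, h0, hi]
    have htt : t ∈ Ioo 0 (S + 1) := ⟨ht.1, by linarith [ht.2]⟩
    have h1 := (hρj ⟨i, hiJ⟩ t htt).exp
    have h2 : (fun t => ω (ρ t) i) =ᶠ[𝓝 t] fun t => Real.exp (ρ t ⟨i, hiJ⟩) := by
      filter_upwards [Ioo_mem_nhds htt.1 htt.2] with s hs
      exact hωJ ⟨i, hiJ⟩ s ⟨hs.1.le, hs.2⟩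
    refine (h1.congr_of_eventuallyEq h2).congr_deriv ?_
    rw [← hωJ ⟨i, hiJ⟩ t ⟨htt.1.le, htt.2⟩]
    rfl

namespace LineScheme

variable {n : ℤ} {h M S α β : ℝ} {f : ℤ → ℝ} {w : ℤ → ℝ → ℝ}

theorem rate_le_rate {v w : ℤ → ℝ → ℝ} {i : ℤ} {t : ℝ} (h0 : w i t = v i t)
    (h1 : w (i + 1) t ≤ v (i + 1) t) (h2 : w (i - 1) t ≤ v (i - 1) t) :
    rate h w i t ≤ rate h v i t := by
  unfold rate
  rw [h0]
  gcongr

/-- Comparison with a strict supersolution. -/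
theorem lt_of_supersolution (hw : LineScheme n h M S α β f w) {v v' : ℤ → ℝ → ℝ}
    (hv : ∀ i t, HasDerivAt (v i) (v' i t) t)
    (hinit : ∀ i, 0 < i → i < n → f i < v i 0)
    (hl : ∀ t ∈ Icc 0 S, α < v 0 t) (hr : ∀ t ∈ Icc 0 S, β < v n t)
    (hsup : ∀ i, 0 < i → i < n → ∀ t ∈ Ioc 0 S, 0 < v i t → v i t ≤ M →
      v i t * rate h v i t < v' i t) :
    ∀ i t, 0 ≤ i → i ≤ n → t ∈ Icc 0 S → w i t < v i t := by
  intro i t h0 hn ht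
  have hS : (0:ℝ) ∈ Icc 0 S := ⟨le_rfl, ht.1.trans ht.2⟩
  have := neg_of_touching (Finset.Icc 0 n) (fun i t => w i t - v i t) (t₀ := 0) (t₁ := S)
    ?_ ?_ ?_ i (by simp [h0, hn]) t ht
  · linarith
  · intro i hi
    rw [Finset.mem_Icc] at hi
    exact (hw.cont i hi.1 hi.2).sub fun t _ => (hv i t).continuousAt.continuousWithinAt
  · intro i hi
    rw [Finset.mem_Icc] at hi
    rcases eq_or_lt_of_le hi.1 with hi0 | hi0
    · subst hi0; have := hl 0 hS; simp only [hw.left]; linarith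
    rcases eq_or_lt_of_le hi.2 with hin | hin
    · subst hin; have := hr 0 hS; simp only [hw.right]; linarith
    · have := hinit i hi0 hin; simp only [hw.init i hi0 hin]; linarith
  · intro i hi t ht hle hz
    rw [Finset.mem_Icc] at hi
    have htI : t ∈ Icc 0 S := Ioc_subset_Icc_self ht
    rcases eq_or_lt_of_le hi.1 with hi0 | hi0
    · subst hi0; have := hl t htI; simp only [hw.left] at hz; linarith
    rcases eq_or_lt_of_le hi.2 with hin | hin
    · subst hin; have := hr t htI; simp only [hw.right] at hz; linarith
    · refine ⟨_, ?_, (hw.deriv i hi0 hin t ht).sub (hv i t)⟩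
      have hz' : w i t = v i t := by linarith
      have hp := hw.pos i hi0 hin t htI
      have h1 := hle (i + 1) (by simp; omega)
      have h2 := hle (i - 1) (by simp; omega)
      have h3 : _ ≤ rate h v i t := rate_le_rate hz' (by linarith) (by linarith)
      have h4 := hsup i hi0 hin t ht (by linarith) (by rw [← hz']; exact hw.le i t hi.1 hi.2 htI)
      rw [hz'] at hp ⊢
      have h5 := mul_le_mul_of_nonneg_left h3 hp.le
      linarith

/-- Comparison with a strict subsolution. -/
theorem lt_of_subsolution (hw : LineScheme n h M S α β f w) {v v' : ℤ → ℝ → ℝ}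
    (hv : ∀ i t, HasDerivAt (v i) (v' i t) t)
    (hinit : ∀ i, 0 < i → i < n → v i 0 < f i)
    (hl : ∀ t ∈ Icc 0 S, v 0 t < α) (hr : ∀ t ∈ Icc 0 S, v n t < β)
    (hsub : ∀ i, 0 < i → i < n → ∀ t ∈ Ioc 0 S, 0 < v i t → v i t ≤ M →
      v' i t < v i t * rate h v i t) :
    ∀ i t, 0 ≤ i → i ≤ n → t ∈ Icc 0 S → v i t < w i t := by
  intro i t h0 hn ht
  have hS : (0:ℝ) ∈ Icc 0 S := ⟨le_rfl, ht.1.trans ht.2⟩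
  have := neg_of_touching (Finset.Icc 0 n) (fun i t => v i t - w i t) (t₀ := 0) (t₁ := S)
    ?_ ?_ ?_ i (by simp [h0, hn]) t ht
  · linarith
  · intro i hi
    rw [Finset.mem_Icc] at hi
    exact ContinuousOn.sub (fun t _ => (hv i t).continuousAt.continuousWithinAt)
      (hw.cont i hi.1 hi.2)
  · intro i hi
    rw [Finset.mem_Icc] at hi
    rcases eq_or_lt_of_le hi.1 with hi0 | hi0
    · subst hi0; have := hl 0 hS; simp only [hw.left]; linarith
    rcases eq_or_lt_of_le hi.2 with hin | hin
    · subst hin; have := hr 0 hS; simp only [hw.right]; linarith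
    · have := hinit i hi0 hin; simp only [hw.init i hi0 hin]; linarith
  · intro i hi t ht hle hz
    rw [Finset.mem_Icc] at hi
    have htI : t ∈ Icc 0 S := Ioc_subset_Icc_self ht
    rcases eq_or_lt_of_le hi.1 with hi0 | hi0
    · subst hi0; have := hl t htI; simp only [hw.left] at hz; linarith
    rcases eq_or_lt_of_le hi.2 with hin | hin
    · subst hin; have := hr t htI; simp only [hw.right] at hz; linarith
    · refine ⟨_, ?_, (hv i t).sub (hw.deriv i hi0 hin t ht)⟩
      have hz' : v i t = w i t := by linarith
      have hp := hw.pos i hi0 hin t htI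
      have h1 := hle (i + 1) (by simp; omega)
      have h2 := hle (i - 1) (by simp; omega)
      have h3 : rate h v i t ≤ _ := rate_le_rate hz' (by linarith) (by linarith)
      have h4 := hsub i hi0 hin t ht (by linarith) (by rw [hz']; exact hw.le i t hi.1 hi.2 htI)
      rw [← hz'] at hp ⊢
      have h5 := mul_le_mul_of_nonneg_left h3 hp.le
      linarith

/-- The time derivative of `w i`, including the boundary nodes. -/
noncomputable def velocity (n : ℤ) (h : ℝ) (w : ℤ → ℝ → ℝ) (i : ℤ) (t : ℝ) : ℝ :=
  if 0 < i ∧ i < n then w i t * rate h w i t else 0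

theorem hasDerivAt_velocity (hw : LineScheme n h M S α β f w) {i : ℤ} (h0 : 0 ≤ i) (hi : i ≤ n)
    {t : ℝ} (ht : t ∈ Ioc 0 S) : HasDerivAt (w i) (velocity n h w i t) t := by
  unfold velocity
  split_ifs with hc
  · exact hw.deriv i hc.1 hc.2 t ht
  · have : i = 0 ∨ i = n := by omega
    rcases this with rfl | rfl
    · rw [show w 0 = fun _ => α from funext hw.left]; exact hasDerivAt_const _ _
    · rw [show w i = fun _ => β from funext hw.right]; exact hasDerivAt_const _ _

theorem hasDerivAt_rate (hw : LineScheme n h M S α β f w) {i : ℤ} (h0 : 0 < i) (hi : i < n)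
    {t : ℝ} (ht : t ∈ Ioc 0 S) :
    HasDerivAt (rate h w i) ((velocity n h w (i + 1) t - 2 * velocity n h w i t
      + velocity n h w (i - 1) t) / h ^ 2 - velocity n h w i t) t := by
  have h1 := hw.hasDerivAt_velocity (i := i + 1) (by omega) (by omega) ht
  have h2 := hw.hasDerivAt_velocity (i := i) (by omega) (by omega) ht
  have h3 := hw.hasDerivAt_velocity (i := i - 1) (by omega) (by omega) ht
  exact ((((h1.sub (h2.const_mul 2)).add h3).div_const (h ^ 2)).add_const 1).sub h2

theorem continuousOn_rate (hw : LineScheme n h M S α β f w) {i : ℤ} (h0 : 0 < i) (hi : i < n) :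
    ContinuousOn (rate h w i) (Icc 0 S) := by
  have h1 := hw.cont (i + 1) (by omega) (by omega)
  have h2 := hw.cont i (by omega) (by omega)
  have h3 := hw.cont (i - 1) (by omega) (by omega)
  exact ((((h1.sub (h2.const_mul 2)).add h3).div_const (h ^ 2)).add continuousOn_const).sub h2

/-- The growth rate bound `w_t / w ≥ -1/t`. -/
theorem neg_inv_le_rate (hw : LineScheme n h M S α β f w) :
    ∀ i, 0 < i → i < n → ∀ t ∈ Ioc 0 S, -(1 / t) ≤ rate h w i t := by
  intro i h0 hn t ht
  set R := 1 + ∑ i ∈ Finset.Ioo 0 n, |rate h w i 0| with hR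
  have hRi : ∀ i ∈ Finset.Ioo 0 n, -rate h w i 0 < R := by
    intro i hi
    have := Finset.single_le_sum (f := fun i => |rate h w i 0|) (fun i _ => abs_nonneg _) hi
    linarith [neg_abs_le (rate h w i 0)]
  have hR0 : 0 < R := by positivity
  have key := neg_of_touching (Finset.Ioo 0 n) (fun i t => -rate h w i t - (t + R⁻¹)⁻¹) (t₀ := 0)
    (t₁ := S) ?_ ?_ ?_ i (by simp [h0, hn]) t (Ioc_subset_Icc_self ht)
  · have : (t + R⁻¹)⁻¹ ≤ 1 / t := by
      rw [one_div]
      apply inv_anti₀ ht.1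
      have := inv_pos.mpr hR0
      linarith
    linarith
  · intro i hi
    rw [Finset.mem_Ioo] at hi
    refine (hw.continuousOn_rate hi.1 hi.2).neg.sub ?_
    apply ContinuousOn.inv₀ (by fun_prop)
    intro s hs
    have := inv_pos.mpr hR0
    linarith [hs.1]
  · intro i hi
    have := hRi i hi
    simp only [zero_add, inv_inv]
    linarith
  · intro i hi s hs hle hz
    rw [Finset.mem_Ioo] at hi
    have hRp := inv_pos.mpr hR0
    have hpos : 0 < s + R⁻¹ := by linarith [hs.1]
    set b := (s + R⁻¹)⁻¹ with hb
    have hb0 : 0 < b := inv_pos.mpr hpos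
    have hd2 : HasDerivAt (fun s : ℝ => (s + R⁻¹)⁻¹) (-b ^ 2) s := by
      have := ((hasDerivAt_id s).add_const R⁻¹).inv hpos.ne'
      refine this.congr_deriv ?_
      simp only [id, hb]
      field_simp
    refine ⟨_, ?_, (hw.hasDerivAt_rate hi.1 hi.2 hs).neg.sub hd2⟩
    have hsI : s ∈ Icc 0 S := Ioc_subset_Icc_self hs
    have hv : ∀ j, 0 ≤ j → j ≤ n → -b * w j s ≤ velocity n h w j s := by
      intro j hj0 hjn
      have hwj := hw.nonneg j s hj0 hjn hsI
      unfold velocity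
      split_ifs with hc
      · have := hle j (by simp [hc])
        nlinarith
      · nlinarith
    have h1 := hv (i + 1) (by omega) (by omega)
    have h3 := hv (i - 1) (by omega) (by omega)
    have hri : rate h w i s = -b := by linarith
    have h2 : velocity n h w i s = -b * w i s := by
      unfold velocity; rw [if_pos hi, hri]; ring
    have h4 : (-b * w (i + 1) s - 2 * (-b * w i s) + -b * w (i - 1) s) / h ^ 2 ≤
        (velocity n h w (i + 1) s - 2 * velocity n h w i s
          + velocity n h w (i - 1) s) / h ^ 2 := by
      rw [h2]; gcongr
    have h5 : (-b * w (i + 1) s - 2 * (-b * w i s) + -b * w (i - 1) s) / h ^ 2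
        = -b * (rate h w i s - 1 + w i s) := by
      unfold rate; ring
    rw [h5, hri] at h4
    rw [h2] at h4 ⊢
    nlinarith

end LineScheme

theorem inv_sq_generator_le {M C₁ Y h y α β : ℝ} (hh : 0 < h) (hy : 2 * h ≤ y) (hyY : y ≤ Y)
    (hC₁ : 0 ≤ C₁) (hβ : β ∈ Icc 0 M) (hαβ : |α - β| ≤ C₁ * h) :
    (α * (1 / (y + h) ^ 2 - 1 / y ^ 2) + β * (1 / (y - h) ^ 2 - 1 / y ^ 2)) / h ^ 2 ≤
      (11 * M + 2 * C₁ * Y) * (1 / y ^ 2) ^ 2 := by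
  have hy0 : 0 < y := by linarith
  have hyh : 0 < y - h := by linarith
  have h1 : 1 / (y + h) ^ 2 + 1 / (y - h) ^ 2 - 2 * (1 / y ^ 2) ≤ 11 * h ^ 2 / y ^ 4 := by
    have e : 1 / (y + h) ^ 2 + 1 / (y - h) ^ 2 - 2 * (1 / y ^ 2) =
        (6 * y ^ 2 * h ^ 2 - 2 * h ^ 4) / (y ^ 2 * ((y + h) * (y - h)) ^ 2) := by
      field_simp
      ring
    rw [e, div_le_div_iff₀ (by positivity) (by positivity)]
    have a1 : 3 / 4 * y ^ 2 ≤ (y + h) * (y - h) := by nlinarith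
    have a2 : (3 / 4 * y ^ 2) ^ 2 ≤ ((y + h) * (y - h)) ^ 2 := by gcongr
    have a3 : 11 * h ^ 2 * (y ^ 2 * (3 / 4 * y ^ 2) ^ 2) ≤
        11 * h ^ 2 * (y ^ 2 * ((y + h) * (y - h)) ^ 2) := by gcongr
    have a4 : 0 ≤ h ^ 4 * y ^ 4 := by positivity
    have a5 : 0 ≤ h ^ 2 * y ^ 6 := by positivity
    nlinarith
  have h2 : |1 / (y + h) ^ 2 - 1 / y ^ 2| ≤ 2 * h / y ^ 3 := by
    have e : 1 / (y + h) ^ 2 - 1 / y ^ 2 = -((2 * y * h + h ^ 2) / (y ^ 2 * (y + h) ^ 2)) := by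
      field_simp
      ring
    rw [e, abs_neg, abs_of_nonneg (by positivity), div_le_div_iff₀ (by positivity) (by positivity)]
    have : 0 ≤ h ^ 2 * y ^ 3 := by positivity
    have : 0 ≤ h ^ 3 * y ^ 2 := by positivity
    nlinarith
  have h3 : 0 ≤ 1 / (y + h) ^ 2 + 1 / (y - h) ^ 2 - 2 * (1 / y ^ 2) := by
    have e : 1 / (y + h) ^ 2 + 1 / (y - h) ^ 2 - 2 * (1 / y ^ 2) =
        (6 * y ^ 2 * h ^ 2 - 2 * h ^ 4) / (y ^ 2 * ((y + h) * (y - h)) ^ 2) := by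
      field_simp
      ring
    rw [e]
    apply div_nonneg _ (by positivity)
    have : h ^ 2 ≤ y ^ 2 := by gcongr; linarith
    nlinarith [mul_nonneg (sq_nonneg h) (sub_nonneg.mpr this), sq_nonneg (h ^ 2)]
  have h4 : (α - β) * (1 / (y + h) ^ 2 - 1 / y ^ 2) ≤ C₁ * h * (2 * h / y ^ 3) := by
    refine (le_abs_self _).trans ?_
    rw [abs_mul]
    gcongr
  have h5 : β * (1 / (y + h) ^ 2 + 1 / (y - h) ^ 2 - 2 * (1 / y ^ 2)) ≤
      M * (11 * h ^ 2 / y ^ 4) := by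
    gcongr
    · exact hβ.1.trans hβ.2
    · exact hβ.2
  rw [div_le_iff₀ (by positivity)]
  have h6 : C₁ * h * (2 * h / y ^ 3) ≤ 2 * C₁ * Y * h ^ 2 / y ^ 4 := by
    rw [mul_div_assoc', div_le_div_iff₀ (by positivity) (by positivity)]
    have : 0 ≤ C₁ * h ^ 2 * y ^ 3 := by positivity
    nlinarith [mul_le_mul_of_nonneg_left hyY this]
  calc _ = β * (1 / (y + h) ^ 2 + 1 / (y - h) ^ 2 - 2 * (1 / y ^ 2))
        + (α - β) * (1 / (y + h) ^ 2 - 1 / y ^ 2) := by ring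
    _ ≤ M * (11 * h ^ 2 / y ^ 4) + 2 * C₁ * Y * h ^ 2 / y ^ 4 := add_le_add h5 (h4.trans h6)
    _ = _ := by field_simp

theorem quadratic_absorption {K C₂ C Y a ψ σ F : ℝ} (hK : 1 ≤ K) (hC₂ : 0 ≤ C₂) (hC : 0 ≤ C)
    (hψ : 0 < ψ) (hσ : 0 < σ) (hψY : 1 ≤ ψ * Y ^ 2) (haK : C₂ + 1 + C * Y ^ 4 ≤ a * K)
    (hF : F = K * (ψ + σ)) : K * (C₂ * ψ ^ 2) - a * F ^ 2 + C < -(K * σ ^ 2) := by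
  have hψY2 : 1 ≤ ψ ^ 2 * Y ^ 4 := by
    have := mul_le_mul hψY hψY zero_le_one (by linarith)
    linarith
  have h3 : K * (C₂ + 1 + C * Y ^ 4) * (ψ ^ 2 + σ ^ 2) ≤ a * F ^ 2 := by
    rw [hF]
    have q1 : ψ ^ 2 + σ ^ 2 ≤ (ψ + σ) ^ 2 := by
      have := mul_pos hψ hσ
      linarith [add_sq ψ σ]
    have haK0 : 0 ≤ a * K := le_trans (by positivity) haK
    have h2 := mul_le_mul (mul_le_mul_of_nonneg_left haK (by linarith : 0 ≤ K)) q1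
      (by positivity) (by positivity)
    exact h2.trans_eq (by ring)
  have r1 : 0 < K * ψ ^ 2 := by positivity
  have r2 : 0 ≤ K * C₂ * σ ^ 2 := by positivity
  have r3 : 0 ≤ K * (C * Y ^ 4) * σ ^ 2 := by positivity
  have r4 : C ≤ K * C * (ψ ^ 2 * Y ^ 4) := by
    have hKC : C ≤ K * C := le_mul_of_one_le_left hC hK
    have : C * 1 ≤ (K * C) * (ψ ^ 2 * Y ^ 4) :=
      mul_le_mul hKC hψY2 zero_le_one (by positivity)
    linarith
  have e : K * (C₂ + 1 + C * Y ^ 4) * (ψ ^ 2 + σ ^ 2) = K * (C₂ * ψ ^ 2) + K * C₂ * σ ^ 2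
    + K * ψ ^ 2 + K * σ ^ 2 + K * C * (ψ ^ 2 * Y ^ 4) + K * (C * Y ^ 4) * σ ^ 2 := by ring
  linarith

set_option maxHeartbeats 1000000 in
/-- Local upper bound for discrete parabolic inequalities with quadratic absorption. -/
theorem exists_local_sup_bound {M C₁ Y a C C₀ : ℝ} (hM : 0 ≤ M) (hC₁ : 0 ≤ C₁) (hY : 0 < Y)
    (ha : 0 < a) (hC : 0 ≤ C) (hC₀ : 0 ≤ C₀) :
    ∃ K > 0, ∀ (h x₀ A B t₀ t₁ : ℝ) (F F' α β : ℤ → ℝ → ℝ), 0 < h → B - A ≤ Y →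
      (∀ i : ℤ, A + h ≤ x₀ + i * h → x₀ + i * h ≤ B - h → ContinuousOn (F i) (Icc t₀ t₁)) →
      (∀ i : ℤ, A + h ≤ x₀ + i * h → x₀ + i * h ≤ B - h → ∀ t ∈ Icc t₀ t₁, F i t ≤ C₀ / h ^ 2) →
      (∀ i : ℤ, A + 2 * h ≤ x₀ + i * h → x₀ + i * h ≤ B - 2 * h → ∀ t ∈ Ioc t₀ t₁,
        HasDerivAt (F i) (F' i t) t ∧ α i t ∈ Icc 0 M ∧ β i t ∈ Icc 0 M ∧
        |α i t - β i t| ≤ C₁ * h ∧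
        (0 < F i t → F' i t ≤ (α i t * (F (i + 1) t - F i t) + β i t * (F (i - 1) t - F i t)) / h ^ 2
          - a * F i t ^ 2 + C)) →
      ∀ i : ℤ, A + h ≤ x₀ + i * h → x₀ + i * h ≤ B - h → ∀ t ∈ Ioc t₀ t₁,
        F i t ≤ K * (1 / (x₀ + i * h - A) ^ 2 + 1 / (B - (x₀ + i * h)) ^ 2 + 1 / (t - t₀)) := by
  set C₂ := 11 * M + 2 * C₁ * Y with hC₂
  have hC₂0 : 0 ≤ C₂ := by positivity
  set K := 4 * C₀ + 1 + (C₂ + 1 + C * Y ^ 4) / a with hK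
  have hK1 : 1 ≤ K := by
    have : 0 ≤ (C₂ + 1 + C * Y ^ 4) / a := by positivity
    linarith
  have hKC₀ : 4 * C₀ < K := by
    have : 0 ≤ (C₂ + 1 + C * Y ^ 4) / a := by positivity
    linarith
  have haK : C₂ + 1 + C * Y ^ 4 ≤ a * K := by
    have : a * K = a * (4 * C₀ + 1) + (C₂ + 1 + C * Y ^ 4) := by
      rw [hK]; field_simp
    rw [this]
    have : 0 ≤ a * (4 * C₀ + 1) := by positivity
    linarith
  refine ⟨K, by linarith, ?_⟩
  intro h x₀ A B t₀ t₁ F F' α β hh hBA hcont htriv hpar i hi1 hi2 t ht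
  set I : Finset ℤ := Finset.Icc ⌈(A + h - x₀) / h⌉ ⌊(B - h - x₀) / h⌋ with hI
  have memI : ∀ i : ℤ, i ∈ I ↔ A + h ≤ x₀ + i * h ∧ x₀ + i * h ≤ B - h := by
    intro i
    rw [hI, Finset.mem_Icc, Int.ceil_le, Int.le_floor, div_le_iff₀ hh, le_div_iff₀ hh]
    constructor <;> rintro ⟨h1, h2⟩ <;> constructor <;> linarith
  set ψ : ℤ → ℝ := fun i => 1 / (x₀ + i * h - A) ^ 2 + 1 / (B - (x₀ + i * h)) ^ 2 with hψ
  set R := 1 + ∑ i ∈ I, |F i t₀| with hR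
  have hR0 : 0 < R := by positivity
  have hRi : ∀ i ∈ I, F i t₀ < R := by
    intro i hi
    have := Finset.single_le_sum (f := fun i => |F i t₀|) (fun i _ => abs_nonneg _) hi
    linarith [le_abs_self (F i t₀)]
  have hRp := inv_pos.mpr hR0
  have hψpos : ∀ i ∈ I, 0 < ψ i := by
    intro i hi
    rw [memI] at hi
    have h1 : 0 < x₀ + i * h - A := by linarith
    have h2 : 0 < B - (x₀ + i * h) := by linarith
    simp only [hψ]
    positivity
  have key := neg_of_touching I (fun i t => F i t - K * (ψ i + (t - t₀ + R⁻¹)⁻¹)) (t₀ := t₀)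
    (t₁ := t₁) ?_ ?_ ?_ i ((memI i).mpr ⟨hi1, hi2⟩) t (Ioc_subset_Icc_self ht)
  · have : (t - t₀ + R⁻¹)⁻¹ ≤ 1 / (t - t₀) := by
      rw [one_div]
      apply inv_anti₀ (by linarith [ht.1])
      linarith
    have h3 : K * (ψ i + (t - t₀ + R⁻¹)⁻¹) ≤ K * (ψ i + 1 / (t - t₀)) := by
      gcongr
    simp only [hψ] at h3 key
    linarith
  · intro i hi
    rw [memI] at hi
    refine (hcont i hi.1 hi.2).sub (continuousOn_const.mul (continuousOn_const.add ?_))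
    apply ContinuousOn.inv₀ (by fun_prop)
    intro s hs
    linarith [hs.1]
  · intro i hi
    have h1 := hRi i hi
    have h2 := hψpos i hi
    have h3 : R ≤ K * (ψ i + R) := by nlinarith
    simp only [sub_self, zero_add, inv_inv]
    linarith
  · intro i hi s hs hle hz
    have hψi := hψpos i hi
    have hi' := (memI i).mp hi
    have hsI := Ioc_subset_Icc_self hs
    have hσ : 0 < s - t₀ + R⁻¹ := by linarith [hs.1]
    set σ := s - t₀ + R⁻¹ with hσd
    have hσi : 0 < σ⁻¹ := inv_pos.mpr hσ
    have y1 : 0 < x₀ + i * h - A := by linarith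
    have y2 : 0 < B - (x₀ + i * h) := by linarith
    have hFi : F i s = K * (ψ i + σ⁻¹) := by linarith
    have hFb := htriv i hi'.1 hi'.2 s hsI
    have hlow : ∀ y : ℝ, 0 < y → y < 2 * h → C₀ / h ^ 2 < K * (1 / y ^ 2) := by
      intro y hy0 hy
      have : 1 / (2 * h) ^ 2 < 1 / y ^ 2 := by gcongr
      calc C₀ / h ^ 2 = 4 * C₀ * (1 / (2 * h) ^ 2) := by field_simp; ring
        _ ≤ K * (1 / (2 * h) ^ 2) := by gcongr
        _ < K * (1 / y ^ 2) := by gcongr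
    have hin1 : A + 2 * h ≤ x₀ + i * h := by
      by_contra! hcon
      have h1 := hlow _ y1 (by linarith)
      have h2 : K * (1 / (x₀ + i * h - A) ^ 2) ≤ K * (ψ i + σ⁻¹) := by
        gcongr
        simp only [hψ]
        have : 0 < 1 / (B - (x₀ + i * h)) ^ 2 := by positivity
        linarith
      linarith
    have hin2 : x₀ + i * h ≤ B - 2 * h := by
      by_contra! hcon
      have h1 := hlow _ y2 (by linarith)
      have h2 : K * (1 / (B - (x₀ + i * h)) ^ 2) ≤ K * (ψ i + σ⁻¹) := by
        gcongr
        simp only [hψ]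
        have : 0 < 1 / (x₀ + i * h - A) ^ 2 := by positivity
        linarith
      linarith
    obtain ⟨hder, hα, hβ, hαβ, hineq⟩ := hpar i hin1 hin2 s hs
    have hd2 : HasDerivAt (fun s : ℝ => K * (ψ i + (s - t₀ + R⁻¹)⁻¹)) (K * (-σ⁻¹ ^ 2)) s := by
      have := ((((hasDerivAt_id s).sub_const t₀).add_const R⁻¹).inv hσ.ne').const_add (ψ i)
      refine (this.const_mul K).congr_deriv ?_
      simp only [id, ← hσd]
      field_simp
    refine ⟨_, ?_, hder.sub hd2⟩
    have hF0 : 0 < F i s := by rw [hFi]; positivity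
    have h1 := hineq hF0
    have hp : F (i + 1) s - F i s ≤ K * (ψ (i + 1) - ψ i) := by
      have := hle (i + 1) ((memI _).mpr ⟨by push_cast; linarith, by push_cast; linarith⟩)
      rw [hFi]
      linarith
    have hm : F (i - 1) s - F i s ≤ K * (ψ (i - 1) - ψ i) := by
      have := hle (i - 1) ((memI _).mpr ⟨by push_cast; linarith, by push_cast; linarith⟩)
      rw [hFi]
      linarith
    have hg1 := inv_sq_generator_le (Y := Y) hh (by linarith : 2 * h ≤ x₀ + i * h - A)
      (by linarith) hC₁ hβ hαβ
    have hg2 := inv_sq_generator_le (Y := Y) hh (by linarith : 2 * h ≤ B - (x₀ + i * h))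
      (by linarith) hC₁ hα (by rwa [abs_sub_comm])
    have h2 : (α i s * (F (i + 1) s - F i s) + β i s * (F (i - 1) s - F i s)) / h ^ 2 ≤
        K * (C₂ * ψ i ^ 2) := by
      have e1 : (α i s * (F (i + 1) s - F i s) + β i s * (F (i - 1) s - F i s)) / h ^ 2 ≤
          (α i s * (K * (ψ (i + 1) - ψ i)) + β i s * (K * (ψ (i - 1) - ψ i))) / h ^ 2 := by
        have := hα.1
        have := hβ.1
        gcongr
      refine e1.trans ?_
      have e2 : (α i s * (K * (ψ (i + 1) - ψ i)) + β i s * (K * (ψ (i - 1) - ψ i))) / h ^ 2 =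
          K * ((α i s * (1 / (x₀ + i * h - A + h) ^ 2 - 1 / (x₀ + i * h - A) ^ 2)
            + β i s * (1 / (x₀ + i * h - A - h) ^ 2 - 1 / (x₀ + i * h - A) ^ 2)) / h ^ 2
          + (β i s * (1 / (B - (x₀ + i * h) + h) ^ 2 - 1 / (B - (x₀ + i * h)) ^ 2)
            + α i s * (1 / (B - (x₀ + i * h) - h) ^ 2 - 1 / (B - (x₀ + i * h)) ^ 2)) / h ^ 2) := by
        have f1 : x₀ + ((i + 1 : ℤ) : ℝ) * h - A = x₀ + i * h - A + h := by push_cast; ring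
        have f2 : x₀ + ((i - 1 : ℤ) : ℝ) * h - A = x₀ + i * h - A - h := by push_cast; ring
        have f3 : B - (x₀ + ((i + 1 : ℤ) : ℝ) * h) = B - (x₀ + i * h) - h := by push_cast; ring
        have f4 : B - (x₀ + ((i - 1 : ℤ) : ℝ) * h) = B - (x₀ + i * h) + h := by push_cast; ring
        simp only [hψ, f1, f2, f3, f4]
        ring
      rw [e2]
      have e3 : (1 / (x₀ + i * h - A) ^ 2) ^ 2 + (1 / (B - (x₀ + i * h)) ^ 2) ^ 2 ≤ ψ i ^ 2 := by
        have p1 : 0 ≤ 1 / (x₀ + i * h - A) ^ 2 := by positivity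
        have p2 : 0 ≤ 1 / (B - (x₀ + i * h)) ^ 2 := by positivity
        simp only [hψ]
        nlinarith [mul_nonneg p1 p2]
      have e4 := mul_le_mul_of_nonneg_left e3 hC₂0
      apply mul_le_mul_of_nonneg_left _ (by linarith)
      linarith
    have hψY : 1 ≤ ψ i * Y ^ 2 := by
      have p2 : 0 ≤ 1 / (B - (x₀ + i * h)) ^ 2 := by positivity
      have : 1 / Y ^ 2 ≤ 1 / (x₀ + i * h - A) ^ 2 := by
        gcongr
        linarith
      have h3 : 1 / Y ^ 2 ≤ ψ i := by simp only [hψ]; linarith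
      rwa [div_le_iff₀ (by positivity)] at h3
    have h3 := quadratic_absorption hK1 hC₂0 hC hψi hσi hψY haK hFi
    linarith

theorem convex_seq_bound (g : ℕ → ℝ) {δ : ℝ} (hδ : 0 ≤ δ) (m : ℕ)
    (H : ∀ k, k + 2 ≤ m → -δ ≤ g (k + 2) - 2 * g (k + 1) + g k) :
    m * (g 1 - g 0) - δ * m ^ 2 ≤ g m - g 0 := by
  have h1 : ∀ k, k + 1 ≤ m → (g 1 - g 0) - δ * k ≤ g (k + 1) - g k := by
    intro k
    induction k with
    | zero => intro _; simp
    | succ k ih =>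
      intro hk
      have h2 := ih (by omega)
      have h3 := H k (by omega)
      push_cast
      linarith
  have h2 : ∀ k, k ≤ m → k * (g 1 - g 0) - δ * k ^ 2 ≤ g k - g 0 := by
    intro k
    induction k with
    | zero => intro _; simp
    | succ k ih =>
      intro hk
      have h2 := ih (by omega)
      have h3 := h1 k (by omega)
      have h4 : 0 ≤ δ * (k + 1) := by positivity
      push_cast
      nlinarith
  exact h2 m le_rfl

namespace LineScheme

variable {n : ℤ} {h M S α β : ℝ} {f : ℤ → ℝ} {w : ℤ → ℝ → ℝ}

theorem abs_slope_le (hw : LineScheme n h M S α β f w) (hh : 0 < h) {τ y Y : ℝ} (hτ : 0 < τ)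
    (hy : 0 < y) {i : ℤ} (h0 : 0 < i) (hi : i < n) (hyi : y ≤ i * h) (hyn : y ≤ (n - i) * h)
    (hY : n * h ≤ Y) {t : ℝ} (ht : t ∈ Icc τ S) :
    |(w (i + 1) t - w i t) / h| ≤ M / y + (1 / τ + 1) * Y := by
  have ht' : t ∈ Ioc 0 S := ⟨hτ.trans_le ht.1, ht.2⟩
  have htI := Ioc_subset_Icc_self ht'
  have hnR : (i : ℝ) + 1 ≤ n := by exact_mod_cast hi
  have hiR : (0 : ℝ) < i := by exact_mod_cast h0
  set κ := 1 / τ + 1 with hκ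
  have hκ0 : 0 < κ := by positivity
  have hM : 0 ≤ M := (hw.nonneg 0 t le_rfl (by omega) htI).trans (hw.le 0 t le_rfl (by omega) htI)
  have hsd : ∀ j, 0 < j → j < n → -(κ * h ^ 2) ≤ w (j + 1) t - 2 * w j t + w (j - 1) t := by
    intro j hj0 hjn
    have h1 := hw.neg_inv_le_rate j hj0 hjn t ht'
    have h2 := hw.nonneg j t hj0.le hjn.le htI
    have h3 : 1 / t ≤ 1 / τ := one_div_le_one_div_of_le hτ ht.1
    unfold rate at h1
    have h4 : -κ ≤ (w (j + 1) t - 2 * w j t + w (j - 1) t) / h ^ 2 := by linarith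
    rw [le_div_iff₀ (by positivity)] at h4
    linarith
  have key : ∀ (m : ℕ) (s D : ℝ), y ≤ m * h → m * h ≤ Y →
      m * (h * s) - κ * h ^ 2 * m ^ 2 ≤ D → D ≤ M → s ≤ M / y + κ * Y := by
    intro m s D hm hmY h1 h2
    have hmh : 0 < m * h := by linarith
    have h3 : s * (m * h) ≤ (M / (m * h) + κ * (m * h)) * (m * h) := by
      rw [add_mul, div_mul_cancel₀ _ hmh.ne']
      linarith
    have h4 := le_of_mul_le_mul_right h3 hmh
    have h5 : M / (m * h) ≤ M / y := by gcongr
    have h6 : κ * (m * h) ≤ κ * Y := by gcongr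
    linarith
  have hb : ∀ j, 0 ≤ j → j ≤ n → 0 ≤ w j t ∧ w j t ≤ M := fun j h1 h2 =>
    ⟨hw.nonneg j t h1 h2 htI, hw.le j t h1 h2 htI⟩
  rw [abs_le']
  constructor
  · obtain ⟨m, hm⟩ : ∃ m : ℕ, (m : ℤ) = n - i := ⟨(n - i).toNat, by omega⟩
    have hmR : (m : ℝ) = n - i := by exact_mod_cast hm
    have := convex_seq_bound (fun k => w (i + k) t) (δ := κ * h ^ 2) (by positivity) m ?_
    · refine key m _ _ (by rw [hmR]; exact hyn) ?_ (le_of_eq_of_le ?_ this) ?_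
      · rw [hmR]; nlinarith
      · have e : h * ((w (i + 1) t - w i t) / h) = w (i + 1) t - w i t := by field_simp
        rw [e]; simp
      · have h1 := hb (i + m) (by omega) (by omega)
        have h2 := hb i (by omega) (by omega)
        simp only [Nat.cast_zero, add_zero]
        linarith
    · intro k hk
      have := hsd (i + (k + 1)) (by omega) (by omega)
      push_cast
      rw [show i + ((k : ℤ) + 2) = i + (k + 1) + 1 by ring,
        show i + (k : ℤ) = i + (k + 1) - 1 by ring]
      simpa using this
  · obtain ⟨m, hm⟩ : ∃ m : ℕ, (m : ℤ) = i + 1 := ⟨(i + 1).toNat, by omega⟩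
    have hmR : (m : ℝ) = i + 1 := by exact_mod_cast hm
    have := convex_seq_bound (fun k => w (i + 1 - k) t) (δ := κ * h ^ 2) (by positivity) m ?_
    · refine key m _ _ (by rw [hmR]; linarith) ?_ (le_of_eq_of_le ?_ this) ?_
      · rw [hmR]; nlinarith
      · have e : h * -((w (i + 1) t - w i t) / h) = w i t - w (i + 1) t := by field_simp; ring
        rw [e]; simp
      · have h1 := hb (i + 1 - m) (by omega) (by omega)
        have h2 := hb (i + 1) (by omega) (by omega)
        simp only [Nat.cast_zero, sub_zero]
        linarith
    · intro k hk
      have := hsd (i + 1 - (k + 1)) (by omega) (by omega)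
      push_cast
      rw [show i + 1 - ((k : ℤ) + 2) = i + 1 - (k + 1) - 1 by ring,
        show i + 1 - (k : ℤ) = i + 1 - (k + 1) + 1 by ring]
      linarith

end LineScheme

/-- Mesh width of the uniform grid with `n + 1` cells. -/
noncomputable def mesh (c d : ℝ) (n : ℕ) : ℝ := (d - c) / (n + 1)

/-- Schemes on finer and finer grids of `[c, d]`, started from the positive datum `f`. -/
structure SchemeFamily (c d M S : ℝ) (f : ℝ → ℝ) (W : ℕ → ℤ → ℝ → ℝ) : Prop where
  lt : c < d
  one_le : 1 ≤ M
  S_pos : 0 < S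
  f_cont : ContinuousOn f (Icc c d)
  f_pos : ∀ x ∈ Ioo c d, 0 < f x
  f_nonneg : ∀ x ∈ Icc c d, 0 ≤ f x
  f_le : ∀ x ∈ Icc c d, f x ≤ M
  f_left : f c ≤ 1
  f_right : f d ≤ 1
  scheme : ∀ n : ℕ, LineScheme (n + 1) (mesh c d n) M S (f c) (f d)
    (fun i => f (c + i * mesh c d n)) (W n)

/-- Bounds uniform in `n` on compact subsets of `(c, d) × (0, S]`. -/
def LocBdd (c d S : ℝ) (h : ℕ → ℝ) (X : ℕ → ℤ → ℝ → ℝ) : Prop :=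
  ∀ A B τ, c < A → B < d → 0 < τ → ∃ C, ∀ᶠ n in atTop, ∀ i : ℤ, A ≤ c + i * h n →
    c + i * h n ≤ B → ∀ t ∈ Icc τ S, |X n i t| ≤ C

/-- Forward difference quotient. -/
noncomputable def fdiff (h : ℕ → ℝ) (X : ℕ → ℤ → ℝ → ℝ) (n : ℕ) (i : ℤ) (t : ℝ) : ℝ :=
  (X n (i + 1) t - X n i t) / h n

theorem eventually_shift {h : ℕ → ℝ} (hh : Tendsto h atTop (𝓝 0)) {A A' B B' : ℝ} (hA : A' < A)
    (hB : B < B') (k : ℤ) (c : ℝ) : ∀ᶠ n in atTop, ∀ i : ℤ, A ≤ c + i * h n → c + i * h n ≤ B →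
      A' ≤ c + (i + k : ℤ) * h n ∧ c + (i + k : ℤ) * h n ≤ B' := by
  have h1 : Tendsto (fun n => k * h n) atTop (𝓝 0) := by simpa using hh.const_mul (k : ℝ)
  filter_upwards [h1.eventually_lt_const (sub_pos.mpr hB),
    h1.eventually_const_lt (sub_neg.mpr hA)] with n h2 h3 i h4 h5
  push_cast
  constructor <;> linarith

theorem LocBdd.shift {c d S : ℝ} {h : ℕ → ℝ} {X : ℕ → ℤ → ℝ → ℝ} (hX : LocBdd c d S h X)
    (hh : Tendsto h atTop (𝓝 0)) (k : ℤ) : LocBdd c d S h (fun n i t => X n (i + k) t) := by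
  intro A B τ hA hB hτ
  obtain ⟨C, hC⟩ := hX ((c + A) / 2) ((B + d) / 2) τ (by linarith) (by linarith) hτ
  refine ⟨C, ?_⟩
  filter_upwards [hC, eventually_shift hh (show (c + A) / 2 < A by linarith)
    (show B < (B + d) / 2 by linarith) k c] with n h1 h2 i h3 h4 t ht
  exact h1 _ (h2 i h3 h4).1 (h2 i h3 h4).2 t ht

theorem mesh_pos {c d : ℝ} (h : c < d) (n : ℕ) : 0 < mesh c d n :=
  div_pos (by linarith) (by positivity)

theorem tendsto_mesh (c d : ℝ) : Tendsto (mesh c d) atTop (𝓝 0) := by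
  have := (tendsto_one_div_add_atTop_nhds_zero_nat (𝕜 := ℝ)).const_mul (d - c)
  rw [mul_zero] at this
  exact this.congr fun n => by rw [mesh, mul_one_div]

theorem mul_mesh (c d : ℝ) (n : ℕ) : ((n : ℝ) + 1) * mesh c d n = d - c := by
  unfold mesh
  field_simp

namespace SchemeFamily

variable {c d M S : ℝ} {f : ℝ → ℝ} {W : ℕ → ℤ → ℝ → ℝ}

theorem index_pos (hW : SchemeFamily c d M S f W) {n : ℕ} {i : ℤ} (h : c < c + i * mesh c d n) :
    0 < i := by
  have h1 := mesh_pos hW.lt n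
  have h2 : 0 < (i : ℝ) := by
    by_contra! hc
    nlinarith
  exact_mod_cast h2

theorem index_lt (hW : SchemeFamily c d M S f W) {n : ℕ} {i : ℤ} (h : c + i * mesh c d n < d) :
    i < n + 1 := by
  have h1 := mesh_pos hW.lt n
  have h3 := mul_mesh c d n
  have h2 : (i : ℝ) < n + 1 := by
    by_contra! hc
    nlinarith
  exact_mod_cast h2

theorem node_mem (hW : SchemeFamily c d M S f W) {n : ℕ} {i : ℤ} (h0 : 0 < i) (h1 : i < n + 1) :
    c + i * mesh c d n ∈ Ioo c d := by
  have h2 := mesh_pos hW.lt n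
  have h3 := mul_mesh c d n
  have h4 : (0 : ℝ) < i := by exact_mod_cast h0
  have h5 : (i : ℝ) < n + 1 := by exact_mod_cast h1
  constructor <;> nlinarith

theorem locBdd (hW : SchemeFamily c d M S f W) : LocBdd c d S (mesh c d) W := by
  intro A B τ hA hB hτ
  refine ⟨M, Eventually.of_forall fun n i h1 h2 t ht => ?_⟩
  have h3 := hW.index_pos (hA.trans_le h1)
  have h4 := hW.index_lt (h2.trans_lt hB)
  have ht' : t ∈ Icc 0 S := ⟨hτ.le.trans ht.1, ht.2⟩
  rw [abs_of_nonneg ((hW.scheme n).nonneg i t h3.le h4.le ht')]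
  exact (hW.scheme n).le i t h3.le h4.le ht'

theorem locBdd_slope (hW : SchemeFamily c d M S f W) :
    LocBdd c d S (mesh c d) (fdiff (mesh c d) W) := by
  intro A B τ hA hB hτ
  refine ⟨M / min (A - c) (d - B) + (1 / τ + 1) * (d - c),
    Eventually.of_forall fun n i h1 h2 t ht => ?_⟩
  have h3 := hW.index_pos (hA.trans_le h1)
  have h4 := hW.index_lt (h2.trans_lt hB)
  have h5 := mul_mesh c d n
  refine (hW.scheme n).abs_slope_le (mesh_pos hW.lt n) hτ ?_ h3 h4 ?_ ?_ ?_ ht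
  · exact lt_min (by linarith) (by linarith)
  · exact (min_le_left _ _).trans (by linarith)
  · refine (min_le_right _ _).trans ?_
    push_cast
    linarith
  · push_cast
    exact h5.le

theorem exists_lower_bound (hW : SchemeFamily c d M S f W) {A B : ℝ} (hA : c < A) (hB : B < d) :
    ∃ m > 0, ∀ n : ℕ, ∀ i : ℤ, A ≤ c + i * mesh c d n → c + i * mesh c d n ≤ B →
      ∀ t ∈ Icc 0 S, m ≤ W n i t := by
  rcases lt_or_ge B A with hBA | hAB
  · exact ⟨1, one_pos, fun n i h1 h2 => by linarith⟩
  set A' := (c + A) / 2 with hA'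
  set B' := (B + d) / 2 with hB'
  have hsub : Icc A' B' ⊆ Ioo c d := fun x hx => ⟨by linarith [hx.1], by linarith [hx.2]⟩
  obtain ⟨μ, hμ, hμf⟩ := isCompact_Icc.exists_forall_le'
    (hW.f_cont.mono (hsub.trans Ioo_subset_Icc_self)) (fun x hx => hW.f_pos x (hsub hx))
  have hcd := hW.lt
  have hY : 0 < d - c := by linarith
  set κ := μ / (2 * (d - c) ^ 2) with hκ
  have hκ0 : 0 < κ := by positivity
  set K := 2 * κ + M with hK
  have hK0 : 0 < K := by have := hW.one_le; positivity
  have hA1 : 0 < A - A' := by linarith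
  have hB1 : 0 < B' - B := by linarith
  refine ⟨κ * Real.exp (-(K * S)) * ((A - A') * (B' - B)), by positivity, ?_⟩
  intro n i h1 h2 t ht
  have h3 := hW.index_pos (hA.trans_le h1)
  have h4 := hW.index_lt (h2.trans_lt hB)
  have hh := mesh_pos hW.lt n
  have hmm := mul_mesh c d n
  set h := mesh c d n with hhd
  have key := (hW.scheme n).lt_of_subsolution
    (v := fun i t => κ * Real.exp (-(K * t)) * ((c + i * h - A') * (B' - (c + i * h))))
    (v' := fun i t => -K * (κ * Real.exp (-(K * t)) * ((c + i * h - A') * (B' - (c + i * h)))))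
    ?_ ?_ ?_ ?_ ?_ i t h3.le h4.le ht
  · refine le_trans ?_ key.le
    have : K * t ≤ K * S := by have := ht.2; gcongr
    gcongr
    linarith
  · intro i t
    have := (((hasDerivAt_id t).const_mul K).neg.exp.const_mul κ).mul_const
      ((c + i * h - A') * (B' - (c + i * h)))
    refine this.congr_deriv ?_
    simp only [id, Pi.neg_apply]
    ring
  · intro i hi0 hin
    have hx := hW.node_mem hi0 hin
    rw [← hhd] at hx
    simp only [mul_zero, neg_zero, Real.exp_zero, mul_one]
    set x := c + i * h with hxd
    by_cases hc : x ∈ Icc A' B'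
    · have h5 := hμf x hc
      have h6 : (x - A') * (B' - x) ≤ (d - c) ^ 2 := by
        rw [sq]
        apply mul_le_mul <;> linarith [hc.1, hc.2]
      have h7 : κ * ((x - A') * (B' - x)) ≤ κ * (d - c) ^ 2 := by gcongr
      have h8 : κ * (d - c) ^ 2 = μ / 2 := by rw [hκ]; field_simp
      linarith
    · have h5 : (x - A') * (B' - x) ≤ 0 := by
        rw [mem_Icc, not_and_or, not_le, not_le] at hc
        rcases hc with hc | hc
        · exact mul_nonpos_of_nonpos_of_nonneg (by linarith) (by linarith)
        · exact mul_nonpos_of_nonneg_of_nonpos (by linarith) (by linarith)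
      have h6 := mul_nonpos_of_nonneg_of_nonpos hκ0.le h5
      linarith [hW.f_pos x hx]
  · intro t _
    have h5 := hW.f_nonneg c ⟨le_rfl, hcd.le⟩
    have h6 : (c + ((0 : ℤ) : ℝ) * h - A') * (B' - (c + ((0 : ℤ) : ℝ) * h)) < 0 := by
      simp only [Int.cast_zero, zero_mul, add_zero]
      exact mul_neg_of_neg_of_pos (by linarith) (by linarith)
    exact (mul_neg_of_pos_of_neg (by positivity) h6).trans_le h5
  · intro t _
    have h5 := hW.f_nonneg d ⟨hcd.le, le_rfl⟩
    have h6 : (c + (((n : ℤ) + 1 : ℤ) : ℝ) * h - A') * (B' - (c + (((n : ℤ) + 1 : ℤ) : ℝ) * h))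
        < 0 := by
      push_cast
      rw [hmm]
      exact mul_neg_of_pos_of_neg (by linarith) (by linarith)
    exact (mul_neg_of_pos_of_neg (by positivity) h6).trans_le h5
  · intro i hi0 hin t ht hv hvM
    rw [mul_comm (-K)]
    apply mul_lt_mul_of_pos_left _ hv
    set v := κ * Real.exp (-(K * t)) * ((c + i * h - A') * (B' - (c + i * h))) with hvd
    have e : rate h (fun i t => κ * Real.exp (-(K * t)) * ((c + i * h - A') * (B' - (c + i * h))))
        i t = -2 * (κ * Real.exp (-(K * t))) + 1 - v := by
      simp only [rate, hvd]
      push_cast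
      field_simp
      ring
    rw [e]
    have h6 : Real.exp (-(K * t)) ≤ 1 := by
      rw [Real.exp_le_one_iff]
      have := ht.1
      have : 0 < K * t := by positivity
      linarith
    have h7 := mul_le_mul_of_nonneg_left h6 hκ0.le
    linarith

end SchemeFamily

theorem exists_eventually_le_of_parabolic {c S A A₁ B B₁ τ τ₁ M C₁ a C C₀ : ℝ} {h : ℕ → ℝ}
    {F F' α β : ℕ → ℤ → ℝ → ℝ} (hh : ∀ n, 0 < h n) (hh0 : Tendsto h atTop (𝓝 0)) (hAB : A ≤ B)
    (hA : A₁ < A) (hB : B < B₁) (hτ : τ₁ < τ) (hM : 0 ≤ M) (hC₁ : 0 ≤ C₁) (ha : 0 < a)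
    (hC : 0 ≤ C) (hC₀ : 0 ≤ C₀)
    (H1 : ∀ᶠ n in atTop, ∀ i : ℤ, A₁ + h n ≤ c + i * h n → c + i * h n ≤ B₁ - h n →
      ContinuousOn (F n i) (Icc τ₁ S) ∧ ∀ t ∈ Icc τ₁ S, F n i t ≤ C₀ / h n ^ 2)
    (H2 : ∀ᶠ n in atTop, ∀ i : ℤ, A₁ + 2 * h n ≤ c + i * h n → c + i * h n ≤ B₁ - 2 * h n →
      ∀ t ∈ Ioc τ₁ S, HasDerivAt (F n i) (F' n i t) t ∧ α n i t ∈ Icc 0 M ∧ β n i t ∈ Icc 0 M ∧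
        |α n i t - β n i t| ≤ C₁ * h n ∧
        F' n i t ≤ (α n i t * (F n (i + 1) t - F n i t) + β n i t * (F n (i - 1) t - F n i t))
          / h n ^ 2 - a * F n i t ^ 2 + C) :
    ∃ D, ∀ᶠ n in atTop, ∀ i : ℤ, A ≤ c + i * h n → c + i * h n ≤ B →
      ∀ t ∈ Icc τ S, F n i t ≤ D := by
  obtain ⟨K, hK, hb⟩ := exists_local_sup_bound (Y := B₁ - A₁) hM hC₁ (by linarith) ha hC hC₀
  refine ⟨K * (1 / (A - A₁) ^ 2 + 1 / (B₁ - B) ^ 2 + 1 / (τ - τ₁)), ?_⟩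
  filter_upwards [H1, H2, hh0.eventually_lt_const (sub_pos.mpr hA),
    hh0.eventually_lt_const (sub_pos.mpr hB)] with n h1 h2 h3 h4 i h5 h6 t ht
  have := hb (h n) c A₁ B₁ τ₁ S (F n) (F' n) (α n) (β n) (hh n) le_rfl
    (fun i hi hi' => (h1 i hi hi').1) (fun i hi hi' => (h1 i hi hi').2)
    (fun i hi hi' t ht => by
      obtain ⟨a1, a2, a3, a4, a5⟩ := h2 i hi hi' t ht
      exact ⟨a1, a2, a3, a4, fun _ => a5⟩)
    i (by linarith) (by linarith) t ⟨hτ.trans_le ht.1, ht.2⟩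
  refine this.trans ?_
  have hA0 : 0 < A - A₁ := by linarith
  have hB0 : 0 < B₁ - B := by linarith
  have hτ0 : 0 < τ - τ₁ := by linarith
  have ht1 := ht.1
  gcongr

theorem rate_absorption {M m K₁ w w' w'' s s' z z' : ℝ} (hm : 0 < m)
    (hw : w ∈ Icc 0 M) (hw' : w' ∈ Icc 0 M) (hw'' : m ≤ w'') (hs : |s| ≤ K₁) (hs' : |s'| ≤ K₁) :
    (z + 1 - w) ^ 2 - (z + 1 - w) +
      2 / m * (2 * s * (s * (1 - w - w') - s' * z) - w' * z' ^ 2 - w'' * z ^ 2) ≤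
    -(1 / 8) * (z + 1 - w + 2 / m * s ^ 2) ^ 2 + (5 * (1 + M) ^ 2 + 1 + (1 + M)
      + 4 / m * K₁ ^ 2 * (1 + 2 * M) + (4 / m * K₁ ^ 2) ^ 2 + (1 + M + 2 / m * K₁ ^ 2) ^ 2) := by
  have hK : 0 ≤ K₁ := (abs_nonneg s).trans hs
  have hM : 0 ≤ M := hw.1.trans hw.2
  have hs2 : s ^ 2 ≤ K₁ ^ 2 := sq_le_sq' (abs_le.mp hs).1 (abs_le.mp hs).2
  have e1 : 2 / m * (2 * s * (s * (1 - w - w'))) ≤ 4 / m * K₁ ^ 2 * (1 + 2 * M) := by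
    have h1 : s ^ 2 * (1 - w - w') ≤ K₁ ^ 2 * (1 + 2 * M) := by
      refine (mul_le_mul_of_nonneg_left (by linarith [hw.1, hw'.1] : 1 - w - w' ≤ 1 + 2 * M)
        (sq_nonneg s)).trans ?_
      gcongr
    have h2 : 2 / m * (2 * s * (s * (1 - w - w'))) = 4 / m * (s ^ 2 * (1 - w - w')) := by ring
    rw [h2, mul_assoc]
    gcongr
  have e2 : 2 / m * (2 * s * (-(s' * z))) ≤ z ^ 2 / 4 + (4 / m * K₁ ^ 2) ^ 2 := by
    have h1 : |s * s'| ≤ K₁ ^ 2 := by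
      rw [abs_mul, sq]
      gcongr
    have h2 : |4 / m * (s * s')| ≤ 4 / m * K₁ ^ 2 := by
      rw [abs_mul, abs_of_pos (by positivity)]
      gcongr
    have h3 := sq_le_sq' (abs_le.mp h2).1 (abs_le.mp h2).2
    have h4 : 2 / m * (2 * s * (-(s' * z))) = -(4 / m * (s * s')) * z := by ring
    rw [h4]
    nlinarith [sq_nonneg (z / 2 + 4 / m * (s * s'))]
  have e3 : 2 / m * (-(w' * z' ^ 2)) ≤ 0 := by
    have := hw'.1
    have : 0 ≤ 2 / m * (w' * z' ^ 2) := by positivity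
    linarith
  have e4 : 2 / m * (-(w'' * z ^ 2)) ≤ -2 * z ^ 2 := by
    have : 2 / m * (m * z ^ 2) ≤ 2 / m * (w'' * z ^ 2) := by gcongr
    have e : 2 / m * (m * z ^ 2) = 2 * z ^ 2 := by field_simp
    linarith
  set g := 1 - w with hg
  have hg1 : g ≤ 1 + M := by linarith [hw.1]
  have hg2 : -(1 + M) ≤ g := by linarith [hw.2]
  have hg3 : g ^ 2 ≤ (1 + M) ^ 2 := sq_le_sq' hg2 hg1
  have e5 : (z + g) ^ 2 ≤ 5 / 4 * z ^ 2 + 5 * (1 + M) ^ 2 := by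
    nlinarith [sq_nonneg (z - 4 * g)]
  have e6 : -(z + g) ≤ z ^ 2 / 4 + 1 + (1 + M) := by nlinarith [sq_nonneg (z / 2 + 1)]
  set r := 2 / m * s ^ 2 with hr
  have hr0 : 0 ≤ r := by positivity
  have hr1 : r ≤ 2 / m * K₁ ^ 2 := by rw [hr]; gcongr
  have e7 : (z + g + r) ^ 2 ≤ 2 * z ^ 2 + 2 * (1 + M + 2 / m * K₁ ^ 2) ^ 2 := by
    have h1 : (g + r) ^ 2 ≤ (1 + M + 2 / m * K₁ ^ 2) ^ 2 :=
      sq_le_sq' (by linarith) (by linarith)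
    nlinarith [sq_nonneg (z - (g + r))]
  have e8 : 0 ≤ (1 + M + 2 / m * K₁ ^ 2) ^ 2 := sq_nonneg _
  have e9 : z + 1 - w = z + g := by rw [hg]; ring
  rw [e9]
  have e10 : 2 / m * (2 * s * (s * (1 - w - w') - s' * z) - w' * z' ^ 2 - w'' * z ^ 2) =
    2 / m * (2 * s * (s * (1 - w - w'))) + 2 / m * (2 * s * (-(s' * z)))
      + 2 / m * (-(w' * z' ^ 2)) + 2 / m * (-(w'' * z ^ 2)) := by ring
  rw [e10]
  linarith

theorem rate_diff_absorption {m Q K₁ D σ e e' q s κ w w' : ℝ} (hm : 0 < m) (hσ : |σ| ≤ 1)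
    (hq : |q| ≤ Q) (hs : |s| ≤ K₁) (hκ : |κ| ≤ D) (hw : m ≤ w) (hw' : 0 ≤ w') :
    σ * (e * κ) + (2 * q * (q ^ 2 - q) - 2 * q * s * e - w * e ^ 2 - w' * e' ^ 2) ≤
      -(m / 4) * (σ * e + q ^ 2) ^ 2
        + ((D + 2 * Q * K₁) ^ 2 / m + 2 * Q ^ 3 + m * (Q ^ 2) ^ 2) := by
  have hQ : 0 ≤ Q := (abs_nonneg q).trans hq
  have hq2 : q ^ 2 ≤ Q ^ 2 := sq_le_sq' (abs_le.mp hq).1 (abs_le.mp hq).2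
  have h1 : |σ * κ - 2 * q * s| ≤ D + 2 * Q * K₁ := by
    refine (abs_sub _ _).trans ?_
    rw [abs_mul, abs_mul, abs_mul]
    have := mul_le_mul hσ hκ (abs_nonneg _) zero_le_one
    have := mul_le_mul hq hs (abs_nonneg _) hQ
    rw [abs_two]
    linarith
  have h2 := sq_le_sq' (abs_le.mp h1).1 (abs_le.mp h1).2
  set X := σ * κ - 2 * q * s with hX
  have e1 : X * e ≤ m / 4 * e ^ 2 + (D + 2 * Q * K₁) ^ 2 / m := by
    have h3 : X ^ 2 / m ≤ (D + 2 * Q * K₁) ^ 2 / m := by gcongr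
    have h4 : 0 ≤ m / 4 * (e - 2 * X / m) ^ 2 := by positivity
    have h5 : m / 4 * (e - 2 * X / m) ^ 2 = m / 4 * e ^ 2 - X * e + X ^ 2 / m := by
      field_simp
      ring
    linarith
  have e2 : 2 * q * (q ^ 2 - q) ≤ 2 * Q ^ 3 := by
    have h3 : q * q ^ 2 ≤ Q * Q ^ 2 := by
      have := (abs_le.mp hq).2
      gcongr
    nlinarith [sq_nonneg q]
  have e3 : m * e ^ 2 ≤ w * e ^ 2 := by gcongr
  have e4 : 0 ≤ w' * e' ^ 2 := by positivity
  have e5 : (σ * e + q ^ 2) ^ 2 ≤ 2 * e ^ 2 + 2 * (Q ^ 2) ^ 2 := by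
    have h3 : σ ^ 2 ≤ 1 := by rw [sq_le_one_iff_abs_le_one]; exact hσ
    have h4 : (q ^ 2) ^ 2 ≤ (Q ^ 2) ^ 2 := by gcongr
    have h5 : σ ^ 2 * e ^ 2 ≤ 1 * e ^ 2 := by gcongr
    nlinarith [sq_nonneg (σ * e - q ^ 2)]
  have e6 : m / 4 * (σ * e + q ^ 2) ^ 2 ≤ m / 4 * (2 * e ^ 2 + 2 * (Q ^ 2) ^ 2) := by gcongr
  have e7 : 0 ≤ m * (Q ^ 2) ^ 2 := by positivity
  have e8 : 0 ≤ m * e ^ 2 := by positivity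
  have e9 : σ * (e * κ) + (2 * q * (q ^ 2 - q) - 2 * q * s * e - w * e ^ 2 - w' * e' ^ 2) =
    X * e + 2 * q * (q ^ 2 - q) - w * e ^ 2 - w' * e' ^ 2 := by rw [hX]; ring
  rw [e9]
  linarith

namespace LineScheme

variable {n : ℤ} {h M S α β : ℝ} {f : ℤ → ℝ} {w : ℤ → ℝ → ℝ}

theorem hasDerivAt_rate_generator (hw : LineScheme n h M S α β f w) (hh : 0 < h) {i : ℤ}
    (h0 : 0 < i - 1) (hi : i + 1 < n) {t : ℝ} (ht : t ∈ Ioc 0 S) :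
    HasDerivAt (rate h w i) ((w (i + 1) t * (rate h w (i + 1) t - rate h w i t)
      + w (i - 1) t * (rate h w (i - 1) t - rate h w i t)) / h ^ 2
      + rate h w i t ^ 2 - rate h w i t) t := by
  refine (hw.hasDerivAt_rate (by omega) (by omega) ht).congr_deriv ?_
  rw [velocity, velocity, velocity, if_pos (by omega), if_pos (by omega), if_pos (by omega)]
  have e : rate h w i t = (w (i + 1) t - 2 * w i t + w (i - 1) t) / h ^ 2 + 1 - w i t := rfl
  have e2 : (w (i + 1) t - 2 * w i t + w (i - 1) t) = (rate h w i t - 1 + w i t) * h ^ 2 := by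
    rw [e]
    field_simp
    ring
  field_simp
  linear_combination rate h w i t * e2

theorem hasDerivAt_slope (hw : LineScheme n h M S α β f w) {i : ℤ}
    (h0 : 0 < i) (hi : i + 1 < n) {t : ℝ} (ht : t ∈ Ioc 0 S) :
    HasDerivAt (fun t => (w (i + 1) t - w i t) / h)
      ((w (i + 1) t * rate h w (i + 1) t - w i t * rate h w i t) / h) t :=
  ((hw.deriv (i + 1) (by omega) hi t ht).sub (hw.deriv i h0 (by omega) t ht)).div_const h

theorem slope_sq_generator {h a b p q₁ q z₁ z s₁ s s₀ : ℝ} (hh : h ≠ 0)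
    (hs : s = (a - b) / h) (hs0 : s₀ = (b - p) / h)
    (hz1 : z₁ = (s₁ - s) / h) (hz : z = (s - s₀) / h)
    (hq1 : q₁ = z₁ + 1 - a) (hq : q = z + 1 - b) :
    2 * s * ((a * q₁ - b * q) / h) = (a * (s₁ ^ 2 - s ^ 2) + p * (s₀ ^ 2 - s ^ 2)) / h ^ 2
      + (2 * s * (s * (1 - b - a) - s₀ * z) - a * z₁ ^ 2 - p * z ^ 2) := by
  have ha : a = b + h * s := by rw [hs]; field_simp; ring
  have hp : p = b - h * s₀ := by rw [hs0]; field_simp; ring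
  have h1 : s₁ = s + h * z₁ := by rw [hz1]; field_simp; ring
  have h2 : s₀ = s - h * z := by rw [hz]; field_simp; ring
  clear hs hs0 hz1 hz
  rw [hq1, hq, h1, ha, hp, h2]
  field_simp
  ring

end LineScheme

namespace SchemeFamily

variable {c d M S : ℝ} {f : ℝ → ℝ} {W : ℕ → ℤ → ℝ → ℝ}

theorem w_mem (hW : SchemeFamily c d M S f W) {n : ℕ} {i : ℤ} (h0 : 0 < i) (h1 : i < n + 1)
    {t : ℝ} (ht : t ∈ Icc 0 S) : W n i t ∈ Icc 0 M :=
  ⟨(hW.scheme n).nonneg i t h0.le h1.le ht, (hW.scheme n).le i t h0.le h1.le ht⟩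

theorem locBdd_rate (hW : SchemeFamily c d M S f W) :
    LocBdd c d S (mesh c d) (fun n i t => rate (mesh c d n) (W n) i t) := by
  intro A B τ hA hB hτ
  rcases lt_or_ge B A with hBA | hAB
  · exact ⟨0, Eventually.of_forall fun n i h1 h2 => by linarith⟩
  set A₁ := (c + A) / 2 with hA₁
  set B₁ := (B + d) / 2 with hB₁
  obtain ⟨m, hm, hmW⟩ := hW.exists_lower_bound (A := A₁) (B := B₁) (by linarith) (by linarith)
  obtain ⟨K₁, hK₁⟩ := hW.locBdd_slope A₁ B₁ (τ / 2) (by linarith) (by linarith) (by linarith)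
  have hM : 0 ≤ M := by linarith [hW.one_le]
  have hh := mesh_pos hW.lt
  have hh0 := tendsto_mesh c d
  set K := max K₁ 0 with hK
  have hK0 : 0 ≤ K := le_max_right _ _
  have key := exists_eventually_le_of_parabolic (c := c) (S := S) (A := A) (A₁ := A₁)
    (B := B) (B₁ := B₁) (τ := τ) (τ₁ := τ / 2) (M := M) (C₁ := 2 * K) (a := 1 / 8)
    (C := 5 * (1 + M) ^ 2 + 1 + (1 + M) + 4 / m * K ^ 2 * (1 + 2 * M) + (4 / m * K ^ 2) ^ 2
      + (1 + M + 2 / m * K ^ 2) ^ 2) (C₀ := 2 * M + 1 + 2 / m * K ^ 2) (h := mesh c d)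
    (F := fun n i t => rate (mesh c d n) (W n) i t + 2 / m * (fdiff (mesh c d) W n i t) ^ 2)
    (F' := fun n i t => ((W n (i + 1) t * (rate (mesh c d n) (W n) (i + 1) t
        - rate (mesh c d n) (W n) i t)
      + W n (i - 1) t * (rate (mesh c d n) (W n) (i - 1) t - rate (mesh c d n) (W n) i t))
        / mesh c d n ^ 2
      + rate (mesh c d n) (W n) i t ^ 2 - rate (mesh c d n) (W n) i t)
      + 2 / m * (2 * fdiff (mesh c d) W n i t * ((W n (i + 1) t * rate (mesh c d n) (W n) (i + 1) t
        - W n i t * rate (mesh c d n) (W n) i t) / mesh c d n)))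
    (α := fun n i t => W n (i + 1) t) (β := fun n i t => W n (i - 1) t)
    hh hh0 hAB (by linarith) (by linarith) (by linarith) hM (by positivity) (by norm_num)
    (by positivity) (by positivity) ?_ ?_
  · obtain ⟨D, hD⟩ := key
    refine ⟨max D (1 / τ), ?_⟩
    filter_upwards [hD] with n hn i h1 h2 t ht
    have h3 := hW.index_pos (hA.trans_le h1)
    have h4 := hW.index_lt (h2.trans_lt hB)
    have h5 := (hW.scheme n).neg_inv_le_rate i h3 h4 t ⟨hτ.trans_le ht.1, ht.2⟩
    have h6 : 1 / t ≤ 1 / τ := one_div_le_one_div_of_le hτ ht.1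
    have h7 := hn i h1 h2 t ht
    have h8 : 0 ≤ 2 / m * (fdiff (mesh c d) W n i t) ^ 2 := by positivity
    rw [abs_le]
    constructor
    · linarith [le_max_right D (1 / τ)]
    · linarith [le_max_left D (1 / τ)]
  · filter_upwards [hK₁, hh0.eventually_lt_const zero_lt_one] with n h1 hn1 i h2 h3
    have hhn := hh n
    have p1 := hW.index_pos (n := n) (i := i - 1) (by push_cast; linarith)
    have p2 := hW.index_lt (n := n) (i := i + 1) (by push_cast; linarith)
    have hs := hW.scheme n
    constructor
    · refine (((hs.continuousOn_rate (by omega) (by omega)).add (continuousOn_const.mul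
        ((((hs.cont (i + 1) (by omega) (by omega)).sub (hs.cont i (by omega) (by omega))).div_const
          _).pow 2)))).mono (Icc_subset_Icc (by linarith) le_rfl)
    · intro t ht
      have ht' : t ∈ Icc 0 S := ⟨by linarith [ht.1], ht.2⟩
      have w1 := hW.w_mem (n := n) (i := i + 1) (by omega) (by omega) ht'
      have w2 := hW.w_mem (n := n) (i := i) (by omega) (by omega) ht'
      have w3 := hW.w_mem (n := n) (i := i - 1) (by omega) (by omega) ht'
      have h4 := (h1 i (by linarith) (by linarith) t ht).trans (le_max_left K₁ 0)
      have h5 := sq_le_sq' (abs_le.mp h4).1 (abs_le.mp h4).2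
      have h6 : 2 / m * (fdiff (mesh c d) W n i t) ^ 2 ≤ 2 / m * K ^ 2 := by gcongr
      have h7 : mesh c d n ^ 2 ≤ 1 := by rw [sq_le_one_iff_abs_le_one, abs_of_pos hhn]; exact hn1.le
      have h8 : rate (mesh c d n) (W n) i t ≤ 2 * M / mesh c d n ^ 2 + 1 := by
        unfold rate
        have : (W n (i + 1) t - 2 * W n i t + W n (i - 1) t) / mesh c d n ^ 2
            ≤ 2 * M / mesh c d n ^ 2 := by
          gcongr
          linarith [w1.2, w2.1, w3.2]
        linarith [w2.1]
      refine (add_le_add h8 h6).trans ?_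
      have h9 : 1 + 2 / m * K ^ 2 ≤ (1 + 2 / m * K ^ 2) / mesh c d n ^ 2 := by
        rw [le_div_iff₀ (by positivity)]
        exact mul_le_of_le_one_right (by positivity) h7
      have h10 : (2 * M + 1 + 2 / m * K ^ 2) / mesh c d n ^ 2 =
        2 * M / mesh c d n ^ 2 + (1 + 2 / m * K ^ 2) / mesh c d n ^ 2 := by ring
      linarith
  · filter_upwards [hK₁] with n h1 i h2 h3 t ht
    have hhn := hh n
    have p1 := hW.index_pos (n := n) (i := i - 2) (by push_cast; linarith)
    have p2 := hW.index_lt (n := n) (i := i + 2) (by push_cast; linarith)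
    have hs := hW.scheme n
    have ht0 : t ∈ Ioc 0 S := ⟨by linarith [ht.1], ht.2⟩
    have ht' : t ∈ Icc 0 S := Ioc_subset_Icc_self ht0
    have w1 := hW.w_mem (n := n) (i := i + 1) (by omega) (by omega) ht'
    have w2 := hW.w_mem (n := n) (i := i) (by omega) (by omega) ht'
    have w3 := hW.w_mem (n := n) (i := i - 1) (by omega) (by omega) ht'
    have hmw := hmW n (i - 1) (by push_cast; linarith) (by push_cast; linarith) t ht'
    have s1 := (h1 i (by linarith) (by linarith) t (Ioc_subset_Icc_self ht)).trans
      (le_max_left K₁ 0)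
    have s0 := (h1 (i - 1) (by push_cast; linarith) (by push_cast; linarith) t
      (Ioc_subset_Icc_self ht)).trans (le_max_left K₁ 0)
    have es : fdiff (mesh c d) W n i t = (W n (i + 1) t - W n i t) / mesh c d n := rfl
    have es0 : fdiff (mesh c d) W n (i - 1) t = (W n i t - W n (i - 1) t) / mesh c d n := by
      simp [fdiff]
    have es1 : fdiff (mesh c d) W n (i + 1) t = (W n (i + 2) t - W n (i + 1) t) / mesh c d n := by
      simp [fdiff, add_assoc]
    refine ⟨?_, w1, w3, ?_, ?_⟩
    · have d1 := hs.hasDerivAt_rate_generator hhn (i := i) (by omega) (by omega) ht0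
      have d2 := ((hs.hasDerivAt_slope (i := i) (by omega) (by omega) ht0).pow 2).const_mul (2 / m)
      refine (d1.add d2).congr_deriv ?_
      simp only [fdiff]
      push_cast
      ring
    · have e : W n (i + 1) t - W n (i - 1) t
          = mesh c d n * (fdiff (mesh c d) W n i t + fdiff (mesh c d) W n (i - 1) t) := by
        rw [es, es0]
        field_simp
        ring
      rw [e, abs_mul, abs_of_pos hhn, mul_comm]
      gcongr
      refine (abs_add_le _ _).trans ?_
      linarith
    · set s := fdiff (mesh c d) W n i t with hsd
      set s₀ := fdiff (mesh c d) W n (i - 1) t with hs0d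
      set s₁ := fdiff (mesh c d) W n (i + 1) t with hs1d
      set z := (s - s₀) / mesh c d n with hz
      set z₁ := (s₁ - s) / mesh c d n with hz1
      have q0 : rate (mesh c d n) (W n) i t = z + 1 - W n i t := by
        rw [hz, es, es0]
        unfold rate
        field_simp
        ring
      have q1 : rate (mesh c d n) (W n) (i + 1) t = z₁ + 1 - W n (i + 1) t := by
        rw [hz1, es1, es]
        unfold rate
        rw [show i + 1 + 1 = i + 2 by ring, show i + 1 - 1 = i by ring]
        field_simp
        ring
      have g := LineScheme.slope_sq_generator hhn.ne' es es0 hz1 hz q1 q0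
      have ab := rate_absorption (z' := z₁) (z := z) hm w2 w1 hmw s1 s0
      rw [← q0] at ab
      rw [g]
      refine (sub_nonpos.mp ?_)
      refine le_trans (le_of_eq ?_) (sub_nonpos.mpr ab)
      ring

end SchemeFamily

theorem rate_sq_generator {h w₂ w₁ w₀ wm q₂ q₁ q₀ qm e₁ e₀ em : ℝ} (hh : h ≠ 0)
    (he1 : e₁ = (q₂ - q₁) / h) (he0 : e₀ = (q₁ - q₀) / h) (hem : em = (q₀ - qm) / h) (σ : ℝ) :
    σ * (((w₂ * (q₂ - q₁) + w₀ * (q₀ - q₁)) / h ^ 2 + q₁ ^ 2 - q₁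
        - ((w₁ * (q₁ - q₀) + wm * (qm - q₀)) / h ^ 2 + q₀ ^ 2 - q₀)) / h)
      + 2 * q₀ * ((w₁ * (q₁ - q₀) + wm * (qm - q₀)) / h ^ 2 + q₀ ^ 2 - q₀) =
    (w₂ * (σ * e₁ + q₁ ^ 2 - (σ * e₀ + q₀ ^ 2)) + wm * (σ * em + qm ^ 2 - (σ * e₀ + q₀ ^ 2))) / h ^ 2
      + (σ * (e₀ * ((w₂ - w₁ - w₀ + wm) / h ^ 2 + (q₀ + q₁ - 1)))
        + (2 * q₀ * (q₀ ^ 2 - q₀) - 2 * q₀ * ((w₂ - w₁) / h) * e₀ - w₂ * e₀ ^ 2 - wm * em ^ 2)) := by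
  have h1 : q₁ = q₀ + h * e₀ := by rw [he0]; field_simp; ring
  have h2 : q₂ = q₁ + h * e₁ := by rw [he1]; field_simp; ring
  have h3 : qm = q₀ - h * em := by rw [hem]; field_simp; ring
  clear he1 he0 hem
  rw [h2, h1, h3]
  field_simp
  ring

namespace SchemeFamily

variable {c d M S : ℝ} {f : ℝ → ℝ} {W : ℕ → ℤ → ℝ → ℝ}

theorem exists_signed_rate_slope_le (hW : SchemeFamily c d M S f W) {σ : ℝ} (hσ : |σ| ≤ 1)
    {A B τ : ℝ} (hA : c < A) (hB : B < d) (hτ : 0 < τ) :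
    ∃ D, ∀ᶠ n in atTop, ∀ i : ℤ, A ≤ c + i * mesh c d n → c + i * mesh c d n ≤ B →
      ∀ t ∈ Icc τ S, σ * fdiff (mesh c d) (fun n i t => rate (mesh c d n) (W n) i t) n i t
        + rate (mesh c d n) (W n) i t ^ 2 ≤ D := by
  rcases lt_or_ge B A with hBA | hAB
  · exact ⟨0, Eventually.of_forall fun n i h1 h2 => by linarith⟩
  set A₁ := (c + A) / 2 with hA₁
  set B₁ := (B + d) / 2 with hB₁
  obtain ⟨m, hm, hmW⟩ := hW.exists_lower_bound (A := A₁) (B := B₁) (by linarith) (by linarith)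
  obtain ⟨K₁, hK₁⟩ := hW.locBdd_slope A₁ B₁ (τ / 2) (by linarith) (by linarith) (by linarith)
  obtain ⟨Q₁, hQ₁⟩ := hW.locBdd_rate A₁ B₁ (τ / 2) (by linarith) (by linarith) (by linarith)
  have hM : 0 ≤ M := by linarith [hW.one_le]
  have hh := mesh_pos hW.lt
  have hh0 := tendsto_mesh c d
  set K := max K₁ 0 with hK
  have hK0 : 0 ≤ K := le_max_right _ _
  set Q := max Q₁ 0 with hQ
  have hQ0 : 0 ≤ Q := le_max_right _ _
  set D := 4 * Q + 3 + 2 * M with hD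
  have hD0 : 0 ≤ D := by positivity
  set q : ℕ → ℤ → ℝ → ℝ := fun n i t => rate (mesh c d n) (W n) i t with hq
  refine exists_eventually_le_of_parabolic (c := c) (S := S) (A := A) (A₁ := A₁)
    (B := B) (B₁ := B₁) (τ := τ) (τ₁ := τ / 2) (M := M) (C₁ := 3 * K) (a := m / 4)
    (C := (D + 2 * Q * K) ^ 2 / m + 2 * Q ^ 3 + m * (Q ^ 2) ^ 2) (C₀ := 2 * Q + Q ^ 2)
    (F' := fun n i t => σ * (((W n (i + 2) t * (q n (i + 2) t - q n (i + 1) t)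
          + W n i t * (q n i t - q n (i + 1) t)) / mesh c d n ^ 2 + q n (i + 1) t ^ 2
          - q n (i + 1) t
        - ((W n (i + 1) t * (q n (i + 1) t - q n i t)
          + W n (i - 1) t * (q n (i - 1) t - q n i t)) / mesh c d n ^ 2 + q n i t ^ 2
          - q n i t)) / mesh c d n)
      + 2 * q n i t * ((W n (i + 1) t * (q n (i + 1) t - q n i t)
        + W n (i - 1) t * (q n (i - 1) t - q n i t)) / mesh c d n ^ 2 + q n i t ^ 2 - q n i t))
    (α := fun n i t => W n (i + 2) t) (β := fun n i t => W n (i - 1) t)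
    hh hh0 hAB (by linarith) (by linarith) (by linarith) hM (by positivity) (by positivity)
    (by positivity) (by positivity) ?_ ?_
  · filter_upwards [hQ₁, hh0.eventually_lt_const zero_lt_one] with n h1 hn1 i h2 h3
    have hhn := hh n
    have p1 := hW.index_pos (n := n) (i := i - 1) (by push_cast; linarith)
    have p2 := hW.index_lt (n := n) (i := i + 1) (by push_cast; linarith)
    have hs := hW.scheme n
    constructor
    · refine ((continuousOn_const.mul
        (((hs.continuousOn_rate (i := i + 1) (by omega) (by omega)).sub
        (hs.continuousOn_rate (i := i) (by omega) (by omega))).div_const _)).add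
        ((hs.continuousOn_rate (i := i) (by omega) (by omega)).pow 2)).mono
        (Icc_subset_Icc (by linarith) le_rfl)
    · intro t ht
      have q0 := (h1 i (by linarith) (by linarith) t ht).trans (le_max_left Q₁ 0)
      have q1 := (h1 (i + 1) (by push_cast; linarith) (by push_cast; linarith) t ht).trans
        (le_max_left Q₁ 0)
      have h7 : mesh c d n ^ 2 ≤ 1 := by rw [sq_le_one_iff_abs_le_one, abs_of_pos hhn]; exact hn1.le
      have h8 : q n i t ^ 2 ≤ Q ^ 2 / mesh c d n ^ 2 := by
        rw [le_div_iff₀ (by positivity)]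
        refine (mul_le_of_le_one_right (sq_nonneg _) h7).trans ?_
        exact sq_le_sq' (abs_le.mp q0).1 (abs_le.mp q0).2
      have h9 : σ * fdiff (mesh c d) q n i t ≤ 2 * Q / mesh c d n ^ 2 := by
        refine (le_abs_self _).trans ?_
        rw [abs_mul]
        have h10 : |fdiff (mesh c d) q n i t| ≤ 2 * Q / mesh c d n ^ 2 := by
          have e1 : |q n (i + 1) t - q n i t| ≤ 2 * Q := (abs_sub _ _).trans (by linarith)
          rw [fdiff, abs_div, abs_of_pos hhn, div_le_div_iff₀ hhn (by positivity)]
          have : mesh c d n ^ 2 ≤ mesh c d n := by nlinarith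
          gcongr
        exact (mul_le_of_le_one_left (abs_nonneg _) hσ).trans h10
      rw [add_div]
      exact add_le_add h9 h8
  · filter_upwards [hK₁, hQ₁] with n h1 hq1 i h2 h3 t ht
    have hhn := hh n
    have p1 := hW.index_pos (n := n) (i := i - 2) (by push_cast; linarith)
    have p2 := hW.index_lt (n := n) (i := i + 2) (by push_cast; linarith)
    have hs := hW.scheme n
    have ht0 : t ∈ Ioc 0 S := ⟨by linarith [ht.1], ht.2⟩
    have ht' : t ∈ Icc 0 S := Ioc_subset_Icc_self ht0
    have w2 := hW.w_mem (n := n) (i := i + 2) (by omega) (by omega) ht'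
    have w1 := hW.w_mem (n := n) (i := i + 1) (by omega) (by omega) ht'
    have w0 := hW.w_mem (n := n) (i := i) (by omega) (by omega) ht'
    have wm := hW.w_mem (n := n) (i := i - 1) (by omega) (by omega) ht'
    have hmw := hmW n (i + 2) (by push_cast; linarith) (by push_cast; linarith) t ht'
    have hti := Ioc_subset_Icc_self ht
    have sb : ∀ j : ℤ, A₁ ≤ c + j * mesh c d n → c + j * mesh c d n ≤ B₁ →
        |W n (j + 1) t - W n j t| ≤ mesh c d n * K := by
      intro j hj1 hj2
      have := (h1 j hj1 hj2 t hti).trans (le_max_left K₁ 0)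
      rwa [fdiff, abs_div, abs_of_pos hhn, div_le_iff₀' hhn] at this
    have s1 := sb (i + 1) (by push_cast; linarith) (by push_cast; linarith)
    have s0 := sb i (by linarith) (by linarith)
    have sm := sb (i - 1) (by push_cast; linarith) (by push_cast; linarith)
    rw [show i + 1 + 1 = i + 2 by ring] at s1
    rw [show i - 1 + 1 = i by ring] at sm
    have q0 := (hq1 i (by linarith) (by linarith) t hti).trans (le_max_left Q₁ 0)
    have q1 := (hq1 (i + 1) (by push_cast; linarith) (by push_cast; linarith) t hti).trans
      (le_max_left Q₁ 0)
    refine ⟨?_, w2, wm, ?_, ?_⟩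
    · have d1 := hs.hasDerivAt_rate_generator hhn (i := i + 1) (by omega) (by omega) ht0
      have d0 := hs.hasDerivAt_rate_generator hhn (i := i) (by omega) (by omega) ht0
      rw [show i + 1 + 1 = i + 2 by ring, show i + 1 - 1 = i by ring] at d1
      refine ((((d1.sub d0).div_const (mesh c d n)).const_mul σ).add (d0.pow 2)).congr_deriv ?_
      simp only [hq]
      push_cast
      ring
    · rw [abs_le] at s1 s0 sm ⊢
      constructor <;> linarith [s1.1, s1.2, s0.1, s0.2, sm.1, sm.2]
    · have g := rate_sq_generator (w₂ := W n (i + 2) t) (w₁ := W n (i + 1) t) (w₀ := W n i t)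
        (wm := W n (i - 1) t) hhn.ne' (rfl : (q n (i + 2) t - q n (i + 1) t) / mesh c d n = _)
        (rfl : (q n (i + 1) t - q n i t) / mesh c d n = _)
        (rfl : (q n i t - q n (i - 1) t) / mesh c d n = _) σ
      set κ := (W n (i + 2) t - W n (i + 1) t - W n i t + W n (i - 1) t) / mesh c d n ^ 2
        + (q n i t + q n (i + 1) t - 1) with hκ
      have hκD : |κ| ≤ D := by
        have e : κ = 2 * q n i t + 2 * q n (i + 1) t - 3 + W n i t + W n (i + 1) t := by
          simp only [hκ, hq, rate]
          rw [show i + 1 + 1 = i + 2 by ring, show i + 1 - 1 = i by ring]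
          field_simp
          ring
        have hw1 := w1.1
        have hw2 := w1.2
        have hw3 := w0.1
        have hw4 := w0.2
        change |q n i t| ≤ Q at q0
        change |q n (i + 1) t| ≤ Q at q1
        rw [e, abs_le]
        rw [abs_le] at q0 q1
        constructor <;> linarith [q0.1, q0.2, q1.1, q1.2]
      have hs1 : |(W n (i + 2) t - W n (i + 1) t) / mesh c d n| ≤ K := by
        rwa [abs_div, abs_of_pos hhn, div_le_iff₀' hhn]
      have ab := rate_diff_absorption (e := (q n (i + 1) t - q n i t) / mesh c d n)
        (e' := (q n i t - q n (i - 1) t) / mesh c d n) hm hσ q0 hs1 hκD hmw wm.1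
      simp only [fdiff]
      rw [show i + 1 + 1 = i + 2 by ring, show i - 1 + 1 = i by ring, g]
      refine (sub_nonpos.mp ?_)
      refine le_trans (le_of_eq ?_) (sub_nonpos.mpr ab)
      simp only [hq]
      ring

theorem locBdd_rate_slope (hW : SchemeFamily c d M S f W) :
    LocBdd c d S (mesh c d)
      (fdiff (mesh c d) (fun n i t => rate (mesh c d n) (W n) i t)) := by
  intro A B τ hA hB hτ
  obtain ⟨D, hD⟩ := hW.exists_signed_rate_slope_le (σ := 1) (by simp) hA hB hτ
  obtain ⟨D', hD'⟩ := hW.exists_signed_rate_slope_le (σ := -1) (by simp) hA hB hτ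
  refine ⟨max D D', ?_⟩
  filter_upwards [hD, hD'] with n h1 h2 i h3 h4 t ht
  have h5 := h1 i h3 h4 t ht
  have h6 := h2 i h3 h4 t ht
  have h7 := sq_nonneg (rate (mesh c d n) (W n) i t)
  rw [abs_le]
  constructor
  · linarith [le_max_right D D']
  · linarith [le_max_left D D']

end SchemeFamily

theorem abs_sub_le_of_steps {X : ℤ → ℝ} {δ : ℝ} {p q : ℤ}
    (H : ∀ i, p ≤ i → i ≤ q → |X (i + 1) - X i| ≤ δ) {i j : ℤ} (hi : i ∈ Icc p q)
    (hj : j ∈ Icc p q) : |X j - X i| ≤ δ * |(j : ℝ) - i| := by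
  have key : ∀ (k : ℕ) (i : ℤ), p ≤ i → i + k ≤ q → |X (i + k) - X i| ≤ δ * k := by
    intro k i hi
    induction k with
    | zero => intro _; simp
    | succ k ih =>
      intro hk
      push_cast at hk
      have h1 := ih (by linarith)
      have h2 := H (i + k) (by omega) (by omega)
      push_cast
      rw [← add_assoc]
      have h3 := abs_add_le (X (i + k + 1) - X (i + k)) (X (i + k) - X i)
      rw [sub_add_sub_cancel] at h3
      linarith
  rcases le_total i j with h | h
  · obtain ⟨k, rfl⟩ := Int.le.dest h
    have := key k i hi.1 hj.2
    simpa using this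
  · obtain ⟨k, rfl⟩ := Int.le.dest h
    have := key k j hj.1 hi.2
    rw [abs_sub_comm]
    simpa using this

theorem abs_taylor_le_of_second_differences {X : ℤ → ℝ} {δ : ℝ} (hδ : 0 ≤ δ) {p q : ℤ}
    (H : ∀ i, p ≤ i → i ≤ q → |X (i + 2) - 2 * X (i + 1) + X i| ≤ δ) {i j : ℤ}
    (hi : i ∈ Icc p q) (hj : j ∈ Icc p q) :
    |X j - X i - ((j : ℝ) - i) * (X (i + 1) - X i)| ≤ δ * (|(j : ℝ) - i| + 1) ^ 2 := by
  have two_sided : ∀ (g : ℕ → ℝ) (m : ℕ),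
      (∀ k, k + 2 ≤ m → |g (k + 2) - 2 * g (k + 1) + g k| ≤ δ) →
      |g m - g 0 - m * (g 1 - g 0)| ≤ δ * m ^ 2 := by
    intro g m hg
    have h1 := convex_seq_bound g hδ m fun k hk => (abs_le.mp (hg k hk)).1
    have h2 := convex_seq_bound (fun k => -g k) hδ m fun k hk => by
      have := (abs_le.mp (hg k hk)).2
      linarith
    rw [abs_le]
    constructor
    · linarith
    · linarith
  rcases le_total i j with h | h
  · obtain ⟨k, rfl⟩ := Int.le.dest h
    have := two_sided (fun m => X (i + m)) k fun m hm => by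
      have := H (i + m) (by linarith [hi.1]) (by have := hj.2; omega)
      push_cast
      rwa [← add_assoc, ← add_assoc]
    simp only [Nat.cast_zero, add_zero, Nat.cast_one] at this
    push_cast
    rw [add_sub_cancel_left, abs_of_nonneg (Nat.cast_nonneg k : (0 : ℝ) ≤ k)]
    refine this.trans ?_
    gcongr
    linarith
  · obtain ⟨k, rfl⟩ := Int.le.dest h
    have := two_sided (fun m => X (j + k + 1 - m)) (k + 1) fun m hm => by
      have := H (j + k + 1 - (m + 2)) (by have := hj.1; omega) (by have := hi.2; omega)
      push_cast
      rw [show j + k + 1 - ((m : ℤ) + 1) = j + k + 1 - (m + 2) + 1 by ring,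
        show j + k + 1 - (m : ℤ) = j + k + 1 - (m + 2) + 2 by ring]
      convert this using 2
      ring
    simp only [Nat.cast_zero, sub_zero, Nat.cast_one, Nat.cast_add, add_sub_cancel_right] at this
    have e1 : j + k + 1 - ((k : ℤ) + 1) = j := by ring
    rw [e1] at this
    push_cast
    rw [sub_add_cancel_left, abs_neg, abs_of_nonneg (Nat.cast_nonneg k : (0 : ℝ) ≤ k)]
    convert this using 2
    ring

theorem node_convex {c h A B : ℝ} (hh : 0 < h) {i j l : ℤ} (hij : i ≤ l) (hlj : l ≤ j)
    (hA : A ≤ c + i * h) (hB : c + j * h ≤ B) : A ≤ c + l * h ∧ c + l * h ≤ B := by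
  have h1 : (i : ℝ) ≤ l := by exact_mod_cast hij
  have h2 : (l : ℝ) ≤ j := by exact_mod_cast hlj
  constructor <;> nlinarith

theorem LocBdd.abs_sub_le {c d S : ℝ} {h : ℕ → ℝ} (hh : ∀ n, 0 < h n) {X : ℕ → ℤ → ℝ → ℝ}
    (hX : LocBdd c d S h (fdiff h X)) {A B τ : ℝ} (hA : c < A) (hB : B < d) (hτ : 0 < τ) :
    ∃ C ≥ 0, ∀ᶠ n in atTop, ∀ i j : ℤ, A ≤ c + i * h n → c + i * h n ≤ B → A ≤ c + j * h n →
      c + j * h n ≤ B → ∀ t ∈ Icc τ S, |X n j t - X n i t| ≤ C * |j * h n - i * h n| := by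
  obtain ⟨C, hC⟩ := hX A B τ hA hB hτ
  refine ⟨max C 0, le_max_right _ _, ?_⟩
  filter_upwards [hC] with n hn i j hi1 hi2 hj1 hj2 t ht
  have hhn := hh n
  have := abs_sub_le_of_steps (X := fun i => X n i t) (δ := max C 0 * h n) (p := min i j)
    (q := max i j) (i := i) (j := j) ?_ ⟨min_le_left _ _, le_max_left _ _⟩
    ⟨min_le_right _ _, le_max_right _ _⟩
  · refine this.trans_eq ?_
    rw [← sub_mul, abs_mul, abs_of_pos hhn]
    ring
  · intro l hl1 hl2
    have hl : A ≤ c + l * h n ∧ c + l * h n ≤ B := by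
      rcases le_total i j with hij | hij
      · exact node_convex hhn (by simpa [hij] using hl1) (by simpa [hij] using hl2) hi1 hj2
      · exact node_convex hhn (by simpa [hij] using hl1) (by simpa [hij] using hl2) hj1 hi2
    have := hn l hl.1 hl.2 t ht
    rw [fdiff, abs_div, abs_of_pos hhn, div_le_iff₀ hhn] at this
    refine this.trans ?_
    gcongr
    exact le_max_left _ _

theorem LocBdd.abs_taylor_le {c d S : ℝ} {h : ℕ → ℝ} (hh : ∀ n, 0 < h n) {X : ℕ → ℤ → ℝ → ℝ}
    (hX : LocBdd c d S h (fdiff h (fdiff h X))) {A B τ : ℝ} (hA : c < A) (hB : B < d)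
    (hτ : 0 < τ) : ∃ C ≥ 0, ∀ᶠ n in atTop, ∀ i j : ℤ, A ≤ c + i * h n → c + i * h n ≤ B →
      A ≤ c + j * h n → c + j * h n ≤ B → ∀ t ∈ Icc τ S,
      |X n j t - X n i t - (j * h n - i * h n) * fdiff h X n i t|
        ≤ C * (|j * h n - i * h n| + h n) ^ 2 := by
  obtain ⟨C, hC⟩ := hX A B τ hA hB hτ
  refine ⟨max C 0, le_max_right _ _, ?_⟩
  filter_upwards [hC] with n hn i j hi1 hi2 hj1 hj2 t ht
  have hhn := hh n
  have := abs_taylor_le_of_second_differences (X := fun i => X n i t) (δ := max C 0 * h n ^ 2)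
    (p := min i j) (q := max i j) (i := i) (j := j) (by positivity) ?_
    ⟨min_le_left _ _, le_max_left _ _⟩ ⟨min_le_right _ _, le_max_right _ _⟩
  · have e1 : (j * h n - i * h n) * fdiff h X n i t = ((j : ℝ) - i) * (X n (i + 1) t - X n i t) := by
      unfold fdiff
      field_simp
    have e2 : |j * h n - i * h n| = |(j : ℝ) - i| * h n := by
      rw [← sub_mul, abs_mul, abs_of_pos hhn]
    rw [e1, e2]
    refine this.trans_eq ?_
    ring
  · intro l hl1 hl2
    have hl : A ≤ c + l * h n ∧ c + l * h n ≤ B := by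
      rcases le_total i j with hij | hij
      · exact node_convex hhn (by simpa [hij] using hl1) (by simpa [hij] using hl2) hi1 hj2
      · exact node_convex hhn (by simpa [hij] using hl1) (by simpa [hij] using hl2) hj1 hi2
    have := hn l hl.1 hl.2 t ht
    have e : fdiff h (fdiff h X) n l t
        = (X n (l + 2) t - 2 * X n (l + 1) t + X n l t) / h n ^ 2 := by
      unfold fdiff
      rw [show l + 1 + 1 = l + 2 by ring]
      field_simp
      ring
    rw [e, abs_div, abs_of_pos (by positivity : 0 < h n ^ 2), div_le_iff₀ (by positivity)] at this
    refine this.trans ?_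
    gcongr
    exact le_max_left _ _

/-- Equicontinuity in time, uniform in `n` on compact subsets of `(c, d) × (0, S]`. -/
def TimeEqui (c d S : ℝ) (h : ℕ → ℝ) (X : ℕ → ℤ → ℝ → ℝ) : Prop :=
  ∀ A B τ, c < A → B < d → 0 < τ → ∀ ε > 0, ∃ δ > 0, ∀ᶠ n in atTop, ∀ i : ℤ, A ≤ c + i * h n →
    c + i * h n ≤ B → ∀ t ∈ Icc τ S, ∀ t' ∈ Icc τ S, |t' - t| ≤ δ → |X n i t' - X n i t| ≤ ε

theorem TimeEqui.shift {c d S : ℝ} {h : ℕ → ℝ} {X : ℕ → ℤ → ℝ → ℝ} (hX : TimeEqui c d S h X)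
    (hh : Tendsto h atTop (𝓝 0)) (k : ℤ) : TimeEqui c d S h (fun n i t => X n (i + k) t) := by
  intro A B τ hA hB hτ ε hε
  obtain ⟨δ, hδ, hC⟩ := hX ((c + A) / 2) ((B + d) / 2) τ (by linarith) (by linarith) hτ ε hε
  refine ⟨δ, hδ, ?_⟩
  filter_upwards [hC, eventually_shift hh (show (c + A) / 2 < A by linarith)
    (show B < (B + d) / 2 by linarith) k c] with n h1 h2 i h3 h4 t ht
  exact h1 _ (h2 i h3 h4).1 (h2 i h3 h4).2 t ht

theorem TimeEqui.forwardDiff {c d S : ℝ} {h : ℕ → ℝ} (hh : ∀ n, 0 < h n) (hh0 : Tendsto h atTop (𝓝 0))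
    {X : ℕ → ℤ → ℝ → ℝ} (hX : TimeEqui c d S h X) (hX2 : LocBdd c d S h (fdiff h (fdiff h X))) :
    TimeEqui c d S h (fdiff h X) := by
  intro A B τ hA hB hτ ε hε
  set B' := (B + d) / 2 with hB'
  obtain ⟨C, hC0, hC⟩ := hX2.abs_taylor_le hh hA (show B' < d by linarith) hτ
  set κ := min (ε / (36 * (C + 1))) ((d - B) / 4) with hκ
  have hκ0 : 0 < κ := lt_min (by positivity) (by linarith)
  have hκ1 : κ ≤ ε / (36 * (C + 1)) := min_le_left _ _
  have hκ2 : κ ≤ (d - B) / 4 := min_le_right _ _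
  obtain ⟨δ, hδ, hδX⟩ := hX A B' τ hA (by linarith) hτ (ε * κ / 8) (by positivity)
  refine ⟨δ, hδ, ?_⟩
  filter_upwards [hC, hδX, hh0.eventually_lt_const hκ0] with n h1 h2 h3 i hi1 hi2 t ht t' ht' htt
  have hhn := hh n
  obtain ⟨k, hk1, hk2⟩ : ∃ k : ℤ, κ ≤ k * h n ∧ k * h n ≤ 2 * κ := by
    refine ⟨⌈κ / h n⌉, ?_, ?_⟩
    · have := Int.le_ceil (κ / h n)
      rwa [div_le_iff₀ hhn] at this
    · have := (Int.ceil_lt_add_one (κ / h n)).le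
      have h4 := mul_le_mul_of_nonneg_right this hhn.le
      rw [add_mul, div_mul_cancel₀ _ hhn.ne'] at h4
      linarith
  have hj : ((i + k : ℤ) : ℝ) * h n = i * h n + k * h n := by push_cast; ring
  have hj1 : A ≤ c + (i + k : ℤ) * h n := by rw [hj]; linarith
  have hj2 : c + (i + k : ℤ) * h n ≤ B' := by rw [hj]; linarith
  have a1 := h1 i (i + k) hi1 (by linarith) hj1 hj2 t ht
  have a2 := h1 i (i + k) hi1 (by linarith) hj1 hj2 t' ht'
  have a3 := h2 i hi1 (by linarith) t ht t' ht' htt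
  have a4 := h2 (i + k) hj1 hj2 t ht t' ht' htt
  rw [hj, add_sub_cancel_left] at a1 a2
  set K := (k : ℝ) * h n with hK
  have hK0 : 0 < K := by linarith
  rw [abs_of_pos hK0] at a1 a2
  have a5 : C * (K + h n) ^ 2 ≤ C * (3 * κ) * (3 * K) := by
    have e1 : K + h n ≤ 3 * κ := by linarith
    have e2 : K + h n ≤ 3 * K := by linarith
    have := mul_le_mul e1 e2 (by positivity) (by positivity)
    have := mul_le_mul_of_nonneg_left this hC0
    linarith
  have a6 : C * (3 * κ) * (3 * K) ≤ ε * K / 4 := by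
    have : C * κ * 36 ≤ ε := by
      have e1 := mul_le_mul_of_nonneg_left hκ1 (by positivity : 0 ≤ 36 * (C + 1))
      rw [mul_div_cancel₀ _ (by positivity)] at e1
      linarith
    have := mul_le_mul_of_nonneg_right this hK0.le
    linarith
  have a7 : ε * κ ≤ ε * K := by gcongr
  have a8 : |K * (fdiff h X n i t' - fdiff h X n i t)| ≤ K * ε := by
    rw [abs_le] at a1 a2 a3 a4 ⊢
    constructor <;> linarith [a1.1, a1.2, a2.1, a2.2, a3.1, a3.2, a4.1, a4.2]
  rw [abs_mul, abs_of_pos hK0] at a8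
  exact le_of_mul_le_mul_left a8 hK0

theorem TimeEqui.add {c d S : ℝ} {h : ℕ → ℝ} {X Y : ℕ → ℤ → ℝ → ℝ} (hX : TimeEqui c d S h X)
    (hY : TimeEqui c d S h Y) : TimeEqui c d S h (fun n i t => X n i t + Y n i t) := by
  intro A B τ hA hB hτ ε hε
  obtain ⟨δ, hδ, h1⟩ := hX A B τ hA hB hτ (ε / 2) (by positivity)
  obtain ⟨δ', hδ', h2⟩ := hY A B τ hA hB hτ (ε / 2) (by positivity)
  refine ⟨min δ δ', lt_min hδ hδ', ?_⟩
  filter_upwards [h1, h2] with n h1 h2 i hi1 hi2 t ht t' ht' htt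
  have e1 := h1 i hi1 hi2 t ht t' ht' (htt.trans (min_le_left _ _))
  have e2 := h2 i hi1 hi2 t ht t' ht' (htt.trans (min_le_right _ _))
  rw [add_sub_add_comm]
  exact (abs_add_le _ _).trans (by linarith)

theorem TimeEqui.mul {c d S : ℝ} {h : ℕ → ℝ} {X Y : ℕ → ℤ → ℝ → ℝ} (hX : TimeEqui c d S h X)
    (hY : TimeEqui c d S h Y) (bX : LocBdd c d S h X) (bY : LocBdd c d S h Y) :
    TimeEqui c d S h (fun n i t => X n i t * Y n i t) := by
  intro A B τ hA hB hτ ε hε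
  obtain ⟨C, hC⟩ := bX A B τ hA hB hτ
  obtain ⟨D, hD⟩ := bY A B τ hA hB hτ
  set E := max (max C D) 0 + 1 with hE
  have hE0 : 0 < E := by linarith [le_max_right (max C D) 0]
  have hCE : C ≤ E := by linarith [le_max_left (max C D) 0, le_max_left C D]
  have hDE : D ≤ E := by linarith [le_max_left (max C D) 0, le_max_right C D]
  obtain ⟨δ, hδ, h1⟩ := hX A B τ hA hB hτ (ε / (2 * E)) (by positivity)
  obtain ⟨δ', hδ', h2⟩ := hY A B τ hA hB hτ (ε / (2 * E)) (by positivity)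
  refine ⟨min δ δ', lt_min hδ hδ', ?_⟩
  filter_upwards [h1, h2, hC, hD] with n h1 h2 h3 h4 i hi1 hi2 t ht t' ht' htt
  have e1 := h1 i hi1 hi2 t ht t' ht' (htt.trans (min_le_left _ _))
  have e2 := h2 i hi1 hi2 t ht t' ht' (htt.trans (min_le_right _ _))
  have e3 := (h3 i hi1 hi2 t' ht').trans hCE
  have e4 := (h4 i hi1 hi2 t ht).trans hDE
  have e : X n i t' * Y n i t' - X n i t * Y n i t =
    X n i t' * (Y n i t' - Y n i t) + (X n i t' - X n i t) * Y n i t := by ring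
  rw [e]
  refine (abs_add_le _ _).trans ?_
  rw [abs_mul, abs_mul]
  have f1 := mul_le_mul e3 e2 (abs_nonneg _) hE0.le
  have f2 := mul_le_mul e1 e4 (abs_nonneg _) (by positivity)
  have f3 : E * (ε / (2 * E)) = ε / 2 := by field_simp
  linarith

theorem TimeEqui.of_hasDerivAt {c d S : ℝ} {h : ℕ → ℝ} {X V : ℕ → ℤ → ℝ → ℝ}
    (hX : ∀ A B τ, c < A → B < d → 0 < τ → ∀ᶠ n in atTop, ∀ i : ℤ, A ≤ c + i * h n →
      c + i * h n ≤ B → ∀ t ∈ Icc τ S, HasDerivAt (X n i) (V n i t) t)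
    (hV : LocBdd c d S h V) : TimeEqui c d S h X := by
  intro A B τ hA hB hτ ε hε
  obtain ⟨C, hC⟩ := hV A B τ hA hB hτ
  refine ⟨ε / (max C 0 + 1), by positivity, ?_⟩
  filter_upwards [hC, hX A B τ hA hB hτ] with n h1 h2 i hi1 hi2 t ht t' ht' htt
  have := (convex_Icc τ S).norm_image_sub_le_of_norm_hasDerivWithin_le
    (fun t ht => (h2 i hi1 hi2 t ht).hasDerivWithinAt)
    (fun t ht => (h1 i hi1 hi2 t ht).trans ((le_max_left C 0).trans
      (le_add_of_nonneg_right zero_le_one))) ht ht'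
  rw [Real.norm_eq_abs, Real.norm_eq_abs] at this
  refine this.trans ?_
  have h3 := mul_le_mul_of_nonneg_left htt (by positivity : 0 ≤ max C 0 + 1)
  rwa [mul_div_cancel₀ _ (by positivity)] at h3

theorem LocBdd.add {c d S : ℝ} {h : ℕ → ℝ} {X Y : ℕ → ℤ → ℝ → ℝ} (hX : LocBdd c d S h X)
    (hY : LocBdd c d S h Y) : LocBdd c d S h (fun n i t => X n i t + Y n i t) := by
  intro A B τ hA hB hτ
  obtain ⟨C, hC⟩ := hX A B τ hA hB hτ
  obtain ⟨D, hD⟩ := hY A B τ hA hB hτ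
  refine ⟨C + D, ?_⟩
  filter_upwards [hC, hD] with n h1 h2 i hi1 hi2 t ht
  exact (abs_add_le _ _).trans (add_le_add (h1 i hi1 hi2 t ht) (h2 i hi1 hi2 t ht))

theorem LocBdd.mul {c d S : ℝ} {h : ℕ → ℝ} {X Y : ℕ → ℤ → ℝ → ℝ} (hX : LocBdd c d S h X)
    (hY : LocBdd c d S h Y) : LocBdd c d S h (fun n i t => X n i t * Y n i t) := by
  intro A B τ hA hB hτ
  obtain ⟨C, hC⟩ := hX A B τ hA hB hτ
  obtain ⟨D, hD⟩ := hY A B τ hA hB hτ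
  refine ⟨C * D, ?_⟩
  filter_upwards [hC, hD] with n h1 h2 i hi1 hi2 t ht
  rw [abs_mul]
  have e1 := h1 i hi1 hi2 t ht
  exact mul_le_mul e1 (h2 i hi1 hi2 t ht) (abs_nonneg _) ((abs_nonneg _).trans e1)

theorem LocBdd.const {c d S : ℝ} {h : ℕ → ℝ} (r : ℝ) : LocBdd c d S h (fun _ _ _ => r) :=
  fun _ _ _ _ _ _ => ⟨|r|, Eventually.of_forall fun _ _ _ _ _ _ => le_rfl⟩

theorem TimeEqui.const {c d S : ℝ} {h : ℕ → ℝ} (r : ℝ) : TimeEqui c d S h (fun _ _ _ => r) := by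
  intro A B τ hA hB hτ ε hε
  refine ⟨1, one_pos, Eventually.of_forall fun n i _ _ t _ t' _ _ => ?_⟩
  simpa using hε.le

/-- Index of the grid node just below `x`. -/
noncomputable def node (c : ℝ) (h : ℕ → ℝ) (x : ℝ) (n : ℕ) : ℤ := ⌊(x - c) / h n⌋

/-- Limit of grid functions along a fixed ultrafilter. -/
noncomputable def gridLim (c : ℝ) (h : ℕ → ℝ) (X : ℕ → ℤ → ℝ → ℝ) (x t : ℝ) : ℝ :=
  limUnder (hyperfilter ℕ : Filter ℕ) (fun n => X n (node c h x n) t)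

section GridLim

variable {c d S : ℝ} {h : ℕ → ℝ} {X : ℕ → ℤ → ℝ → ℝ}

theorem node_mul_le (hh : ∀ n, 0 < h n) (x : ℝ) (n : ℕ) : c + node c h x n * h n ≤ x := by
  have := Int.floor_le ((x - c) / h n)
  rw [le_div_iff₀ (hh n)] at this
  unfold node
  linarith

theorem lt_node_mul (hh : ∀ n, 0 < h n) (x : ℝ) (n : ℕ) : x - h n < c + node c h x n * h n := by
  have := Int.lt_floor_add_one ((x - c) / h n)
  rw [div_lt_iff₀ (hh n)] at this
  unfold node
  linarith

theorem tendsto_node_mul (hh : ∀ n, 0 < h n) (hh0 : Tendsto h atTop (𝓝 0)) (x : ℝ) :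
    Tendsto (fun n => c + node c h x n * h n) atTop (𝓝 x) := by
  refine tendsto_of_tendsto_of_tendsto_of_le_of_le (g := fun n => x - h n) (h := fun _ => x) ?_
    tendsto_const_nhds (fun n => (lt_node_mul hh x n).le) (fun n => node_mul_le hh x n)
  simpa using tendsto_const_nhds.sub hh0

theorem eventually_node_mem (hh : ∀ n, 0 < h n) (hh0 : Tendsto h atTop (𝓝 0)) {A B x : ℝ}
    (hA : A < x) (hB : x ≤ B) : ∀ᶠ n in atTop, A ≤ c + node c h x n * h n ∧
      c + node c h x n * h n ≤ B := by
  filter_upwards [(tendsto_node_mul (c := c) hh hh0 x).eventually_const_lt hA] with n hn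
  exact ⟨hn.le, (node_mul_le hh x n).trans hB⟩

theorem tendsto_gridLim (hh : ∀ n, 0 < h n) (hh0 : Tendsto h atTop (𝓝 0))
    (hX : LocBdd c d S h X) {x t : ℝ} (hx : x ∈ Ioo c d) (ht : t ∈ Ioc 0 S) :
    Tendsto (fun n => X n (node c h x n) t) (hyperfilter ℕ : Filter ℕ)
      (𝓝 (gridLim c h X x t)) := by
  obtain ⟨C, hC⟩ := hX ((c + x) / 2) x t (by linarith [hx.1]) hx.2 ht.1
  have hev : ∀ᶠ n in atTop, X n (node c h x n) t ∈ Icc (-C) C := by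
    filter_upwards [hC, eventually_node_mem hh hh0 (show (c + x) / 2 < x by linarith [hx.1]) le_rfl]
      with n h1 h2
    exact abs_le.mp (h1 _ h2.1 h2.2 t ⟨le_rfl, ht.2⟩)
  have hev' := Nat.hyperfilter_le_atTop hev
  obtain ⟨a, -, ha⟩ := isCompact_Icc.ultrafilter_le_nhds
    ((hyperfilter ℕ).map fun n => X n (node c h x n) t) (le_principal_iff.mpr hev')
  exact tendsto_nhds_limUnder ⟨a, ha⟩

theorem gridLim_eq {x t l : ℝ}
    (hl : Tendsto (fun n => X n (node c h x n) t) (hyperfilter ℕ : Filter ℕ) (𝓝 l)) :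
    gridLim c h X x t = l := hl.limUnder_eq

theorem gridLim_lipschitz (hh : ∀ n, 0 < h n) (hh0 : Tendsto h atTop (𝓝 0))
    (hX : LocBdd c d S h X) (hX1 : LocBdd c d S h (fdiff h X)) {A B τ : ℝ} (hA : c < A)
    (hB : B < d) (hτ : 0 < τ) : ∃ C ≥ 0, ∀ x ∈ Icc A B, ∀ y ∈ Icc A B, ∀ t ∈ Icc τ S,
      |gridLim c h X y t - gridLim c h X x t| ≤ C * |y - x| := by
  have hA' : (c + A) / 2 < A := by linarith
  obtain ⟨C, hC0, hC⟩ := hX1.abs_sub_le hh (show c < (c + A) / 2 by linarith) hB hτ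
  refine ⟨C, hC0, fun x hx y hy t ht => ?_⟩
  have ht' : t ∈ Ioc 0 S := ⟨hτ.trans_le ht.1, ht.2⟩
  have hx' : x ∈ Ioo c d := ⟨by linarith [hx.1], by linarith [hx.2]⟩
  have hy' : y ∈ Ioo c d := ⟨by linarith [hy.1], by linarith [hy.2]⟩
  have l1 := ((tendsto_gridLim hh hh0 hX hy' ht').sub (tendsto_gridLim hh hh0 hX hx' ht')).abs
  have l2 := (((tendsto_node_mul (c := c) hh hh0 y).sub
    (tendsto_node_mul (c := c) hh hh0 x)).abs.const_mul C).mono_left Nat.hyperfilter_le_atTop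
  refine le_of_tendsto_of_tendsto l1 l2 (Nat.hyperfilter_le_atTop ?_)
  filter_upwards [hC, eventually_node_mem hh hh0 (hA'.trans_le hx.1) hx.2,
    eventually_node_mem hh hh0 (hA'.trans_le hy.1) hy.2] with n h1 h2 h3
  simpa using h1 _ _ h2.1 h2.2 h3.1 h3.2 t ht

theorem gridLim_taylor (hh : ∀ n, 0 < h n) (hh0 : Tendsto h atTop (𝓝 0))
    (hX : LocBdd c d S h X) (hX1 : LocBdd c d S h (fdiff h X))
    (hX2 : LocBdd c d S h (fdiff h (fdiff h X))) {A B τ : ℝ} (hA : c < A)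
    (hB : B < d) (hτ : 0 < τ) : ∃ C ≥ 0, ∀ x ∈ Icc A B, ∀ y ∈ Icc A B, ∀ t ∈ Icc τ S,
      |gridLim c h X y t - gridLim c h X x t - (y - x) * gridLim c h (fdiff h X) x t|
        ≤ C * |y - x| ^ 2 := by
  have hA' : (c + A) / 2 < A := by linarith
  obtain ⟨C, hC0, hC⟩ := hX2.abs_taylor_le hh (show c < (c + A) / 2 by linarith) hB hτ
  refine ⟨C, hC0, fun x hx y hy t ht => ?_⟩
  have ht' : t ∈ Ioc 0 S := ⟨hτ.trans_le ht.1, ht.2⟩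
  have hx' : x ∈ Ioo c d := ⟨by linarith [hx.1], by linarith [hx.2]⟩
  have hy' : y ∈ Ioo c d := ⟨by linarith [hy.1], by linarith [hy.2]⟩
  have l0 := (tendsto_node_mul (c := c) hh hh0 y).sub (tendsto_node_mul (c := c) hh hh0 x)
  have l1 := (((tendsto_gridLim hh hh0 hX hy' ht').sub (tendsto_gridLim hh hh0 hX hx' ht')).sub
    ((l0.mono_left Nat.hyperfilter_le_atTop).mul (tendsto_gridLim hh hh0 hX1 hx' ht'))).abs
  have l2 := (((l0.abs.add hh0).pow 2).const_mul C).mono_left Nat.hyperfilter_le_atTop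
  rw [add_zero] at l2
  refine le_of_tendsto_of_tendsto l1 l2 (Nat.hyperfilter_le_atTop ?_)
  filter_upwards [hC, eventually_node_mem hh hh0 (hA'.trans_le hx.1) hx.2,
    eventually_node_mem hh hh0 (hA'.trans_le hy.1) hy.2] with n h1 h2 h3
  simpa using h1 _ _ h2.1 h2.2 h3.1 h3.2 t ht

theorem hasDerivAt_of_abs_taylor_le {g : ℝ → ℝ} {g' x C : ℝ}
    (H : ∀ᶠ y in 𝓝 x, |g y - g x - (y - x) * g'| ≤ C * |y - x| ^ 2) : HasDerivAt g g' x := by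
  rw [hasDerivAt_iff_isLittleO]
  have h1 : (fun y => g y - g x - (y - x) • g') =O[𝓝 x] fun y => ‖y - x‖ ^ 2 := by
    refine Asymptotics.IsBigO.of_bound C ?_
    filter_upwards [H] with y hy
    simpa using hy
  exact h1.trans_isLittleO (Asymptotics.isLittleO_pow_sub_sub x one_lt_two)

theorem hasDerivAt_gridLim (hh : ∀ n, 0 < h n) (hh0 : Tendsto h atTop (𝓝 0))
    (hX : LocBdd c d S h X) (hX1 : LocBdd c d S h (fdiff h X))
    (hX2 : LocBdd c d S h (fdiff h (fdiff h X))) {x t : ℝ} (hx : x ∈ Ioo c d) (ht : t ∈ Ioc 0 S) :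
    HasDerivAt (fun y => gridLim c h X y t) (gridLim c h (fdiff h X) x t) x := by
  obtain ⟨C, -, hC⟩ := gridLim_taylor hh hh0 hX hX1 hX2 (A := (c + x) / 2) (B := (x + d) / 2)
    (by linarith [hx.1]) (by linarith [hx.2]) ht.1
  have h1 : (c + x) / 2 < x := by linarith [hx.1]
  have h2 : x < (x + d) / 2 := by linarith [hx.2]
  refine hasDerivAt_of_abs_taylor_le (C := C) ?_
  filter_upwards [Icc_mem_nhds h1 h2] with y hy
  exact hC x ⟨h1.le, h2.le⟩ y hy t ⟨le_rfl, ht.2⟩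

theorem gridLim_timeEqui (hh : ∀ n, 0 < h n) (hh0 : Tendsto h atTop (𝓝 0))
    (hX : LocBdd c d S h X) (hXt : TimeEqui c d S h X) {A B τ ε : ℝ} (hA : c < A)
    (hB : B < d) (hτ : 0 < τ) (hε : 0 < ε) : ∃ δ > 0, ∀ x ∈ Icc A B, ∀ t ∈ Icc τ S,
      ∀ t' ∈ Icc τ S, |t' - t| ≤ δ → |gridLim c h X x t' - gridLim c h X x t| ≤ ε := by
  have hA' : (c + A) / 2 < A := by linarith
  obtain ⟨δ, hδ, hD⟩ := hXt ((c + A) / 2) B τ (by linarith) hB hτ ε hε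
  refine ⟨δ, hδ, fun x hx t ht t' ht' htt => ?_⟩
  have hx' : x ∈ Ioo c d := ⟨by linarith [hx.1], by linarith [hx.2]⟩
  refine le_of_tendsto ((tendsto_gridLim hh hh0 hX hx' ⟨hτ.trans_le ht'.1, ht'.2⟩).sub
    (tendsto_gridLim hh hh0 hX hx' ⟨hτ.trans_le ht.1, ht.2⟩)).abs (Nat.hyperfilter_le_atTop ?_)
  filter_upwards [hD, eventually_node_mem hh hh0 (hA'.trans_le hx.1) hx.2] with n h1 h2
  exact h1 _ h2.1 h2.2 t ht t' ht' htt

theorem continuousAt_gridLim (hh : ∀ n, 0 < h n) (hh0 : Tendsto h atTop (𝓝 0))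
    (hX : LocBdd c d S h X) (hX1 : LocBdd c d S h (fdiff h X)) (hXt : TimeEqui c d S h X)
    {x t : ℝ} (hx : x ∈ Ioo c d) (ht : t ∈ Ioo 0 S) :
    ContinuousAt (fun p : ℝ × ℝ => gridLim c h X p.1 p.2) (x, t) := by
  have h1 : (c + x) / 2 < x := by linarith [hx.1]
  have h2 : x < (x + d) / 2 := by linarith [hx.2]
  have h3 : t / 2 < t := by linarith [ht.1]
  have hA : c < (c + x) / 2 := by linarith [hx.1]
  have hB : (x + d) / 2 < d := by linarith [hx.2]
  obtain ⟨C, hC0, hC⟩ := gridLim_lipschitz hh hh0 hX hX1 hA hB (half_pos ht.1)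
  rw [Metric.continuousAt_iff]
  intro ε hε
  obtain ⟨δ, hδ, hD⟩ := gridLim_timeEqui hh hh0 hX hXt hA hB (half_pos ht.1) (half_pos hε)
  obtain ⟨r, hr, hrs⟩ := Metric.mem_nhds_iff.mp
    (prod_mem_nhds (Icc_mem_nhds h1 h2) (Icc_mem_nhds h3 ht.2))
  refine ⟨min r (min δ (ε / (2 * (C + 1)))), by positivity, ?_⟩
  rintro ⟨y, s⟩ hys
  have a1 := hrs (show (y, s) ∈ Metric.ball (x, t) r from hys.trans_le (min_le_left _ _))
  rw [Prod.dist_eq, max_lt_iff, Real.dist_eq, Real.dist_eq] at hys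
  have a2 : |y - x| < ε / (2 * (C + 1)) :=
    hys.1.trans_le ((min_le_right _ _).trans (min_le_right _ _))
  have a3 : |s - t| ≤ δ := hys.2.le.trans ((min_le_right _ _).trans (min_le_left _ _))
  have a4 := hC x ⟨h1.le, h2.le⟩ y a1.1 s a1.2
  have a5 := hD x ⟨h1.le, h2.le⟩ t ⟨h3.le, ht.2.le⟩ s a1.2 a3
  rw [Real.dist_eq]
  have a6 : C * |y - x| < ε / 2 := by
    rw [lt_div_iff₀ (by positivity)] at a2
    have := abs_nonneg (y - x)
    have hc := mul_nonneg hC0 this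
    rcases eq_or_lt_of_le this with h | h
    · rw [← h]; simpa using half_pos hε
    · linarith
  have a7 := abs_add_le (gridLim c h X y s - gridLim c h X x s)
    (gridLim c h X x s - gridLim c h X x t)
  rw [sub_add_sub_cancel] at a7
  dsimp only
  linarith

theorem hasDerivAt_time_gridLim (hh : ∀ n, 0 < h n) (hh0 : Tendsto h atTop (𝓝 0))
    (hX : LocBdd c d S h X) {V : ℕ → ℤ → ℝ → ℝ} (hV : LocBdd c d S h V)
    (hVt : TimeEqui c d S h V)
    (hXV : ∀ A B τ, c < A → B < d → 0 < τ → ∀ᶠ n in atTop, ∀ i : ℤ, A ≤ c + i * h n →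
      c + i * h n ≤ B → ∀ t ∈ Icc τ S, HasDerivAt (X n i) (V n i t) t)
    {x t : ℝ} (hx : x ∈ Ioo c d) (ht : t ∈ Ioo 0 S) :
    HasDerivAt (fun s => gridLim c h X x s) (gridLim c h V x t) t := by
  have h1 : (c + x) / 2 < x := by linarith [hx.1]
  have h3 : t / 2 < t := by linarith [ht.1]
  have hA : c < (c + x) / 2 := by linarith [hx.1]
  rw [hasDerivAt_iff_isLittleO, Asymptotics.isLittleO_iff]
  intro ε hε
  obtain ⟨δ, hδ, hD⟩ := hVt _ _ _ hA hx.2 (half_pos ht.1) ε hε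
  have hE := hXV _ _ _ hA hx.2 (half_pos ht.1)
  filter_upwards [Icc_mem_nhds h3 ht.2, Metric.ball_mem_nhds t hδ] with s hs hsδ
  have ht' : t ∈ Ioc 0 S := ⟨ht.1, ht.2.le⟩
  have hs' : s ∈ Ioc 0 S := ⟨by linarith [hs.1, ht.1], hs.2⟩
  rw [Real.norm_eq_abs, Real.norm_eq_abs, smul_eq_mul]
  refine le_of_tendsto (((tendsto_gridLim hh hh0 hX hx hs').sub
    (tendsto_gridLim hh hh0 hX hx ht')).sub
    ((tendsto_gridLim hh hh0 hV hx ht').const_mul (s - t))).abs (Nat.hyperfilter_le_atTop ?_)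
  filter_upwards [hD, hE, eventually_node_mem hh hh0 h1 le_rfl] with n n1 n2 n3
  set i := node c h x n with hi
  have hsub : uIcc t s ⊆ Icc (t / 2) S := by
    exact uIcc_subset_Icc ⟨h3.le, ht.2.le⟩ hs
  have key := (convex_uIcc t s).norm_image_sub_le_of_norm_hasDerivWithin_le
    (f := fun r => X n i r - r * V n i t) (f' := fun r => V n i r - V n i t) (C := ε)
    (fun r hr => ?_) (fun r hr => ?_) left_mem_uIcc right_mem_uIcc
  · rw [Real.norm_eq_abs, Real.norm_eq_abs] at key
    refine le_of_eq_of_le ?_ key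
    congr 1
    ring
  · have := (n2 i n3.1 n3.2 r (hsub hr)).sub ((hasDerivAt_id r).mul_const (V n i t))
    rw [one_mul] at this
    exact this.hasDerivWithinAt
  · have hrt : |r - t| ≤ δ := by
      refine (abs_sub_left_of_mem_uIcc hr).trans ?_
      exact (Metric.mem_ball.mp hsδ).le
    exact n1 i n3.1 n3.2 t ⟨h3.le, ht.2.le⟩ r (hsub hr) hrt

theorem gridLim_shift (hh : ∀ n, 0 < h n) (hh0 : Tendsto h atTop (𝓝 0))
    (hX : LocBdd c d S h X) (hX1 : LocBdd c d S h (fdiff h X)) (k : ℤ) {x t : ℝ}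
    (hx : x ∈ Ioo c d) (ht : t ∈ Ioc 0 S) :
    gridLim c h (fun n i t => X n (i + k) t) x t = gridLim c h X x t := by
  apply gridLim_eq
  have h1 : (c + x) / 2 < x := by linarith [hx.1]
  have h2 : x < (x + d) / 2 := by linarith [hx.2]
  obtain ⟨C, hC0, hC⟩ := hX1.abs_sub_le hh (A := (c + (c + x) / 2) / 2) (B := (x + d) / 2)
    (by linarith) (by linarith [hx.2]) ht.1
  have h0 := tendsto_gridLim hh hh0 hX hx ht
  have hd : Tendsto (fun n => X n (node c h x n + k) t - X n (node c h x n) t)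
      (hyperfilter ℕ : Filter ℕ) (𝓝 0) := by
    refine squeeze_zero_norm' (a := fun n => C * |k * h n|) (Nat.hyperfilter_le_atTop ?_) ?_
    · filter_upwards [hC, eventually_node_mem hh hh0 h1 le_rfl,
        eventually_shift hh0 (A' := (c + (c + x) / 2) / 2) (A := (c + x) / 2) (by linarith) h2 k c]
        with n n1 n2 n3
      have n4 := n3 _ n2.1 n2.2
      have := n1 (node c h x n) (node c h x n + k) (by linarith [n2.1]) (by linarith [n2.2])
        n4.1 n4.2 t ⟨le_rfl, ht.2⟩
      rw [Real.norm_eq_abs]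
      refine this.trans_eq ?_
      push_cast
      ring_nf
    · have := ((hh0.const_mul (k : ℝ)).abs.const_mul C).mono_left Nat.hyperfilter_le_atTop
      simpa using this
  simpa using hd.add h0

end GridLim

/-- The function `u` is a `C^{2,1}` solution of `u_t = |u| u_xx + u (1 - |u|)` near `(x, t)`. -/
def SolvesNear (u : ℝ → ℝ → ℝ) (x t : ℝ) : Prop :=
  ∃ ux uxx ut : ℝ → ℝ → ℝ,
    (∀ᶠ p : ℝ × ℝ in 𝓝 (x, t), HasDerivAt (fun y => u y p.2) (ux p.1 p.2) p.1 ∧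
      HasDerivAt (fun y => ux y p.2) (uxx p.1 p.2) p.1 ∧
      HasDerivAt (fun s => u p.1 s) (ut p.1 p.2) p.2 ∧
      ut p.1 p.2 = |u p.1 p.2| * uxx p.1 p.2 + u p.1 p.2 * (1 - |u p.1 p.2|)) ∧
    ContinuousAt (fun p : ℝ × ℝ => ux p.1 p.2) (x, t) ∧
    ContinuousAt (fun p : ℝ × ℝ => uxx p.1 p.2) (x, t) ∧
    ContinuousAt (fun p : ℝ × ℝ => ut p.1 p.2) (x, t)

namespace SchemeFamily

variable {c d M S : ℝ} {f : ℝ → ℝ} {W : ℕ → ℤ → ℝ → ℝ}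

theorem fdiff_fdiff_eq (hW : SchemeFamily c d M S f W) :
    fdiff (mesh c d) (fdiff (mesh c d) W) =
      fun n i t => rate (mesh c d n) (W n) (i + 1) t + (-1 + W n (i + 1) t) := by
  funext n i t
  have := (mesh_pos hW.lt n).ne'
  simp only [fdiff, rate, add_sub_cancel_right]
  field_simp
  ring

theorem locBdd_fdiff₂ (hW : SchemeFamily c d M S f W) :
    LocBdd c d S (mesh c d) (fdiff (mesh c d) (fdiff (mesh c d) W)) := by
  rw [hW.fdiff_fdiff_eq]
  exact (hW.locBdd_rate.shift (tendsto_mesh c d) 1).add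
    ((LocBdd.const (-1)).add (hW.locBdd.shift (tendsto_mesh c d) 1))

theorem locBdd_fdiff₃ (hW : SchemeFamily c d M S f W) :
    LocBdd c d S (mesh c d) (fdiff (mesh c d) (fdiff (mesh c d) (fdiff (mesh c d) W))) := by
  have : fdiff (mesh c d) (fdiff (mesh c d) (fdiff (mesh c d) W)) = fun n i t =>
      fdiff (mesh c d) (fun n i t => rate (mesh c d n) (W n) i t) n (i + 1) t
        + fdiff (mesh c d) W n (i + 1) t := by
    rw [hW.fdiff_fdiff_eq]
    funext n i t
    simp only [fdiff]
    ring
  rw [this]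
  exact (hW.locBdd_rate_slope.shift (tendsto_mesh c d) 1).add
    (hW.locBdd_slope.shift (tendsto_mesh c d) 1)

theorem hasDerivAt_time (hW : SchemeFamily c d M S f W) (A B τ : ℝ) (hA : c < A) (hB : B < d)
    (hτ : 0 < τ) : ∀ᶠ n in atTop, ∀ i : ℤ, A ≤ c + i * mesh c d n → c + i * mesh c d n ≤ B →
      ∀ t ∈ Icc τ S, HasDerivAt (W n i) (W n i t * rate (mesh c d n) (W n) i t) t := by
  refine Eventually.of_forall fun n i h1 h2 t ht => ?_
  exact (hW.scheme n).deriv i (hW.index_pos (hA.trans_le h1)) (hW.index_lt (h2.trans_lt hB)) t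
    ⟨hτ.trans_le ht.1, ht.2⟩

theorem timeEqui (hW : SchemeFamily c d M S f W) : TimeEqui c d S (mesh c d) W :=
  TimeEqui.of_hasDerivAt hW.hasDerivAt_time (hW.locBdd.mul hW.locBdd_rate)

theorem timeEqui_fdiff (hW : SchemeFamily c d M S f W) :
    TimeEqui c d S (mesh c d) (fdiff (mesh c d) W) :=
  hW.timeEqui.forwardDiff (mesh_pos hW.lt) (tendsto_mesh c d) hW.locBdd_fdiff₂

theorem timeEqui_fdiff₂ (hW : SchemeFamily c d M S f W) :
    TimeEqui c d S (mesh c d) (fdiff (mesh c d) (fdiff (mesh c d) W)) :=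
  hW.timeEqui_fdiff.forwardDiff (mesh_pos hW.lt) (tendsto_mesh c d) hW.locBdd_fdiff₃

theorem rate_eq (hW : SchemeFamily c d M S f W) :
    (fun n i t => rate (mesh c d n) (W n) i t) = fun n i t =>
      fdiff (mesh c d) (fdiff (mesh c d) W) n (i + -1) t + (1 + -1 * W n i t) := by
  rw [hW.fdiff_fdiff_eq]
  funext n i t
  simp only [neg_add_cancel_right]
  ring

theorem timeEqui_rate (hW : SchemeFamily c d M S f W) :
    TimeEqui c d S (mesh c d) (fun n i t => rate (mesh c d n) (W n) i t) := by
  rw [hW.rate_eq]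
  exact (hW.timeEqui_fdiff₂.shift (tendsto_mesh c d) (-1)).add ((TimeEqui.const 1).add
    ((TimeEqui.const (-1)).mul hW.timeEqui (LocBdd.const (-1)) hW.locBdd))

theorem gridLim_velocity (hW : SchemeFamily c d M S f W) {x t : ℝ} (hx : x ∈ Ioo c d)
    (ht : t ∈ Ioc 0 S) :
    gridLim c (mesh c d) (fun n i t => W n i t * rate (mesh c d n) (W n) i t) x t =
      gridLim c (mesh c d) W x t * (gridLim c (mesh c d) (fdiff (mesh c d) (fdiff (mesh c d) W)) x t
        + (1 + -1 * gridLim c (mesh c d) W x t)) := by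
  have hh := mesh_pos hW.lt
  have hh0 := tendsto_mesh c d
  apply gridLim_eq
  have h1 := tendsto_gridLim hh hh0 hW.locBdd hx ht
  have h2 := tendsto_gridLim hh hh0 (hW.locBdd_fdiff₂.shift hh0 (-1)) hx ht
  rw [gridLim_shift hh hh0 hW.locBdd_fdiff₂ hW.locBdd_fdiff₃ (-1) hx ht] at h2
  refine (h1.mul (h2.add ((h1.const_mul (-1)).const_add 1))).congr fun n => ?_
  exact congrArg _ (congrFun (congrFun (congrFun hW.rate_eq n) _) t).symm

theorem le_gridLim (hW : SchemeFamily c d M S f W) {x : ℝ} (hx : x ∈ Ioo c d) :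
    ∃ m > 0, ∀ t ∈ Ioc 0 S, m ≤ gridLim c (mesh c d) W x t := by
  have h1 : (c + x) / 2 < x := by linarith [hx.1]
  obtain ⟨m, hm, hmW⟩ := hW.exists_lower_bound (A := (c + x) / 2) (by linarith [hx.1]) hx.2
  refine ⟨m, hm, fun t ht => ?_⟩
  refine ge_of_tendsto (tendsto_gridLim (mesh_pos hW.lt) (tendsto_mesh c d) hW.locBdd hx ht)
    (Nat.hyperfilter_le_atTop ?_)
  filter_upwards [eventually_node_mem (mesh_pos hW.lt) (tendsto_mesh c d) h1 le_rfl] with n hn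
  exact hmW n _ hn.1 hn.2 t (Ioc_subset_Icc_self ht)

theorem solvesNear (hW : SchemeFamily c d M S f W) {x t : ℝ} (hx : x ∈ Ioo c d)
    (ht : t ∈ Ioo 0 S) : SolvesNear (gridLim c (mesh c d) W) x t := by
  have hh := mesh_pos hW.lt
  have hh0 := tendsto_mesh c d
  have hVt := hW.timeEqui.mul hW.timeEqui_rate hW.locBdd hW.locBdd_rate
  have hV := hW.locBdd.mul hW.locBdd_rate
  have c0 := continuousAt_gridLim hh hh0 hW.locBdd hW.locBdd_slope hW.timeEqui hx ht
  have c2 := continuousAt_gridLim hh hh0 hW.locBdd_fdiff₂ hW.locBdd_fdiff₃ hW.timeEqui_fdiff₂ hx ht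
  have hev : ∀ᶠ p : ℝ × ℝ in 𝓝 (x, t), p.1 ∈ Ioo c d ∧ p.2 ∈ Ioo 0 S :=
    prod_mem_nhds (Ioo_mem_nhds hx.1 hx.2) (Ioo_mem_nhds ht.1 ht.2)
  refine ⟨_, _, gridLim c (mesh c d) (fun n i t => W n i t * rate (mesh c d n) (W n) i t), ?_,
    continuousAt_gridLim hh hh0 hW.locBdd_slope hW.locBdd_fdiff₂ hW.timeEqui_fdiff hx ht, c2, ?_⟩
  · filter_upwards [hev] with p hp
    have hp2 := Ioo_subset_Ioc_self hp.2
    refine ⟨hasDerivAt_gridLim hh hh0 hW.locBdd hW.locBdd_slope hW.locBdd_fdiff₂ hp.1 hp2,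
      hasDerivAt_gridLim hh hh0 hW.locBdd_slope hW.locBdd_fdiff₂ hW.locBdd_fdiff₃ hp.1 hp2,
      hasDerivAt_time_gridLim hh hh0 hW.locBdd hV hVt hW.hasDerivAt_time hp.1 hp.2, ?_⟩
    obtain ⟨m, hm, hm'⟩ := hW.le_gridLim hp.1
    rw [hW.gridLim_velocity hp.1 hp2, abs_of_pos (hm.trans_le (hm' _ hp2))]
    ring
  · refine (c0.mul (c2.add ((c0.const_mul (-1)).const_add 1))).congr ?_
    filter_upwards [hev] with p hp
    exact (hW.gridLim_velocity hp.1 (Ioo_subset_Ioc_self hp.2)).symm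

end SchemeFamily

namespace SchemeFamily

variable {c d M S : ℝ} {f : ℝ → ℝ} {W : ℕ → ℤ → ℝ → ℝ}

theorem le_of_quadratic_barrier (hW : SchemeFamily c d M S f W) {x₀ ε K : ℝ} (hK : 0 ≤ K)
    (hf : ∀ x ∈ Icc c d, |f x - f x₀| < ε + K * (x - x₀) ^ 2) {n : ℕ} {i : ℤ} (h0 : 0 ≤ i)
    (h1 : i ≤ n + 1) {t : ℝ} (ht : t ∈ Icc 0 S) :
    |W n i t - f x₀| ≤ ε + K * (c + i * mesh c d n - x₀) ^ 2 + (M * (2 * K + 1 + M) + 1) * t := by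
  have hh := mesh_pos hW.lt n
  have hM := hW.one_le
  set h := mesh c d n with hdef
  set C := M * (2 * K + 1 + M) + 1 with hC
  have hC0 : 0 ≤ C := by positivity
  have hend : c + ((n : ℝ) + 1) * h = d := by linarith [mul_mesh c d n]
  have hfc := abs_lt.mp (hf c ⟨le_rfl, hW.lt.le⟩)
  have hfd := abs_lt.mp (hf d ⟨hW.lt.le, le_rfl⟩)
  have up := (hW.scheme n).lt_of_supersolution
    (v := fun i t => f x₀ + ε + K * (c + i * h - x₀) ^ 2 + C * t) (v' := fun _ _ => C)
    (fun i t => by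
      have := ((hasDerivAt_id' t).const_mul C).const_add (f x₀ + ε + K * (c + i * h - x₀) ^ 2)
      rwa [mul_one] at this)
    (fun i h0 h1 => by
      have := abs_lt.mp (hf _ (Ioo_subset_Icc_self (hW.node_mem h0 h1)))
      linarith)
    (fun t ht => by
      have := mul_nonneg hC0 ht.1
      push_cast
      rw [zero_mul, add_zero]
      linarith)
    (fun t ht => by
      have := mul_nonneg hC0 ht.1
      push_cast
      rw [hend]
      linarith)
    (fun i h0 h1 t ht hv0 hvM => by
      have e : rate h (fun i t => f x₀ + ε + K * (c + i * h - x₀) ^ 2 + C * t) i t =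
          2 * K + 1 - (f x₀ + ε + K * (c + i * h - x₀) ^ 2 + C * t) := by
        unfold rate
        push_cast
        field_simp
        ring
      rw [e]
      nlinarith)
    i t h0 h1 ht
  have lo := (hW.scheme n).lt_of_subsolution
    (v := fun i t => f x₀ - ε - K * (c + i * h - x₀) ^ 2 - C * t) (v' := fun _ _ => -C)
    (fun i t => by
      have := ((hasDerivAt_id' t).const_mul C).const_sub (f x₀ - ε - K * (c + i * h - x₀) ^ 2)
      rwa [mul_one] at this)
    (fun i h0 h1 => by
      have := abs_lt.mp (hf _ (Ioo_subset_Icc_self (hW.node_mem h0 h1)))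
      linarith)
    (fun t ht => by
      have := mul_nonneg hC0 ht.1
      push_cast
      rw [zero_mul, add_zero]
      linarith)
    (fun t ht => by
      have := mul_nonneg hC0 ht.1
      push_cast
      rw [hend]
      linarith)
    (fun i h0 h1 t ht hv0 hvM => by
      have e : rate h (fun i t => f x₀ - ε - K * (c + i * h - x₀) ^ 2 - C * t) i t =
          -2 * K + 1 - (f x₀ - ε - K * (c + i * h - x₀) ^ 2 - C * t) := by
        unfold rate
        push_cast
        field_simp
        ring
      rw [e]
      nlinarith)
    i t h0 h1 ht
  rw [abs_le]
  constructor <;> linarith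

theorem le_of_lateral_barrier (hW : SchemeFamily c d M S f W) {x₀ ε K σ : ℝ} (hε : 0 < ε)
    (hK : 0 ≤ K) (hx₀ : f x₀ ≤ 1) (hpos : ∀ x ∈ Icc c d, 0 ≤ σ * (x - x₀))
    (hf : ∀ x ∈ Icc c d, |f x - f x₀| < ε + K * (σ * (x - x₀)) - (x - x₀) ^ 2 / 2)
    {n : ℕ} {i : ℤ} (h0 : 0 ≤ i) (h1 : i ≤ n + 1) {t : ℝ} (ht : t ∈ Icc 0 S) :
    |W n i t - f x₀| ≤ ε + K * (σ * (c + i * mesh c d n - x₀)) := by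
  have hh := mesh_pos hW.lt n
  have hM := hW.one_le
  set h := mesh c d n with hdef
  have hend : c + ((n : ℝ) + 1) * h = d := by linarith [mul_mesh c d n]
  have hfc := abs_lt.mp (hf c ⟨le_rfl, hW.lt.le⟩)
  have hfd := abs_lt.mp (hf d ⟨hW.lt.le, le_rfl⟩)
  have up := (hW.scheme n).lt_of_supersolution
    (v := fun i _ => f x₀ + ε + K * (σ * (c + i * h - x₀)) - (c + i * h - x₀) ^ 2 / 2)
    (v' := fun _ _ => 0) (fun i t => hasDerivAt_const _ _)
    (fun i h0 h1 => by
      have := abs_lt.mp (hf _ (Ioo_subset_Icc_self (hW.node_mem h0 h1)))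
      linarith)
    (fun t ht => by
      push_cast
      rw [zero_mul, add_zero]
      linarith)
    (fun t ht => by
      push_cast
      rw [hend]
      linarith)
    (fun i h0 h1 t ht hv0 hvM => by
      have e : rate h (fun i _ => f x₀ + ε + K * (σ * (c + i * h - x₀))
          - (c + i * h - x₀) ^ 2 / 2) i t =
          - (f x₀ + ε + K * (σ * (c + i * h - x₀)) - (c + i * h - x₀) ^ 2 / 2) := by
        unfold rate
        push_cast
        field_simp
        ring
      rw [e]
      nlinarith)
    i t h0 h1 ht
  have lo := (hW.scheme n).lt_of_subsolution
    (v := fun i _ => f x₀ - ε - K * (σ * (c + i * h - x₀)))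
    (v' := fun _ _ => 0) (fun i t => hasDerivAt_const _ _)
    (fun i h0 h1 => by
      have := abs_lt.mp (hf _ (Ioo_subset_Icc_self (hW.node_mem h0 h1)))
      have := sq_nonneg (c + i * h - x₀)
      linarith)
    (fun t ht => by
      have := sq_nonneg (c - x₀)
      push_cast
      rw [zero_mul, add_zero]
      linarith)
    (fun t ht => by
      have := sq_nonneg (d - x₀)
      push_cast
      rw [hend]
      linarith)
    (fun i h0 h1 t ht hv0 hvM => by
      have e : rate h (fun i _ => f x₀ - ε - K * (σ * (c + i * h - x₀))) i t =
          1 - (f x₀ - ε - K * (σ * (c + i * h - x₀))) := by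
        unfold rate
        push_cast
        field_simp
        ring
      rw [e]
      have := mul_nonneg hK (hpos _ (Ioo_subset_Icc_self (hW.node_mem h0 h1)))
      exact mul_pos hv0 (by linarith))
    i t h0 h1 ht
  rw [abs_le]
  have := sq_nonneg (c + i * h - x₀)
  constructor <;> linarith

theorem exists_sub_lt (hW : SchemeFamily c d M S f W) {x₀ ε : ℝ} (hx₀ : x₀ ∈ Icc c d)
    (hε : 0 < ε) : ∃ δ > 0, ∀ x ∈ Icc c d, |f x - f x₀| < ε ∨
      (δ ≤ |x - x₀| ∧ |f x - f x₀| < ε + M) := by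
  obtain ⟨δ, hδ, h⟩ := Metric.continuousOn_iff.mp hW.f_cont x₀ hx₀ ε hε
  refine ⟨δ, hδ, fun x hx => ?_⟩
  rcases lt_or_ge |x - x₀| δ with h1 | h1
  · exact Or.inl (h x hx h1)
  · refine Or.inr ⟨h1, abs_lt.mpr ⟨?_, ?_⟩⟩ <;>
      linarith [hW.f_nonneg x hx, hW.f_le x hx, hW.f_nonneg x₀ hx₀, hW.f_le x₀ hx₀]

theorem exists_quadratic_barrier (hW : SchemeFamily c d M S f W) {x₀ ε : ℝ} (hx₀ : x₀ ∈ Icc c d)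
    (hε : 0 < ε) : ∃ K ≥ 0, ∀ x ∈ Icc c d, |f x - f x₀| < ε + K * (x - x₀) ^ 2 := by
  obtain ⟨δ, hδ, h⟩ := hW.exists_sub_lt hx₀ hε
  have hM := hW.one_le
  refine ⟨M / δ ^ 2, by positivity, fun x hx => ?_⟩
  rcases h x hx with h1 | ⟨h1, h2⟩
  · have : 0 ≤ M / δ ^ 2 * (x - x₀) ^ 2 := by positivity
    linarith
  · have h3 : δ ^ 2 ≤ (x - x₀) ^ 2 := by
      rw [← sq_abs (x - x₀)]
      gcongr
    have h4 : M / δ ^ 2 * δ ^ 2 ≤ M / δ ^ 2 * (x - x₀) ^ 2 := by gcongr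
    rw [div_mul_cancel₀ _ (by positivity)] at h4
    linarith

theorem exists_lateral_barrier (hW : SchemeFamily c d M S f W) {x₀ ε σ : ℝ} (hx₀ : x₀ ∈ Icc c d)
    (hε : 0 < ε) (hσ : σ ^ 2 = 1) (hpos : ∀ x ∈ Icc c d, 0 ≤ σ * (x - x₀)) :
    ∃ K ≥ 0, ∀ x ∈ Icc c d,
      |f x - f x₀| < ε + K * (σ * (x - x₀)) - (x - x₀) ^ 2 / 2 := by
  obtain ⟨δ, hδ, h⟩ := hW.exists_sub_lt hx₀ hε
  have hM := hW.one_le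
  have hcd := hW.lt
  refine ⟨M / δ + (d - c), by have := sub_pos.mpr hcd; positivity, fun x hx => ?_⟩
  have e : |x - x₀| = σ * (x - x₀) := by
    rw [← abs_of_nonneg (hpos x hx), abs_mul]
    rcases sq_eq_one_iff.mp hσ with h | h <;> simp [h]
  have h3 : (x - x₀) ^ 2 / 2 ≤ (d - c) * (σ * (x - x₀)) := by
    rw [← sq_abs, e]
    have h4 : σ * (x - x₀) ≤ d - c := by
      rw [← e, abs_le]
      constructor <;> linarith [hx.1, hx.2, hx₀.1, hx₀.2]
    nlinarith [hpos x hx]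
  rw [add_mul]
  rcases h x hx with h1 | ⟨h1, h2⟩
  · have := mul_nonneg (show 0 ≤ M / δ by positivity) (hpos x hx)
    linarith
  · rw [e] at h1
    have h4 : M / δ * δ ≤ M / δ * (σ * (x - x₀)) := by gcongr
    rw [div_mul_cancel₀ _ hδ.ne'] at h4
    linarith

end SchemeFamily

theorem SolvesNear.congr {u v : ℝ → ℝ → ℝ} {x t : ℝ} (hu : SolvesNear u x t)
    (h : ∀ᶠ p : ℝ × ℝ in 𝓝 (x, t), v p.1 p.2 = u p.1 p.2) : SolvesNear v x t := by
  obtain ⟨ux, uxx, ut, h1, h2, h3, h4⟩ := hu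
  refine ⟨ux, uxx, ut, ?_, h2, h3, h4⟩
  filter_upwards [h1, h.eventually_nhds] with p hp hpv
  obtain ⟨e1, e2, e3, e4⟩ := hp
  have c1 : ContinuousAt (fun y => (y, p.2)) p.1 := by fun_prop
  have c2 : ContinuousAt (fun s => (p.1, s)) p.2 := by fun_prop
  refine ⟨e1.congr_of_eventuallyEq (c1.eventually hpv), e2,
    e3.congr_of_eventuallyEq (c2.eventually hpv), ?_⟩
  rw [hpv.self_of_nhds]
  exact e4

theorem SolvesNear.neg {u : ℝ → ℝ → ℝ} {x t : ℝ} (hu : SolvesNear u x t) :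
    SolvesNear (fun x t => -u x t) x t := by
  obtain ⟨ux, uxx, ut, h1, h2, h3, h4⟩ := hu
  refine ⟨fun x t => -ux x t, fun x t => -uxx x t, fun x t => -ut x t, ?_, h2.neg, h3.neg, h4.neg⟩
  filter_upwards [h1] with p hp
  obtain ⟨e1, e2, e3, e4⟩ := hp
  refine ⟨e1.neg, e2.neg, e3.neg, ?_⟩
  rw [abs_neg, e4]
  ring

theorem continuousWithinAt_of_abs_sub_le {X : Type*} [TopologicalSpace X] {g : X → ℝ} {s : Set X}
    {p : X} (H : ∀ ε > 0, ∃ B : X → ℝ, ContinuousAt B p ∧ B p = ε ∧ ∀ q ∈ s, |g q - g p| ≤ B q) :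
    ContinuousWithinAt g s p := by
  rw [ContinuousWithinAt, Metric.tendsto_nhds]
  intro ε hε
  obtain ⟨B, hB, hBp, hgB⟩ := H (ε / 2) (half_pos hε)
  have h1 : ∀ᶠ q in 𝓝 p, B q < ε := hB.eventually_lt_const (by rw [hBp]; linarith)
  filter_upwards [mem_nhdsWithin_of_mem_nhds h1, self_mem_nhdsWithin] with q hq hqs
  exact (hgB q hqs).trans_lt hq

theorem exists_schemeFamily {c d S : ℝ} (hcd : c < d) (hS : 0 < S) {f : ℝ → ℝ}
    (hf : ContinuousOn f (Icc c d)) (hpos : ∀ x ∈ Ioo c d, 0 < f x) (hc : f c ∈ Icc 0 1)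
    (hd : f d ∈ Icc 0 1) : ∃ M W, SchemeFamily c d M S f W := by
  obtain ⟨M₀, hM₀⟩ := isCompact_Icc.bddAbove_image hf
  have hle : ∀ x ∈ Icc c d, f x ≤ max M₀ 1 := fun x hx =>
    (hM₀ (mem_image_of_mem f hx)).trans (le_max_left _ _)
  have h1 : (1 : ℝ) ≤ max M₀ 1 := le_max_right _ _
  have hnn : ∀ x ∈ Icc c d, 0 ≤ f x := by
    intro x hx
    rcases eq_or_lt_of_le hx.1 with h | h
    · rw [← h]; exact hc.1
    rcases eq_or_lt_of_le hx.2 with h' | h'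
    · rw [h']; exact hd.1
    exact (hpos x ⟨h, h'⟩).le
  have hnode : ∀ (n : ℕ) (i : ℤ), 0 < i → i < n + 1 → c + i * mesh c d n ∈ Ioo c d := by
    intro n i h0 h1
    have h2 := mesh_pos hcd n
    have h3 := mul_mesh c d n
    have h4 : (0 : ℝ) < i := by exact_mod_cast h0
    have h5 : (i : ℝ) < n + 1 := by exact_mod_cast h1
    have h6 := mul_lt_mul_of_pos_right h5 h2
    have h7 := mul_pos h4 h2
    constructor <;> linarith
  have hex : ∀ n : ℕ, ∃ w, LineScheme (n + 1) (mesh c d n) (max M₀ 1) S (f c) (f d)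
      (fun i => f (c + i * mesh c d n)) w := fun n =>
    exists_lineScheme (n + 1) (by positivity) h1 hS ⟨hc.1, hc.2.trans h1⟩ ⟨hd.1, hd.2.trans h1⟩ _
      fun i h0 hi => ⟨hpos _ (hnode n i h0 hi), hle _ (Ioo_subset_Icc_self (hnode n i h0 hi))⟩
  choose W hW using hex
  exact ⟨max M₀ 1, W, hcd, h1, hS, hf, hpos, hnn, hle, hc.2, hd.2, hW⟩

namespace SchemeFamily

variable {c d M S : ℝ} {f : ℝ → ℝ} {W : ℕ → ℤ → ℝ → ℝ}

theorem abs_gridLim_sub_le (hW : SchemeFamily c d M S f W) {B : ℝ → ℝ} {x g t : ℝ}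
    (hx : x ∈ Ioo c d) (ht : t ∈ Ioc 0 S) (hB : ContinuousAt B x)
    (h : ∀ (n : ℕ) (i : ℤ), 0 ≤ i → i ≤ n + 1 → |W n i t - g| ≤ B (c + i * mesh c d n)) :
    |gridLim c (mesh c d) W x t - g| ≤ B x := by
  have hh := mesh_pos hW.lt
  have hh0 := tendsto_mesh c d
  have h1 : (c + x) / 2 < x := by linarith [hx.1]
  refine le_of_tendsto_of_tendsto ((tendsto_gridLim hh hh0 hW.locBdd hx ht).sub_const g).abs
    ((hB.tendsto.comp (tendsto_node_mul (c := c) hh hh0 x)).mono_left Nat.hyperfilter_le_atTop)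
    (Nat.hyperfilter_le_atTop ?_)
  filter_upwards [eventually_node_mem hh hh0 h1 le_rfl] with n hn
  exact h n _ (hW.index_pos (lt_of_lt_of_le (by linarith [hx.1]) hn.1)).le
    (hW.index_lt (hn.2.trans_lt hx.2)).le

open Classical in
/-- The limit of the scheme, extended by the data to the parabolic boundary. -/
noncomputable def limit (c d : ℝ) (f : ℝ → ℝ) (W : ℕ → ℤ → ℝ → ℝ) (x t : ℝ) : ℝ :=
  if x ∈ Ioo c d ∧ 0 < t then gridLim c (mesh c d) W x t else f x

theorem abs_limit_sub_le (hW : SchemeFamily c d M S f W) {B : ℝ → ℝ} {x g t : ℝ}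
    (ht : t ∈ Icc 0 S) (hB : Continuous B) (hf : |f x - g| ≤ B x)
    (h : ∀ (n : ℕ) (i : ℤ), 0 ≤ i → i ≤ n + 1 → |W n i t - g| ≤ B (c + i * mesh c d n)) :
    |limit c d f W x t - g| ≤ B x := by
  unfold limit
  split_ifs with hxt
  · exact hW.abs_gridLim_sub_le hxt.1 ⟨hxt.2, ht.2⟩ hB.continuousAt h
  · exact hf

theorem limit_zero (x : ℝ) : limit c d f W x 0 = f x := by simp [limit]

theorem limit_left (t : ℝ) : limit c d f W c t = f c := by simp [limit]

theorem limit_right (t : ℝ) : limit c d f W d t = f d := by simp [limit]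

theorem limit_pos (hW : SchemeFamily c d M S f W) {x t : ℝ} (hx : x ∈ Ioo c d)
    (ht : t ∈ Icc 0 S) : 0 < limit c d f W x t := by
  unfold limit
  split_ifs with hxt
  · obtain ⟨m, hm, h⟩ := hW.le_gridLim hx
    exact hm.trans_le (h t ⟨hxt.2, ht.2⟩)
  · exact hW.f_pos x hx

theorem limit_eventuallyEq {x t : ℝ} (hx : x ∈ Ioo c d) (ht : 0 < t) :
    ∀ᶠ p : ℝ × ℝ in 𝓝 (x, t), limit c d f W p.1 p.2 = gridLim c (mesh c d) W p.1 p.2 := by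
  filter_upwards [prod_mem_nhds (Ioo_mem_nhds hx.1 hx.2) (Ioi_mem_nhds ht)] with p hp
  exact if_pos hp

theorem continuousWithinAt_limit_zero (hW : SchemeFamily c d M S f W) {x₀ : ℝ}
    (hx₀ : x₀ ∈ Icc c d) :
    ContinuousWithinAt (fun p : ℝ × ℝ => limit c d f W p.1 p.2) (Icc c d ×ˢ Icc 0 S) (x₀, 0) := by
  refine continuousWithinAt_of_abs_sub_le fun ε hε => ?_
  obtain ⟨K, hK, hKf⟩ := hW.exists_quadratic_barrier hx₀ hε
  have hM := hW.one_le
  refine ⟨fun p => ε + K * (p.1 - x₀) ^ 2 + (M * (2 * K + 1 + M) + 1) * p.2, by fun_prop,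
    by simp, ?_⟩
  rintro ⟨x, t⟩ ⟨hx, ht⟩
  dsimp only at hx ht ⊢
  rw [limit_zero]
  refine hW.abs_limit_sub_le (B := fun x => ε + K * (x - x₀) ^ 2 + (M * (2 * K + 1 + M) + 1) * t)
    ht (by fun_prop) ?_ fun n i h0 h1 => hW.le_of_quadratic_barrier hK hKf h0 h1 ht
  have : 0 ≤ (M * (2 * K + 1 + M) + 1) * t := mul_nonneg (by positivity) ht.1
  linarith [hKf x hx]

theorem continuousWithinAt_limit_lateral (hW : SchemeFamily c d M S f W) {x₀ σ t₀ : ℝ}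
    (hx₀ : x₀ ∈ Icc c d) (hfx₀ : f x₀ ≤ 1) (hσ : σ ^ 2 = 1)
    (hpos : ∀ x ∈ Icc c d, 0 ≤ σ * (x - x₀)) (hlim : limit c d f W x₀ t₀ = f x₀) :
    ContinuousWithinAt (fun p : ℝ × ℝ => limit c d f W p.1 p.2) (Icc c d ×ˢ Icc 0 S)
      (x₀, t₀) := by
  refine continuousWithinAt_of_abs_sub_le fun ε hε => ?_
  obtain ⟨K, hK, hKf⟩ := hW.exists_lateral_barrier hx₀ hε hσ hpos
  refine ⟨fun p => ε + K * (σ * (p.1 - x₀)), by fun_prop, by simp, ?_⟩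
  rintro ⟨x, t⟩ ⟨hx, ht⟩
  dsimp only at hx ht ⊢
  rw [hlim]
  refine hW.abs_limit_sub_le (B := fun x => ε + K * (σ * (x - x₀)))
    ht (by fun_prop) ?_ fun n i h0 h1 => hW.le_of_lateral_barrier hε hK hfx₀ hpos hKf h0 h1 ht
  linarith [hKf x hx, sq_nonneg (x - x₀)]

theorem solvesNear_limit (hW : SchemeFamily c d M S f W) {x t : ℝ} (hx : x ∈ Ioo c d)
    (ht : t ∈ Ioo 0 S) : SolvesNear (limit c d f W) x t :=
  (hW.solvesNear hx ht).congr (limit_eventuallyEq hx ht.1)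

theorem continuousOn_limit (hW : SchemeFamily c d M S f W) {T : ℝ} (hT : T < S) :
    ContinuousOn (fun p : ℝ × ℝ => limit c d f W p.1 p.2) (Icc c d ×ˢ Icc 0 T) := by
  have hsub : Icc c d ×ˢ Icc 0 T ⊆ Icc c d ×ˢ Icc 0 S :=
    prod_mono le_rfl (Icc_subset_Icc_right hT.le)
  rintro ⟨x, t⟩ ⟨hx, ht⟩
  dsimp only at hx ht
  rcases eq_or_lt_of_le hx.1 with rfl | hc
  · exact (hW.continuousWithinAt_limit_lateral (σ := 1) hx hW.f_left (by norm_num)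
      (fun x hx => by linarith [hx.1]) (limit_left t)).mono hsub
  rcases eq_or_lt_of_le hx.2 with rfl | hd
  · exact (hW.continuousWithinAt_limit_lateral (σ := -1) hx hW.f_right (by norm_num)
      (fun x hx => by linarith [hx.2]) (limit_right t)).mono hsub
  rcases eq_or_lt_of_le ht.1 with rfl | ht0
  · exact (hW.continuousWithinAt_limit_zero hx).mono hsub
  · refine ContinuousAt.continuousWithinAt ?_
    exact (continuousAt_gridLim (mesh_pos hW.lt) (tendsto_mesh c d) hW.locBdd hW.locBdd_slope
      hW.timeEqui ⟨hc, hd⟩ ⟨ht0, ht.2.trans_lt hT⟩).congr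
      (EventuallyEq.symm (limit_eventuallyEq ⟨hc, hd⟩ ht0))

end SchemeFamily

theorem exists_positive_solution {c d T : ℝ} (hcd : c < d) (hT : 0 < T) {f : ℝ → ℝ}
    (hf : ContinuousOn f (Icc c d)) (hpos : ∀ x ∈ Ioo c d, 0 < f x) (hc : f c ∈ Icc 0 1)
    (hd : f d ∈ Icc 0 1) : ∃ w : ℝ → ℝ → ℝ,
      ContinuousOn (fun p : ℝ × ℝ => w p.1 p.2) (Icc c d ×ˢ Icc 0 T) ∧
      (∀ x ∈ Ioo c d, ∀ t ∈ Icc 0 T, 0 < w x t) ∧ (∀ x, w x 0 = f x) ∧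
      (∀ t, w c t = f c) ∧ (∀ t, w d t = f d) ∧
      ∀ x ∈ Ioo c d, ∀ t ∈ Ioc 0 T, SolvesNear w x t := by
  obtain ⟨M, W, hW⟩ := exists_schemeFamily hcd (show 0 < T + 1 by linarith) hf hpos hc hd
  exact ⟨_, hW.continuousOn_limit (lt_add_one T),
    fun x hx t ht => hW.limit_pos hx ⟨ht.1, by linarith [ht.2]⟩,
    SchemeFamily.limit_zero, SchemeFamily.limit_left, SchemeFamily.limit_right,
    fun x hx t ht => hW.solvesNear_limit hx ⟨ht.1, by linarith [ht.2]⟩⟩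

/-- A solution on `[a, b] × [0, T]` with stationary zeros and stationary lateral values. -/
structure StationaryZeroSol (a b T : ℝ) (f : ℝ → ℝ) (w : ℝ → ℝ → ℝ) : Prop where
  cont : ContinuousOn (fun p : ℝ × ℝ => w p.1 p.2) (Icc a b ×ˢ Icc 0 T)
  zero_iff : ∀ x ∈ Ioo a b, ∀ t ∈ Icc 0 T, (w x t = 0 ↔ f x = 0)
  init : ∀ x, w x 0 = f x
  left : ∀ t, w a t = f a
  right : ∀ t, w b t = f b
  solves : ∀ x ∈ Ioo a b, f x ≠ 0 → ∀ t ∈ Ioc 0 T, SolvesNear w x t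

theorem forall_pos_or_forall_neg_of_continuousOn {a b : ℝ} {f : ℝ → ℝ}
    (hf : ContinuousOn f (Ioo a b)) (h0 : ∀ x ∈ Ioo a b, f x ≠ 0) :
    (∀ x ∈ Ioo a b, 0 < f x) ∨ ∀ x ∈ Ioo a b, f x < 0 := by
  by_contra! h
  obtain ⟨⟨x, hx, hfx⟩, ⟨y, hy, hfy⟩⟩ := h
  obtain ⟨z, hz, hfz⟩ := isPreconnected_Ioo.intermediate_value hx hy hf ⟨hfx, hfy⟩
  exact h0 z hz hfz

theorem nonneg_of_pos_on_Ioo {a b : ℝ} (hab : a < b) {f : ℝ → ℝ} (hf : ContinuousOn f (Icc a b))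
    (h : ∀ x ∈ Ioo a b, 0 < f x) {x : ℝ} (hx : x ∈ Icc a b) : 0 ≤ f x := by
  rw [← closure_Ioo hab.ne] at hf hx
  exact le_on_closure (f := fun _ => 0) (fun x hx => (h x hx).le) continuousOn_const hf hx

theorem exists_stationaryZeroSol_of_pos {a b T : ℝ} (hab : a < b) (hT : 0 < T) {f : ℝ → ℝ}
    (hf : ContinuousOn f (Icc a b)) (ha : |f a| ≤ 1) (hb : |f b| ≤ 1)
    (hpos : ∀ x ∈ Ioo a b, 0 < f x) : ∃ w, StationaryZeroSol a b T f w := by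
  obtain ⟨w, h1, h2, h3, h4, h5, h6⟩ := exists_positive_solution hab hT hf hpos
    ⟨nonneg_of_pos_on_Ioo hab hf hpos ⟨le_rfl, hab.le⟩, (abs_le.mp ha).2⟩
    ⟨nonneg_of_pos_on_Ioo hab hf hpos ⟨hab.le, le_rfl⟩, (abs_le.mp hb).2⟩
  exact ⟨w, h1, fun x hx t ht => iff_of_false (h2 x hx t ht).ne' (hpos x hx).ne', h3, h4, h5,
    fun x hx _ => h6 x hx⟩

theorem StationaryZeroSol.neg {a b T : ℝ} {f : ℝ → ℝ} {w : ℝ → ℝ → ℝ}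
    (hw : StationaryZeroSol a b T (fun x => -f x) w) :
    StationaryZeroSol a b T f (fun x t => -w x t) where
  cont := hw.cont.neg
  zero_iff x hx t ht := by simpa using hw.zero_iff x hx t ht
  init x := by simp [hw.init]
  left t := by simp [hw.left]
  right t := by simp [hw.right]
  solves x hx hfx t ht := (hw.solves x hx (by simpa using hfx) t ht).neg

theorem StationaryZeroSol.glue {a b z T : ℝ} {f : ℝ → ℝ} {w₁ w₂ : ℝ → ℝ → ℝ}
    (hz : z ∈ Ioo a b) (hfz : f z = 0) (h₁ : StationaryZeroSol a z T f w₁)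
    (h₂ : StationaryZeroSol z b T f w₂) :
    StationaryZeroSol a b T f (fun x t => if x ≤ z then w₁ x t else w₂ x t) where
  cont := by
    have e : Icc a b ×ˢ Icc 0 T = Icc a z ×ˢ Icc 0 T ∪ Icc z b ×ˢ Icc 0 T := by
      rw [← union_prod, Icc_union_Icc_eq_Icc hz.1.le hz.2.le]
    rw [e]
    refine ContinuousOn.union_of_isClosed ?_ ?_ (isClosed_Icc.prod isClosed_Icc)
      (isClosed_Icc.prod isClosed_Icc)
    · exact h₁.cont.congr fun p hp => if_pos hp.1.2
    · refine h₂.cont.congr fun p hp => ?_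
      rcases eq_or_lt_of_le hp.1.1 with h | h
      · simp only [← h, le_refl, if_true, h₁.right, h₂.left]
      · exact if_neg h.not_ge
  zero_iff x hx t ht := by
    rcases lt_trichotomy x z with h | h | h
    · simpa only [if_pos h.le] using h₁.zero_iff x ⟨hx.1, h⟩ t ht
    · subst h
      simp only [le_refl, if_true, h₁.right]
    · simpa only [if_neg h.not_ge] using h₂.zero_iff x ⟨h, hx.2⟩ t ht
  init x := by
    split_ifs
    exacts [h₁.init x, h₂.init x]
  left t := by rw [if_pos hz.1.le, h₁.left]
  right t := by rw [if_neg hz.2.not_ge, h₂.right]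
  solves x hx hfx t ht := by
    rcases lt_trichotomy x z with h | h | h
    · refine (h₁.solves x ⟨hx.1, h⟩ hfx t ht).congr ?_
      filter_upwards [continuousAt_fst.eventually (Iio_mem_nhds h)] with p hp
      exact if_pos (le_of_lt hp)
    · exact absurd (h ▸ hfz) hfx
    · refine (h₂.solves x ⟨h, hx.2⟩ hfx t ht).congr ?_
      filter_upwards [continuousAt_fst.eventually (Ioi_mem_nhds h)] with p hp
      exact if_neg (not_le_of_gt hp)

theorem exists_stationaryZeroSol {T : ℝ} (hT : 0 < T) {f : ℝ → ℝ} (s : Finset ℝ) :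
    ∀ a b, a < b → ContinuousOn f (Icc a b) → |f a| ≤ 1 → |f b| ≤ 1 →
      (∀ x ∈ Ioo a b, f x = 0 → x ∈ s) → ∃ w, StationaryZeroSol a b T f w := by
  classical
  induction s using Finset.induction_on with
  | empty =>
    intro a b hab hf ha hb hs
    rcases forall_pos_or_forall_neg_of_continuousOn (hf.mono Ioo_subset_Icc_self)
      (fun x hx h => absurd (hs x hx h) (Finset.notMem_empty x)) with h | h
    · exact exists_stationaryZeroSol_of_pos hab hT hf ha hb h
    · obtain ⟨w, hw⟩ := exists_stationaryZeroSol_of_pos (f := fun x => -f x) hab hT hf.neg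
        (by simpa using ha) (by simpa using hb) fun x hx => neg_pos.mpr (h x hx)
      exact ⟨_, hw.neg⟩
  | insert z s hzs ih =>
    intro a b hab hf ha hb hs
    by_cases hz : z ∈ Ioo a b ∧ f z = 0
    · obtain ⟨hz, hfz⟩ := hz
      have hfz' : |f z| ≤ 1 := by simp [hfz]
      obtain ⟨w₁, h₁⟩ := ih a z hz.1 (hf.mono (Icc_subset_Icc_right hz.2.le)) ha hfz'
        fun x hx hfx => (Finset.mem_insert.mp (hs x ⟨hx.1, hx.2.trans hz.2⟩ hfx)).resolve_left
          hx.2.ne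
      obtain ⟨w₂, h₂⟩ := ih z b hz.2 (hf.mono (Icc_subset_Icc_left hz.1.le)) hfz' hb
        fun x hx hfx => (Finset.mem_insert.mp (hs x ⟨hz.1.trans hx.1, hx.2⟩ hfx)).resolve_left
          hx.1.ne'
      exact ⟨_, h₁.glue hz hfz h₂⟩
    · refine ih a b hab hf ha hb fun x hx hfx => ?_
      refine (Finset.mem_insert.mp (hs x hx hfx)).resolve_left ?_
      rintro rfl
      exact hz ⟨hx, hfx⟩

section Regularity

variable {u : ℝ → ℝ → ℝ} {x t : ℝ}

theorem SolvesNear.eventually_pdx_eq {ux : ℝ → ℝ → ℝ}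
    (h : ∀ᶠ p : ℝ × ℝ in 𝓝 (x, t), HasDerivAt (fun y => u y p.2) (ux p.1 p.2) p.1) :
    ∀ᶠ p : ℝ × ℝ in 𝓝 (x, t), ∀ᶠ y in 𝓝 p.1, pdx u y p.2 = ux y p.2 := by
  filter_upwards [h.eventually_nhds] with p hp
  have c1 : ContinuousAt (fun y => (y, p.2)) p.1 := by fun_prop
  filter_upwards [c1.eventually hp] with y hy
  exact hy.deriv

/-- The classical content of `SolvesNear` in terms of the partial derivatives of `u`. -/
theorem SolvesNear.classical {T : ℝ} {s : Set (ℝ × ℝ)} (hu : SolvesNear u x t) (ht : t ≤ T)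
    (hs : ∀ p ∈ s, p.2 ≤ T) :
    DifferentiableAt ℝ (fun y => u y t) x ∧ DifferentiableAt ℝ (fun y => pdx u y t) x ∧
    DifferentiableWithinAt ℝ (fun r => u x r) (Iic T) t ∧
    ContinuousAt (fun p : ℝ × ℝ => pdx u p.1 p.2) (x, t) ∧
    ContinuousAt (fun p : ℝ × ℝ => pdxx u p.1 p.2) (x, t) ∧
    ((x, t) ∈ s → ContinuousWithinAt (fun p : ℝ × ℝ => pdtW T u p.1 p.2) s (x, t)) ∧
    pdtW T u x t = |u x t| * pdxx u x t + u x t * (1 - |u x t|) := by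
  obtain ⟨ux, uxx, ut, h, cx, cxx, ct⟩ := hu
  have hx := SolvesNear.eventually_pdx_eq (h.mono fun p hp => hp.1)
  have hxx : ∀ᶠ p : ℝ × ℝ in 𝓝 (x, t), pdxx u p.1 p.2 = uxx p.1 p.2 := by
    filter_upwards [hx, h] with p hp hp'
    exact (EventuallyEq.deriv_eq hp).trans hp'.2.1.deriv
  have htt : ∀ᶠ p : ℝ × ℝ in 𝓝 (x, t), p.2 ≤ T → pdtW T u p.1 p.2 = ut p.1 p.2 := by
    filter_upwards [h] with p hp hpT
    exact hp.2.2.1.hasDerivWithinAt.derivWithin (uniqueDiffOn_Iic T _ hpT)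
  obtain ⟨e1, e2, e3, e4⟩ := h.self_of_nhds
  refine ⟨e1.differentiableAt, ?_, e3.differentiableAt.differentiableWithinAt,
    cx.congr (hx.mono fun p hp => hp.self_of_nhds.symm), cxx.congr (hxx.mono fun p hp => hp.symm),
    fun hmem => ?_, ?_⟩
  · exact (e2.congr_of_eventuallyEq hx.self_of_nhds).differentiableAt
  · refine ct.continuousWithinAt.congr_of_eventuallyEq_of_mem ?_ hmem
    filter_upwards [mem_nhdsWithin_of_mem_nhds htt, self_mem_nhdsWithin] with p hp hps
    exact hp (hs p hps)
  · rw [htt.self_of_nhds ht, hxx.self_of_nhds]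
    exact e4

end Regularity

theorem mem_QT_diff_NSet {a b T : ℝ} {N₀ : Set ℝ} {p : ℝ × ℝ} :
    p ∈ QT a b T \ NSet N₀ T ↔ p.1 ∈ Ioo a b ∧ p.2 ∈ Ioc 0 T ∧ p.1 ∉ N₀ := by
  constructor
  · rintro ⟨h1, h2⟩
    exact ⟨h1.1, h1.2, fun h => h2 ⟨h, Ioc_subset_Icc_self h1.2⟩⟩
  · rintro ⟨h1, h2, h3⟩
    exact ⟨⟨h1, h2⟩, fun h => h3 h.1⟩

theorem StationaryZeroSol.isClassicalSol {a b T : ℝ} {N₀ : Set ℝ} {u₀ : ℝ → ℝ} {w : ℝ → ℝ → ℝ}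
    (h₀ : InitData a b N₀ u₀) (hw : StationaryZeroSol a b T u₀ w) :
    IsClassicalSol a b T N₀ u₀ w := by
  have key : ∀ p ∈ QT a b T \ NSet N₀ T, _ := fun p hp =>
    (hw.solves p.1 (mem_QT_diff_NSet.mp hp).1
      (fun h => (mem_QT_diff_NSet.mp hp).2.2
        ((h₀.zeros _ (Ioo_subset_Icc_self (mem_QT_diff_NSet.mp hp).1)).mp h)) p.2
      (mem_QT_diff_NSet.mp hp).2.1).classical (T := T) (s := QT a b T \ NSet N₀ T)
      (mem_QT_diff_NSet.mp hp).2.1.2 fun q hq => (mem_QT_diff_NSet.mp hq).2.1.2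
  refine ⟨hw.cont, fun x hx t ht => ?_, fun p hp => (key p hp).1, fun p hp => (key p hp).2.1,
    fun p hp => (key p hp).2.2.1, fun p hp => (key p hp).2.2.2.1.continuousWithinAt,
    fun p hp => (key p hp).2.2.2.2.1.continuousWithinAt,
    fun p hp => (key p hp).2.2.2.2.2.1 hp, fun t _ => (hw.left t).trans h₀.bdry_a,
    fun t _ => (hw.right t).trans h₀.bdry_b, fun x _ => hw.init x,
    fun p hp => (key p hp).2.2.2.2.2.2⟩
  rw [← h₀.zeros x hx]
  rcases eq_or_lt_of_le hx.1 with rfl | h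
  · rw [hw.left]
  rcases eq_or_lt_of_le hx.2 with rfl | h'
  · rw [hw.right]
  exact hw.zero_iff x ⟨h, h'⟩ t ht

theorem InitData.exists_isClassicalSol {a b T : ℝ} (hab : a < b) (hT : 0 < T) {N₀ : Set ℝ}
    {u₀ : ℝ → ℝ} (h₀ : InitData a b N₀ u₀) : ∃ u, IsClassicalSol a b T N₀ u₀ u := by
  obtain ⟨w, hw⟩ := exists_stationaryZeroSol hT h₀.fin.toFinset a b hab h₀.cont
    (by simp [h₀.bdry_a]) (by simp [h₀.bdry_b]) fun x hx hfx => by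
      simpa using (h₀.zeros x (Ioo_subset_Icc_self hx)).mp hfx
  exact ⟨w, hw.isClassicalSol h₀⟩

theorem mul_sq_le_second_difference {φ φ' φ'' : ℝ → ℝ} {x₀ r q : ℝ} (hr : 0 ≤ r)
    (h1 : ∀ x ∈ Icc (x₀ - r) (x₀ + r), HasDerivAt φ (φ' x) x)
    (h2 : ∀ x ∈ Icc (x₀ - r) (x₀ + r), HasDerivAt φ' (φ'' x) x)
    (h3 : ∀ x ∈ Icc (x₀ - r) (x₀ + r), q ≤ φ'' x) :
    q * r ^ 2 ≤ φ (x₀ + r) + φ (x₀ - r) - 2 * φ x₀ := by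
  have mp : ∀ y ∈ Icc 0 r, x₀ + y ∈ Icc (x₀ - r) (x₀ + r) := fun y hy => by
    constructor <;> linarith [hy.1, hy.2]
  have mm : ∀ y ∈ Icc 0 r, x₀ - y ∈ Icc (x₀ - r) (x₀ + r) := fun y hy => by
    constructor <;> linarith [hy.1, hy.2]
  have d1 : ∀ y ∈ Icc 0 r, HasDerivAt (fun y => φ' (x₀ + y) - φ' (x₀ - y) - 2 * q * y)
      (φ'' (x₀ + y) + φ'' (x₀ - y) - 2 * q) y := by
    intro y hy
    have := (((h2 _ (mp y hy)).comp_const_add x₀ y).sub ((h2 _ (mm y hy)).comp_const_sub x₀ y)).sub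
      ((hasDerivAt_id' y).const_mul (2 * q))
    exact this.congr_deriv (by ring)
  have d0 : ∀ y ∈ Icc 0 r, HasDerivAt (fun y => φ (x₀ + y) + φ (x₀ - y) - q * y ^ 2)
      (φ' (x₀ + y) - φ' (x₀ - y) - 2 * q * y) y := by
    intro y hy
    have := (((h1 _ (mp y hy)).comp_const_add x₀ y).add ((h1 _ (mm y hy)).comp_const_sub x₀ y)).sub
      ((hasDerivAt_pow 2 y).const_mul q)
    exact this.congr_deriv (by norm_num; ring)
  have m1 : MonotoneOn (fun y => φ' (x₀ + y) - φ' (x₀ - y) - 2 * q * y) (Icc 0 r) := by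
    refine monotoneOn_of_hasDerivWithinAt_nonneg (convex_Icc 0 r)
      (fun y hy => (d1 y hy).continuousAt.continuousWithinAt)
      (fun y hy => (d1 y (interior_subset hy)).hasDerivWithinAt) fun y hy => ?_
    have hy' := interior_subset hy
    linarith [h3 _ (mp y hy'), h3 _ (mm y hy')]
  have m0 : MonotoneOn (fun y => φ (x₀ + y) + φ (x₀ - y) - q * y ^ 2) (Icc 0 r) := by
    refine monotoneOn_of_hasDerivWithinAt_nonneg (convex_Icc 0 r)
      (fun y hy => (d0 y hy).continuousAt.continuousWithinAt)
      (fun y hy => (d0 y (interior_subset hy)).hasDerivWithinAt) fun y hy => ?_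
    have hy' := interior_subset hy
    simpa using m1 ⟨le_rfl, hr⟩ hy' hy'.1
  have := m0 ⟨le_rfl, hr⟩ ⟨hr, le_rfl⟩ hr
  simp only [add_zero, sub_zero] at this
  linarith

theorem hasDerivAt_parametric_integral {g gx : ℝ → ℝ → ℝ} {A B s t x : ℝ} (hst : s ≤ t)
    (hx : x ∈ Ioo A B) (hg : ∀ y ∈ Ioo A B, ContinuousOn (g y) (Icc s t))
    (hgx : ContinuousOn (fun p : ℝ × ℝ => gx p.1 p.2) (Ioo A B ×ˢ Icc s t))
    (hd : ∀ y ∈ Ioo A B, ∀ r ∈ Icc s t, HasDerivAt (fun y => g y r) (gx y r) y) :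
    HasDerivAt (fun y => ∫ r in s..t, g y r) (∫ r in s..t, gx x r) x := by
  obtain ⟨δ, hδ, hball⟩ := Metric.nhds_basis_closedBall.mem_iff.mp (Ioo_mem_nhds hx.1 hx.2)
  obtain ⟨C, hC⟩ := ((isCompact_closedBall x δ).prod (isCompact_Icc (a := s) (b := t))
    ).bddAbove_image
    (hgx.mono (prod_mono hball le_rfl)).norm
  have hsec : ContinuousOn (gx x) (Icc s t) :=
    hgx.comp (f := fun r => (x, r)) (by fun_prop) fun r hr => ⟨hx, hr⟩
  refine (intervalIntegral.hasDerivAt_integral_of_dominated_loc_of_deriv_le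
    (F := g) (F' := gx) (s := Metric.closedBall x δ) (bound := fun _ => C)
    (Metric.closedBall_mem_nhds x hδ) ?_ ?_ ?_ ?_ intervalIntegrable_const ?_).2
  · filter_upwards [Ioo_mem_nhds hx.1 hx.2] with y hy
    rw [uIoc_of_le hst]
    exact ((hg y hy).mono Ioc_subset_Icc_self).aestronglyMeasurable measurableSet_Ioc
  · exact (hg x hx).intervalIntegrable_of_Icc hst
  · rw [uIoc_of_le hst]
    exact (hsec.mono Ioc_subset_Icc_self).aestronglyMeasurable measurableSet_Ioc
  · refine Eventually.of_forall fun r hr y hy => ?_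
    rw [uIoc_of_le hst] at hr
    exact hC (mem_image_of_mem _ (show (y, r) ∈ Metric.closedBall x δ ×ˢ Icc s t from
      ⟨hy, Ioc_subset_Icc_self hr⟩))
  · refine Eventually.of_forall fun r hr y hy => ?_
    rw [uIoc_of_le hst] at hr
    exact hd y (hball hy) r (Ioc_subset_Icc_self hr)

namespace IsClassicalSol

variable {a b T : ℝ} {N₀ : Set ℝ} {u₀ : ℝ → ℝ} {u v : ℝ → ℝ → ℝ} {σ x t : ℝ}

theorem continuousOn_time (hu : IsClassicalSol a b T N₀ u₀ u) (hx : x ∈ Icc a b) :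
    ContinuousOn (u x) (Icc 0 T) :=
  hu.cont.comp (f := fun r => (x, r)) (by fun_prop) fun _ hr => ⟨hx, hr⟩

theorem sign_mul_pos (hu : IsClassicalSol a b T N₀ u₀ u) (h₀ : InitData a b N₀ u₀)
    (hx : x ∈ Ioo a b) (hσ : 0 < σ * u₀ x) (ht : t ∈ Icc 0 T) : 0 < σ * u x t := by
  by_contra! hneg
  have hx' := Ioo_subset_Icc_self hx
  have hc : ContinuousOn (fun r => σ * u x r) (Icc 0 t) :=
    ((hu.continuousOn_time hx').mono (Icc_subset_Icc_right ht.2)).const_mul σ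
  have h0 : 0 ≤ σ * u x 0 := by rw [hu.init x hx]; exact hσ.le
  obtain ⟨r, hr, hr0⟩ := intermediate_value_Icc' ht.1 hc ⟨hneg, h0⟩
  have hσ0 : σ ≠ 0 := left_ne_zero_of_mul hσ.ne'
  have hur : u x r = 0 := (mul_eq_zero.mp hr0).resolve_left hσ0
  have := (hu.zero_iff x hx' r ⟨hr.1, hr.2.trans ht.2⟩).mp hur
  rw [← h₀.zeros x hx'] at this
  simp [this] at hσ

theorem hasDerivAt_log (hu : IsClassicalSol a b T N₀ u₀ u) (h₀ : InitData a b N₀ u₀)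
    (hx : x ∈ Ioo a b) (hσ1 : σ ^ 2 = 1) (hσ : 0 < σ * u₀ x) (ht : t ∈ Ioo 0 T) :
    HasDerivAt (fun r => σ * Real.log (u x r)) (pdxx u x t + σ - u x t) t := by
  have hxN : x ∉ N₀ := fun h => by
    rw [← h₀.zeros x (Ioo_subset_Icc_self hx)] at h
    simp [h] at hσ
  have hmem : (x, t) ∈ QT a b T \ NSet N₀ T :=
    mem_QT_diff_NSet.mpr ⟨hx, Ioo_subset_Ioc_self ht, hxN⟩
  have hpos := hu.sign_mul_pos h₀ hx hσ (Ioo_subset_Icc_self ht)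
  have hne : u x t ≠ 0 := right_ne_zero_of_mul hpos.ne'
  have hT := Iic_mem_nhds ht.2
  have hd : HasDerivAt (fun r => u x r) (pdtW T u x t) t := by
    have := ((hu.diff_t _ hmem).differentiableAt hT).hasDerivAt
    rwa [← derivWithin_of_mem_nhds hT] at this
  have hpde := hu.pde _ hmem
  dsimp only at hpde
  have habs : |u x t| = σ * u x t := by
    rcases sq_eq_one_iff.mp hσ1 with h | h
    · rw [h, one_mul] at hpos ⊢
      exact abs_of_pos hpos
    · rw [h, neg_one_mul] at hpos ⊢
      exact abs_of_neg (neg_pos.mp hpos)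
  refine ((hd.log hne).const_mul σ).congr_deriv ?_
  rw [hpde, habs]
  field_simp
  linear_combination (pdxx u x t - u x t) * hσ1

theorem hasDerivAt_integral_sub (hu : IsClassicalSol a b T N₀ u₀ u)
    (hv : IsClassicalSol a b T N₀ u₀ v) (h₀ : InitData a b N₀ u₀) {A B s : ℝ}
    (hAB : Ioo A B ⊆ Ioo a b) (hσ1 : σ ^ 2 = 1) (hσ : ∀ y ∈ Ioo A B, 0 < σ * u₀ y)
    (hs : 0 < s) (hst : s ≤ t) (ht : t ≤ T) (hx : x ∈ Ioo A B) :
    HasDerivAt (fun y => ∫ r in s..t, (u y r - v y r))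
      (∫ r in s..t, (pdx u x r - pdx v x r)) x ∧
    HasDerivAt (fun y => ∫ r in s..t, (pdx u y r - pdx v y r))
      (σ * (Real.log (u x t) - Real.log (v x t)) - σ * (Real.log (u x s) - Real.log (v x s))
        + ∫ r in s..t, (u x r - v x r)) x := by
  have hsub : Ioo A B ×ˢ Icc s t ⊆ QT a b T \ NSet N₀ T := by
    rintro ⟨y, r⟩ ⟨hy, hr⟩
    refine mem_QT_diff_NSet.mpr ⟨hAB hy, ⟨hs.trans_le hr.1, hr.2.trans ht⟩, fun h => ?_⟩
    have h1 := hσ y hy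
    rw [(h₀.zeros y (Ioo_subset_Icc_self (hAB hy))).mpr h] at h1
    simp at h1
  have hsec : ∀ {g : ℝ → ℝ → ℝ},
      ContinuousOn (fun p : ℝ × ℝ => g p.1 p.2) (QT a b T \ NSet N₀ T) →
      ∀ y ∈ Ioo A B, ContinuousOn (g y) (Icc s t) := fun hg y hy =>
    hg.comp (f := fun r => (y, r)) (by fun_prop) fun r hr => hsub ⟨hy, hr⟩
  have htime : ∀ {w}, IsClassicalSol a b T N₀ u₀ w → ∀ y ∈ Ioo A B,
      ContinuousOn (w y) (Icc s t) := fun hw y hy =>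
    (hw.continuousOn_time (Ioo_subset_Icc_self (hAB hy))).mono (Icc_subset_Icc hs.le ht)
  have hlog : ∀ {w}, IsClassicalSol a b T N₀ u₀ w →
      ContinuousOn (fun r => σ * Real.log (w x r)) (Icc s t) := fun hw =>
    ((htime hw x hx).log fun r hr => right_ne_zero_of_mul
      (hw.sign_mul_pos h₀ (hAB hx) (hσ x hx) (Icc_subset_Icc hs.le ht hr)).ne').const_mul σ
  refine ⟨hasDerivAt_parametric_integral (g := fun y r => u y r - v y r)
    (gx := fun y r => pdx u y r - pdx v y r) hst hx
    (fun y hy => (htime hu y hy).sub (htime hv y hy))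
    ((hu.cont_x.sub hv.cont_x).mono hsub) fun y hy r hr => ?_, ?_⟩
  · exact (hu.diff_x (y, r) (hsub ⟨hy, hr⟩)).hasDerivAt.sub
          (hv.diff_x (y, r) (hsub ⟨hy, hr⟩)).hasDerivAt
  · have h1 := hasDerivAt_parametric_integral (g := fun y r => pdx u y r - pdx v y r)
      (gx := fun y r => pdxx u y r - pdxx v y r) hst hx
      (fun y hy => (hsec hu.cont_x y hy).sub (hsec hv.cont_x y hy))
      ((hu.cont_xx.sub hv.cont_xx).mono hsub) fun y hy r hr =>
        (hu.diff_xx (y, r) (hsub ⟨hy, hr⟩)).hasDerivAt.sub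
          (hv.diff_xx (y, r) (hsub ⟨hy, hr⟩)).hasDerivAt
    refine h1.congr_deriv ?_
    have i1 : IntervalIntegrable (fun r => pdxx u x r - pdxx v x r) volume s t :=
      ((hsec hu.cont_xx x hx).sub (hsec hv.cont_xx x hx)).intervalIntegrable_of_Icc hst
    have i2 : IntervalIntegrable (fun r => u x r - v x r) volume s t :=
      ((htime hu x hx).sub (htime hv x hx)).intervalIntegrable_of_Icc hst
    have h2 := intervalIntegral.integral_eq_sub_of_hasDerivAt_of_le hst
      ((hlog hu).sub (hlog hv))
      (f' := fun r => pdxx u x r - pdxx v x r - (u x r - v x r)) (fun r hr => by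
        have hr' : r ∈ Ioo 0 T := ⟨hs.trans hr.1, hr.2.trans_le ht⟩
        have := (hu.hasDerivAt_log h₀ (hAB hx) hσ1 (hσ x hx) hr').sub
          (hv.hasDerivAt_log h₀ (hAB hx) hσ1 (hσ x hx) hr')
        exact this.congr_deriv (by ring)) (i1.sub i2)
    rw [intervalIntegral.integral_sub i1 i2] at h2
    simp only [Pi.sub_apply] at h2
    linarith

end IsClassicalSol

theorem ContinuousOn.exists_continuous_extension_Icc_prod {a b T : ℝ} {u : ℝ → ℝ → ℝ} (hab : a ≤ b)
    (hT : 0 ≤ T) (hu : ContinuousOn (fun p : ℝ × ℝ => u p.1 p.2) (Icc a b ×ˢ Icc 0 T)) :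
    ∃ U : ℝ → ℝ → ℝ, Continuous (Function.uncurry U) ∧
      ∀ x ∈ Icc a b, ∀ t ∈ Icc 0 T, U x t = u x t := by
  refine ⟨fun x t => u (projIcc a b hab x) (projIcc 0 T hT t), ?_, fun x hx t ht => ?_⟩
  · exact hu.comp_continuous
      (f := fun p : ℝ × ℝ => ((projIcc a b hab p.1 : ℝ), (projIcc 0 T hT p.2 : ℝ)))
      (by fun_prop) fun p => ⟨(projIcc a b hab p.1).2, (projIcc 0 T hT p.2).2⟩
  · simp [projIcc_of_mem, hx, ht]

theorem nonneg_of_hasDerivAt_of_forall_le {f : ℝ → ℝ} {f' s t : ℝ} (hst : s < t)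
    (hf : HasDerivAt f f' t) (h : ∀ r ∈ Icc s t, f r ≤ f t) : 0 ≤ f' := by
  have h1 := (hasDerivWithinAt_iff_tendsto_slope' (s := Iio t) self_notMem_Iio).mp
    hf.hasDerivWithinAt
  refine ge_of_tendsto h1 ?_
  filter_upwards [Ioo_mem_nhdsLT hst] with r hr
  rw [slope_def_field]
  exact div_nonneg_of_nonpos (sub_nonpos.mpr (h r (Ioo_subset_Icc_self hr)))
    (sub_nonpos.mpr hr.2.le)

namespace IsClassicalSol

variable {a b T : ℝ} {N₀ : Set ℝ} {u₀ : ℝ → ℝ} {u v : ℝ → ℝ → ℝ} {x t : ℝ}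

theorem eq_of_eqOn_Ioo (hu : IsClassicalSol a b T N₀ u₀ u) (hv : IsClassicalSol a b T N₀ u₀ v)
    (hT : 0 < T) (hx : x ∈ Icc a b) (h : EqOn (u x) (v x) (Ioo 0 T)) :
    EqOn (u x) (v x) (Icc 0 T) :=
  h.of_subset_closure (hu.continuousOn_time hx) (hv.continuousOn_time hx) Ioo_subset_Icc_self
    (closure_Ioo hT.ne).ge

theorem eq_of_mem_zeros_or_boundary (hu : IsClassicalSol a b T N₀ u₀ u)
    (hv : IsClassicalSol a b T N₀ u₀ v) (hT : 0 < T) (hx : x ∈ Icc a b)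
    (h : x = a ∨ x = b ∨ x ∈ N₀) : EqOn (u x) (v x) (Icc 0 T) := by
  refine hu.eq_of_eqOn_Ioo hv hT hx fun r hr => ?_
  rcases h with rfl | rfl | h
  · rw [hu.bdry_a r (Ioo_subset_Ioc_self hr), hv.bdry_a r (Ioo_subset_Ioc_self hr)]
  · rw [hu.bdry_b r (Ioo_subset_Ioc_self hr), hv.bdry_b r (Ioo_subset_Ioc_self hr)]
  · rw [(hu.zero_iff x hx r (Ioo_subset_Icc_self hr)).mpr h,
      (hv.zero_iff x hx r (Ioo_subset_Icc_self hr)).mpr h]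

theorem integral_sub_nonpos (hab : a < b) (hT : 0 < T) (h₀ : InitData a b N₀ u₀)
    (hu : IsClassicalSol a b T N₀ u₀ u) (hv : IsClassicalSol a b T N₀ u₀ v)
    (hx : x ∈ Icc a b) (ht : t ∈ Icc 0 T) : ∫ r in 0..t, (u x r - v x r) ≤ 0 := by
  obtain ⟨U, hUc, hU⟩ := hu.cont.exists_continuous_extension_Icc_prod hab.le hT.le
  obtain ⟨V, hVc, hV⟩ := hv.cont.exists_continuous_extension_Icc_prod hab.le hT.le
  have hEc : Continuous (Function.uncurry fun y r => U y r - V y r) := hUc.sub hVc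
  have hEy : ∀ y, Continuous fun r => U y r - V y r := fun y =>
    hEc.comp (Continuous.prodMk_right y)
  set P : ℝ × ℝ → ℝ := fun p => ∫ r in 0..p.2, (U p.1 r - V p.1 r) with hP
  have hPc : Continuous P :=
    intervalIntegral.continuous_parametric_intervalIntegral_of_continuous
      (f := fun (p : ℝ × ℝ) r => U p.1 r - V p.1 r)
      (hEc.comp (f := fun q : (ℝ × ℝ) × ℝ => (q.1.1, q.2)) (by fun_prop)) continuous_snd
  have hPsub : ∀ y ∈ Icc a b, ∀ s ∈ Icc 0 T, ∀ r ∈ Icc 0 T,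
      ∫ τ in s..r, (u y τ - v y τ) = P (y, r) - P (y, s) := by
    intro y hy s hs r hr
    rw [hP]
    dsimp only
    rw [intervalIntegral.integral_interval_sub_left ((hEy y).intervalIntegrable _ _)
      ((hEy y).intervalIntegrable _ _)]
    refine intervalIntegral.integral_congr fun τ hτ => ?_
    have hτ' : τ ∈ Icc 0 T := (uIcc_subset_Icc hs hr) hτ
    simp only [hU y hy τ hτ', hV y hy τ hτ']
  have hP0 : ∀ y, P (y, 0) = 0 := fun y => by simp [hP]
  have h0T : (0 : ℝ) ∈ Icc 0 T := ⟨le_rfl, hT.le⟩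
  rw [hPsub x hx 0 h0T t ht, hP0, sub_zero]
  obtain ⟨⟨x₀, t₀⟩, ⟨hx₀, ht₀⟩, hmax⟩ := (isCompact_Icc (a := a) (b := b)).prod
    (isCompact_Icc (a := (0 : ℝ)) (b := T)) |>.exists_isMaxOn ⟨(x, t), hx, ht⟩ hPc.continuousOn
  have hmax' : ∀ y ∈ Icc a b, ∀ s ∈ Icc 0 T, P (y, s) ≤ P (x₀, t₀) := fun y hy s hs =>
    hmax (mk_mem_prod hy hs)
  refine (hmax' x hx t ht).trans ?_
  by_contra! hp
  dsimp only at hx₀ ht₀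
  have ht₀pos : 0 < t₀ := by
    refine ht₀.1.lt_of_ne fun h => ?_
    rw [← h, hP0] at hp
    exact hp.false
  have hgood : ¬ (x₀ = a ∨ x₀ = b ∨ x₀ ∈ N₀) := fun h => by
    have he := hu.eq_of_mem_zeros_or_boundary hv hT hx₀ h
    have h1 := hPsub x₀ hx₀ 0 h0T t₀ ht₀
    rw [hP0, intervalIntegral.integral_congr (g := fun _ => (0 : ℝ)) fun τ hτ => ?_] at h1
    · simp only [intervalIntegral.integral_zero, sub_zero] at h1
      exact hp.ne h1
    · exact sub_eq_zero.mpr (he (uIcc_subset_Icc h0T ht₀ hτ))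
  push Not at hgood
  obtain ⟨hxa, hxb, hxN⟩ := hgood
  have hxI : x₀ ∈ Ioo a b := ⟨hx₀.1.lt_of_ne' hxa, hx₀.2.lt_of_ne hxb⟩
  have hu₀ : u₀ x₀ ≠ 0 := fun h => hxN ((h₀.zeros x₀ hx₀).mp h)
  obtain ⟨σ, hσ1, hσ⟩ : ∃ σ : ℝ, σ ^ 2 = 1 ∧ 0 < σ * u₀ x₀ := by
    rcases lt_or_gt_of_ne hu₀ with h | h
    · exact ⟨-1, by norm_num, by linarith⟩
    · exact ⟨1, by norm_num, by linarith⟩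
  obtain ⟨ρ, hρ, hball⟩ : ∃ ρ > 0, ∀ y ∈ Ioo (x₀ - ρ) (x₀ + ρ), y ∈ Ioo a b ∧ 0 < σ * u₀ y := by
    have hc : ContinuousAt (fun y => σ * u₀ y) x₀ :=
      (h₀.cont.continuousAt (Icc_mem_nhds hxI.1 hxI.2)).const_mul σ
    have hI : ∀ᶠ y in 𝓝 x₀, y ∈ Ioo a b := Ioo_mem_nhds hxI.1 hxI.2
    have := hI.and (hc.eventually (lt_mem_nhds hσ))
    obtain ⟨ρ, hρ, h⟩ := Metric.eventually_nhds_iff_ball.mp this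
    exact ⟨ρ, hρ, fun y hy => h y (by rwa [Real.ball_eq_Ioo])⟩
  have hEnn : 0 ≤ U x₀ t₀ - V x₀ t₀ := by
    refine nonneg_of_hasDerivAt_of_forall_le ht₀pos
      (intervalIntegral.integral_hasDerivAt_right ((hEy x₀).intervalIntegrable 0 t₀)
        ((hEy x₀).stronglyMeasurableAtFilter _ _) (hEy x₀).continuousAt) fun r hr => ?_
    exact hmax' x₀ hx₀ r ⟨hr.1, hr.2.trans ht₀.2⟩
  set L : ℝ × ℝ → ℝ := fun q => σ * (Real.log (U q.1 q.2) - Real.log (V q.1 q.2)) with hL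
  have hpos : ∀ {w : ℝ → ℝ → ℝ}, IsClassicalSol a b T N₀ u₀ w → ∀ r ∈ Icc 0 T, 0 < σ * w x₀ r :=
    fun hw r hr => hw.sign_mul_pos h₀ hxI hσ hr
  have hLc : ∀ r ∈ Icc 0 T, ContinuousAt L (x₀, r) := fun r hr => by
    refine ((hUc.continuousAt.log ?_).sub (hVc.continuousAt.log ?_)).const_mul σ
    · change U x₀ r ≠ 0
      rw [hU x₀ hx₀ r hr]
      exact right_ne_zero_of_mul (hpos hu r hr).ne'
    · change V x₀ r ≠ 0
      rw [hV x₀ hx₀ r hr]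
      exact right_ne_zero_of_mul (hpos hv r hr).ne'
  have hL0 : L (x₀, 0) = 0 := by
    simp only [hL, hU x₀ hx₀ 0 h0T, hV x₀ hx₀ 0 h0T, hu.init x₀ hxI, hv.init x₀ hxI, sub_self,
      mul_zero]
  have hLt : 0 ≤ L (x₀, t₀) := by
    have hup := hpos hu t₀ ht₀
    have hvp := hpos hv t₀ ht₀
    rw [← hU x₀ hx₀ t₀ ht₀] at hup
    rw [← hV x₀ hx₀ t₀ ht₀] at hvp
    simp only [hL]
    rcases sq_eq_one_iff.mp hσ1 with rfl | rfl
    · have := Real.log_le_log (by linarith) (show V x₀ t₀ ≤ U x₀ t₀ by linarith)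
      linarith
    · have := Real.log_le_log (by linarith) (show -U x₀ t₀ ≤ -V x₀ t₀ by linarith)
      rw [Real.log_neg_eq_log, Real.log_neg_eq_log] at this
      linarith
  set G : ℝ × ℝ → ℝ := fun q => L (q.1, t₀) - L q + (P (q.1, t₀) - P q) with hG
  have hGc : ContinuousAt G (x₀, 0) := by
    have hm : ContinuousAt (fun q : ℝ × ℝ => (q.1, t₀)) (x₀, 0) := by fun_prop
    exact ((ContinuousAt.comp (f := fun q : ℝ × ℝ => (q.1, t₀)) (hLc t₀ ht₀) hm).sub
      (hLc 0 h0T)).add ((hPc.continuousAt.comp hm).sub hPc.continuousAt)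
  have hG0 : P (x₀, t₀) / 2 < G (x₀, 0) := by
    simp only [hG, hL0, hP0]
    linarith
  obtain ⟨ε, hε, hGε⟩ := Metric.eventually_nhds_iff_ball.mp (hGc.eventually (lt_mem_nhds hG0))
  set R := min ε ρ / 2 with hR
  have hRpos : 0 < R := half_pos (lt_min hε hρ)
  have hRε : R < ε := (half_lt_self (lt_min hε hρ)).trans_le (min_le_left _ _)
  have hRρ : R < ρ := (half_lt_self (lt_min hε hρ)).trans_le (min_le_right _ _)
  have hsubρ : Icc (x₀ - R) (x₀ + R) ⊆ Ioo (x₀ - ρ) (x₀ + ρ) :=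
    Icc_subset_Ioo (by linarith) (by linarith)
  have hsubI : Icc (x₀ - R) (x₀ + R) ⊆ Icc a b := fun y hy =>
    Ioo_subset_Icc_self (hball y (hsubρ hy)).1
  have hR1 : x₀ + R ∈ Icc a b := hsubI ⟨by linarith, le_rfl⟩
  have hR2 : x₀ - R ∈ Icc a b := hsubI ⟨le_rfl, by linarith⟩
  set F : ℝ → ℝ := fun s => (P (x₀ + R, t₀) - P (x₀ + R, s)) + (P (x₀ - R, t₀) - P (x₀ - R, s))
    - 2 * (P (x₀, t₀) - P (x₀, s)) with hF
  have hFc : Continuous F := by fun_prop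
  have hF0 : P (x₀, t₀) / 2 * R ^ 2 ≤ F 0 := by
    refine ge_of_tendsto (hFc.continuousWithinAt (s := Ioi 0)) ?_
    filter_upwards [Ioo_mem_nhdsGT (lt_min hε ht₀pos)] with s hs
    have hsε := hs.2.trans_le (min_le_left _ _)
    have hst := hs.2.trans_le (min_le_right _ _)
    have hsT : s ∈ Icc 0 T := ⟨hs.1.le, hst.le.trans ht₀.2⟩
    have hd := fun y (hy : y ∈ Icc (x₀ - R) (x₀ + R)) =>
      hu.hasDerivAt_integral_sub hv h₀ (fun z hz => (hball z hz).1) hσ1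
        (fun z hz => (hball z hz).2) hs.1 hst.le ht₀.2 (hsubρ hy)
    have := mul_sq_le_second_difference hRpos.le (fun y hy => (hd y hy).1)
      (fun y hy => (hd y hy).2) (q := P (x₀, t₀) / 2) fun y hy => by
        have hyI := hsubI hy
        have := hGε (y, s) (by
          rw [Metric.mem_ball, Prod.dist_eq, max_lt_iff, Real.dist_eq, Real.dist_eq, sub_zero,
            abs_of_pos hs.1, abs_lt]
          exact ⟨⟨by linarith [hy.1], by linarith [hy.2]⟩, hsε⟩)
        rw [hPsub y hyI s hsT t₀ ht₀]
        simp only [hG, hL, hU y hyI _ ht₀, hU y hyI _ hsT, hV y hyI _ ht₀, hV y hyI _ hsT] at this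
        exact this.le
    rwa [hPsub _ hR1 s hsT t₀ ht₀, hPsub _ hR2 s hsT t₀ ht₀, hPsub _ hx₀ s hsT t₀ ht₀] at this
  have h1 := hmax' _ hR1 t₀ ht₀
  have h2 := hmax' _ hR2 t₀ ht₀
  have h3 : 0 < P (x₀, t₀) / 2 * R ^ 2 := by positivity
  simp only [hF, hP0] at hF0
  linarith

theorem unique (hab : a < b) (hT : 0 < T) (h₀ : InitData a b N₀ u₀)
    (hu : IsClassicalSol a b T N₀ u₀ u) (hv : IsClassicalSol a b T N₀ u₀ v)
    (hx : x ∈ Icc a b) : EqOn (u x) (v x) (Icc 0 T) := by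
  refine hu.eq_of_eqOn_Ioo hv hT hx fun t ht => ?_
  have hz : ∀ s ∈ Ioo 0 T, ∫ r in 0..s, (u x r - v x r) = 0 := fun s hs => by
    refine le_antisymm (integral_sub_nonpos hab hT h₀ hu hv hx (Ioo_subset_Icc_self hs)) ?_
    have := integral_sub_nonpos hab hT h₀ hv hu hx (Ioo_subset_Icc_self hs)
    simp only [← neg_sub (u x _), intervalIntegral.integral_neg] at this
    linarith
  have hc : ContinuousOn (fun r => u x r - v x r) (Icc 0 T) :=
    (hu.continuousOn_time hx).sub (hv.continuousOn_time hx)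
  have hnhds : Ioo 0 T ∈ 𝓝 t := Ioo_mem_nhds ht.1 ht.2
  have hd := intervalIntegral.integral_hasDerivAt_right
    ((hc.mono (Icc_subset_Icc_right ht.2.le)).intervalIntegrable_of_Icc ht.1.le)
    ((hc.mono Ioo_subset_Icc_self).stronglyMeasurableAtFilter isOpen_Ioo t ht)
    (hc.continuousAt (Icc_mem_nhds ht.1 ht.2))
  have hd0 : HasDerivAt (fun s => ∫ r in 0..s, (u x r - v x r)) 0 t :=
    (hasDerivAt_const t (0 : ℝ)).congr_of_eventuallyEq (by
      filter_upwards [hnhds] with s hs using hz s hs)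
  exact sub_eq_zero.mp (hd.unique hd0)

end IsClassicalSol

/-- Theorem 2.1: existence and uniqueness of the classical solution of the limit problem. -/
theorem stmt0 (a b T : ℝ) (hab : a < b) (hT : 0 < T)
    (N₀ : Set ℝ) (u₀ : ℝ → ℝ) (h₀ : InitData a b N₀ u₀) :
    ∃ u : ℝ → ℝ → ℝ, IsClassicalSol a b T N₀ u₀ u ∧
      ∀ v : ℝ → ℝ → ℝ, IsClassicalSol a b T N₀ u₀ v →
        ∀ x ∈ Set.Icc a b, ∀ t ∈ Set.Icc (0:ℝ) T, v x t = u x t := by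
  obtain ⟨u, hu⟩ := h₀.exists_isClassicalSol hab hT
  exact ⟨u, hu, fun v hv x hx t ht => hv.unique hab hT h₀ hu hx ht⟩
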